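/- arXiv:1309.6401 — 2 statements merged into one kernel-verified Lean document; each statement's English description precedes it below -/
import Mathlib

section
/- The set of points (x, y) ∈ ℂ² with y² = −x(x² + 1)(x² − 2x − 1), [ℚ(x,y) : ℚ] = 2, and x ∉ ℚ is exactly {(i, 0), (−i, 0), (1 + √2, 0), (1 − √2, 0)}; equivalently, any such point has y = 0 and satisfies x² + 1 = 0 or x² − 2x − 1 = 0. (These are the only non-obvious quadratic points on this affine model of the modular curve X₁(16).) -/
namespace X16

def EE (A B C D : ℤ) : ℤ := 2*A^2-2*A*C+C^2-2*B^2+2*B*D-D^2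
def H1 (A B C D : ℤ) : ℤ := (A-B)^2+(C-D-A+B)^2
def Q2 (A B C D : ℤ) : ℤ := 2*(A+B)^2-(C-D)^2
def H3 (A B C D : ℤ) : ℤ := (A+B)^2+(C+D-A-B)^2
def Q4 (A B C D : ℤ) : ℤ := (C+D)^2-2*(A-B)^2
def G1 (A B C D : ℤ) : ℤ := 2*A*C*H1 A B C D
def G2 (A B C D : ℤ) : ℤ := 2*A*D*Q2 A B C D
def G3 (A B C D : ℤ) : ℤ := 2*B*D*H3 A B C D
def G4 (A B C D : ℤ) : ℤ := 2*B*C*Q4 A B C D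
def NN (A B C D : ℤ) : ℤ := 2*A^2+2*B^2+C^2+D^2

structure PP (A B C D : ℤ) : Prop where
  F : (EE A B C D)^2 = 16*A*B*C*D
  g1 : IsSquare (G1 A B C D)
  g2 : IsSquare (G2 A B C D)
  g3 : IsSquare (G3 A B C D)
  g4 : IsSquare (G4 A B C D)

def Sp (A B C D : ℤ) : Prop :=
  (A = 0 ∧ B = 0 ∧ C = D) ∨ (A = 0 ∧ B = 0 ∧ C = -D) ∨
  (C = 0 ∧ D = 0 ∧ A = B) ∨ (C = 0 ∧ D = 0 ∧ A = -B) ∨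
  (A = B ∧ C = 0 ∧ D = 2*A) ∨ (A = B ∧ D = 0 ∧ C = 2*A) ∨
  (A = -B ∧ C = 0 ∧ D = -2*A) ∨ (A = -B ∧ D = 0 ∧ C = 2*A) ∨
  (A = 0 ∧ C = -B ∧ D = B) ∨ (A = 0 ∧ C = B ∧ D = B) ∨
  (B = 0 ∧ C = A ∧ D = -A) ∨ (B = 0 ∧ C = A ∧ D = A)

/-! symmetries -/

lemma Sp_T0 {A B C D : ℤ} (h : Sp B (-A) D (-C)) : Sp A B C D := by
  unfold Sp at *
  rcases h with h|h|h|h|h|h|h|h|h|h|h|h <;>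
  repeat' first | exact Or.inl ⟨by omega, by omega, by omega⟩ | exact ⟨by omega, by omega, by omega⟩ | apply Or.inr
lemma Sp_neg {A B C D : ℤ} (h : Sp (-A) (-B) (-C) (-D)) : Sp A B C D := by
  unfold Sp at *
  rcases h with h|h|h|h|h|h|h|h|h|h|h|h <;>
  repeat' first | exact Or.inl ⟨by omega, by omega, by omega⟩ | exact ⟨by omega, by omega, by omega⟩ | apply Or.inr
lemma Sp_Ti {A B C D : ℤ} (h : Sp C D (2*A) (2*B)) : Sp A B C D := by
  unfold Sp at *
  rcases h with h|h|h|h|h|h|h|h|h|h|h|h <;>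
  repeat' first | exact Or.inl ⟨by omega, by omega, by omega⟩ | exact ⟨by omega, by omega, by omega⟩ | apply Or.inr

lemma Sp_scale {A B C D c : ℤ} (hc : c ≠ 0) : Sp (c*A) (c*B) (c*C) (c*D) ↔ Sp A B C D := by
  have e0 : ∀ u : ℤ, c*u = 0 ↔ u = 0 := fun u => by simp [hc]
  have e1 : ∀ u v : ℤ, c*u = c*v ↔ u = v := fun u v => by simp [hc]
  have e2 : ∀ u v : ℤ, c*u = -(c*v) ↔ u = -v := fun u v => by rw [← mul_neg, e1]
  have e3 : ∀ u v : ℤ, c*u = 2*(c*v) ↔ u = 2*v := fun u v => by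
    rw [show 2*(c*v) = c*(2*v) by ring, e1]
  have e4 : ∀ u v : ℤ, c*u = -2*(c*v) ↔ u = -2*v := fun u v => by
    rw [show -2*(c*v) = c*(-2*v) by ring, e1]
  unfold Sp
  simp only [e0, e1, e2, e3, e4]

lemma PP_T0 {A B C D : ℤ} (h : PP A B C D) : PP B (-A) D (-C) := by
  refine ⟨?_, ?_, ?_, ?_, ?_⟩
  · have := h.F; unfold EE at *; linear_combination this
  · convert h.g3 using 1; unfold G1 G3 H1 H3; ring
  · convert h.g4 using 1; unfold G2 G4 Q2 Q4; ring
  · convert h.g1 using 1; unfold G1 G3 H1 H3; ring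
  · convert h.g2 using 1; unfold G2 G4 Q2 Q4; ring

lemma PP_neg {A B C D : ℤ} (h : PP A B C D) : PP (-A) (-B) (-C) (-D) := by
  refine ⟨?_, ?_, ?_, ?_, ?_⟩
  · have := h.F; unfold EE at *; linear_combination this
  · convert h.g1 using 1; unfold G1 H1; ring
  · convert h.g2 using 1; unfold G2 Q2; ring
  · convert h.g3 using 1; unfold G3 H3; ring
  · convert h.g4 using 1; unfold G4 Q4; ring

lemma isSquare_mul_sq {c n : ℤ} (h : IsSquare n) : IsSquare (c^2*n) :=
  (IsSquare.sq c).mul h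

lemma isSquare_of_mul {m n : ℤ} (hm : m ≠ 0) (h : IsSquare m) (h2 : IsSquare (m*n)) :
    IsSquare n := by
  rw [← Rat.isSquare_intCast_iff] at *
  have hm' : (m:ℚ) ≠ 0 := by exact_mod_cast hm
  have := h2.div h
  rwa [Int.cast_mul, mul_div_cancel_left₀ _ hm'] at this

lemma PP_Ti {A B C D : ℤ} (h : PP A B C D) : PP C D (2*A) (2*B) := by
  refine ⟨?_, ?_, ?_, ?_, ?_⟩
  · have := h.F; unfold EE at *; linear_combination 4*this
  · convert isSquare_mul_sq (c := 2) h.g1 using 1; unfold G1 H1; ring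
  · convert isSquare_mul_sq (c := 2) h.g4 using 1; unfold G2 G4 Q2 Q4; ring
  · convert isSquare_mul_sq (c := 2) h.g3 using 1; unfold G3 H3; ring
  · convert isSquare_mul_sq (c := 2) h.g2 using 1; unfold G2 G4 Q2 Q4; ring

lemma PP_scale {A B C D c : ℤ} (hc : c ≠ 0) :
    PP (c*A) (c*B) (c*C) (c*D) ↔ PP A B C D := by
  have key : ∀ n : ℤ, IsSquare ((c^2)^2*n) ↔ IsSquare n := fun n =>
    ⟨fun h => isSquare_of_mul (by positivity) (IsSquare.sq _) h, fun h => isSquare_mul_sq h⟩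
  have e1 : G1 (c*A) (c*B) (c*C) (c*D) = (c^2)^2*G1 A B C D := by unfold G1 H1; ring
  have e2 : G2 (c*A) (c*B) (c*C) (c*D) = (c^2)^2*G2 A B C D := by unfold G2 Q2; ring
  have e3 : G3 (c*A) (c*B) (c*C) (c*D) = (c^2)^2*G3 A B C D := by unfold G3 H3; ring
  have e4 : G4 (c*A) (c*B) (c*C) (c*D) = (c^2)^2*G4 A B C D := by unfold G4 Q4; ring
  have e0 : EE (c*A) (c*B) (c*C) (c*D) = c^2*EE A B C D := by unfold EE; ring
  constructor
  · rintro ⟨h0, h1, h2, h3, h4⟩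
    rw [e1, key] at h1
    rw [e2, key] at h2
    rw [e3, key] at h3
    rw [e4, key] at h4
    refine ⟨?_, h1, h2, h3, h4⟩
    rw [e0] at h0
    have : c^4 ≠ 0 := by positivity
    apply mul_left_cancel₀ this
    linear_combination h0
  · rintro ⟨h0, h1, h2, h3, h4⟩
    refine ⟨?_, ?_, ?_, ?_, ?_⟩
    · rw [e0]; linear_combination c^4*h0
    · rw [e1, key]; exact h1
    · rw [e2, key]; exact h2
    · rw [e3, key]; exact h3
    · rw [e4, key]; exact h4

/-! products of the `G`s -/
lemma G12 {A B C D : ℤ} (F : (EE A B C D)^2 = 16*A*B*C*D) :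
    IsSquare (G1 A B C D * G2 A B C D) := by
  refine ⟨A*((C-D-A+B)*(4*C*D)-(C+D)*EE A B C D), ?_⟩
  unfold EE G1 G2 H1 Q2 at *
  linear_combination (A^2*(4*C*D-(C+D)^2))*F
lemma G14 {A B C D : ℤ} (F : (EE A B C D)^2 = 16*A*B*C*D) :
    IsSquare (G1 A B C D * G4 A B C D) := by
  refine ⟨C*((A+B)*(EE A B C D)+(C-D-2*A+2*B)*(4*A*B)), ?_⟩
  unfold EE G1 G4 H1 Q4 at *
  linear_combination (C^2*(4*A*B-(A+B)^2))*F
lemma G13 {A B C D : ℤ} (F : (EE A B C D)^2 = 16*A*B*C*D) :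
    H1 A B C D * H3 A B C D = ((A+B)*(C+D)-(A-B)*(C-D))^2 := by
  unfold EE H1 H3 at *
  linear_combination F
lemma G24 {A B C D : ℤ} (F : (EE A B C D)^2 = 16*A*B*C*D) :
    Q2 A B C D * Q4 A B C D = ((C-D-2*A+2*B)*(C+D)-2*(C-D-A+B)*(A+B))^2 := by
  unfold EE Q2 Q4 at *
  linear_combination (-2)*F
lemma G13' {A B C D : ℤ} (F : (EE A B C D)^2 = 16*A*B*C*D) :
    IsSquare (G1 A B C D * G3 A B C D) := by
  rw [← Rat.isSquare_intCast_iff]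
  refine ⟨(EE A B C D * ((A+B)*(C+D)-(A-B)*(C-D)) : ℤ) / 2, ?_⟩
  have h1 := G13 F
  have : 4 * (G1 A B C D * G3 A B C D) = (EE A B C D * ((A+B)*(C+D)-(A-B)*(C-D)))^2 := by
    unfold G1 G3
    rw [mul_pow, F, ← h1]; ring
  have h2 : (4:ℚ) * ((G1 A B C D * G3 A B C D : ℤ) : ℚ) =
    ((EE A B C D * ((A+B)*(C+D)-(A-B)*(C-D)) : ℤ) : ℚ)^2 := by exact_mod_cast this
  linear_combination h2/4
lemma G24' {A B C D : ℤ} (F : (EE A B C D)^2 = 16*A*B*C*D) :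
    IsSquare (G2 A B C D * G4 A B C D) := by
  rw [← Rat.isSquare_intCast_iff]
  refine ⟨(EE A B C D * ((C-D-2*A+2*B)*(C+D)-2*(C-D-A+B)*(A+B)) : ℤ) / 2, ?_⟩
  have h1 := G24 F
  have : 4 * (G2 A B C D * G4 A B C D) = (EE A B C D * ((C-D-2*A+2*B)*(C+D)-2*(C-D-A+B)*(A+B)))^2 := by
    unfold G2 G4
    rw [mul_pow, F, ← h1]; ring
  have h2 : (4:ℚ) * ((G2 A B C D * G4 A B C D : ℤ) : ℚ) =
    ((EE A B C D * ((C-D-2*A+2*B)*(C+D)-2*(C-D-A+B)*(A+B)) : ℤ) : ℚ)^2 := by exact_mod_cast this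
  linear_combination h2/4
lemma G23 {A B C D : ℤ} (F : (EE A B C D)^2 = 16*A*B*C*D) :
    IsSquare (G2 A B C D * G3 A B C D) := by
  refine ⟨D*((A-B)*(EE A B C D)+(2*A+2*B-C-D)*(4*A*B)), ?_⟩
  unfold EE G2 G3 Q2 H3 at *
  linear_combination (D^2*(-4*A*B-(A-B)^2))*F
lemma G34 {A B C D : ℤ} (F : (EE A B C D)^2 = 16*A*B*C*D) :
    IsSquare (G3 A B C D * G4 A B C D) := by
  refine ⟨B*((C+D-A-B)*(4*C*D)+(C-D)*EE A B C D), ?_⟩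
  unfold EE G3 G4 H3 Q4 at *
  linear_combination (B^2*(-4*C*D-(C-D)^2))*F

lemma PP_of_1 {A B C D : ℤ} (F : (EE A B C D)^2 = 16*A*B*C*D)
    (h1 : IsSquare (G1 A B C D)) (h : G1 A B C D ≠ 0) : PP A B C D :=
  ⟨F, h1, isSquare_of_mul h h1 (G12 F), isSquare_of_mul h h1 (G13' F), isSquare_of_mul h h1 (G14 F)⟩
lemma PP_of_2 {A B C D : ℤ} (F : (EE A B C D)^2 = 16*A*B*C*D)
    (h1 : IsSquare (G2 A B C D)) (h : G2 A B C D ≠ 0) : PP A B C D :=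
  ⟨F, isSquare_of_mul h h1 (mul_comm (G1 A B C D) _ ▸ G12 F), h1,
    isSquare_of_mul h h1 (G23 F), isSquare_of_mul h h1 (G24' F)⟩
lemma PP_of_4 {A B C D : ℤ} (F : (EE A B C D)^2 = 16*A*B*C*D)
    (h1 : IsSquare (G4 A B C D)) (h : G4 A B C D ≠ 0) : PP A B C D :=
  ⟨F, isSquare_of_mul h h1 (mul_comm (G1 A B C D) _ ▸ G14 F),
    isSquare_of_mul h h1 (mul_comm (G2 A B C D) _ ▸ G24' F),
    isSquare_of_mul h h1 (mul_comm (G3 A B C D) _ ▸ G34 F), h1⟩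

end X16


namespace X16

lemma prim4 (a b c d : ℤ) (h : ¬(a = 0 ∧ b = 0 ∧ c = 0 ∧ d = 0)) :
    ∃ g a' b' c' d' m1 m2 m3 m4 : ℤ, g ≠ 0 ∧ a = g*a' ∧ b = g*b' ∧ c = g*c' ∧ d = g*d' ∧
      m1*a'+m2*b'+m3*c'+m4*d' = 1 := by
  obtain ⟨g, hg⟩ := (IsPrincipalIdealRing.principal (Ideal.span {a, b, c, d} : Ideal ℤ)).principal
  have ha : a ∈ Ideal.span ({a, b, c, d} : Set ℤ) := Ideal.subset_span (by simp)
  have hb : b ∈ Ideal.span ({a, b, c, d} : Set ℤ) := Ideal.subset_span (by simp)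
  have hc : c ∈ Ideal.span ({a, b, c, d} : Set ℤ) := Ideal.subset_span (by simp)
  have hd : d ∈ Ideal.span ({a, b, c, d} : Set ℤ) := Ideal.subset_span (by simp)
  have hgm : g ∈ Ideal.span ({a, b, c, d} : Set ℤ) := by
    rw [hg]; exact Submodule.mem_span_singleton_self g
  rw [hg] at ha hb hc hd
  obtain ⟨a', rfl⟩ := Submodule.mem_span_singleton.1 ha
  obtain ⟨b', rfl⟩ := Submodule.mem_span_singleton.1 hb
  obtain ⟨c', rfl⟩ := Submodule.mem_span_singleton.1 hc
  obtain ⟨d', rfl⟩ := Submodule.mem_span_singleton.1 hd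
  simp only [smul_eq_mul] at *
  have hg0 : g ≠ 0 := by
    rintro rfl; simp at h
  simp only [Ideal.mem_span_insert, Ideal.mem_span_singleton'] at hgm
  obtain ⟨m1, _, ⟨m2, _, ⟨m3, _, ⟨m4, rfl⟩, rfl⟩, rfl⟩, hh⟩ := hgm
  refine ⟨g, a', b', c', d', m1, m2, m3, m4, hg0, by ring, by ring, by ring, by ring, ?_⟩
  apply mul_left_cancel₀ hg0
  linear_combination -hh

lemma rank1_aux (aa bb cc dd ab ac ad bc bd cd v1 v2 v3 v4 r : ℤ) (hr : r ≠ 0)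
    (tr : 0 < 2*aa+2*bb+cc+dd)
    (haa : v1*v1 = r*aa) (hbb : v2*v2 = r*bb) (hcc : v3*v3 = r*cc) (hdd : v4*v4 = r*dd)
    (hab : v1*v2 = r*ab) (hac : v1*v3 = r*ac) (had : v1*v4 = r*ad)
    (hbc : v2*v3 = r*bc) (hbd : v2*v4 = r*bd) (hcd : v3*v4 = r*cd) :
    ∃ c A B C D : ℤ, 0 < c ∧ aa = c*(A*A) ∧ bb = c*(B*B) ∧ cc = c*(C*C) ∧ dd = c*(D*D) ∧
      ab = c*(A*B) ∧ ac = c*(A*C) ∧ ad = c*(A*D) ∧ bc = c*(B*C) ∧ bd = c*(B*D) ∧ cd = c*(C*D) := by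
  have hv : ¬(v1 = 0 ∧ v2 = 0 ∧ v3 = 0 ∧ v4 = 0) := by
    rintro ⟨rfl, rfl, rfl, rfl⟩
    simp [hr] at haa hbb hcc hdd
    omega
  obtain ⟨g, A, B, C, D, m1, m2, m3, m4, hg, rfl, rfl, rfl, rfl, hm⟩ := prim4 _ _ _ _ hv
  set c := m1*m1*aa+m2*m2*bb+m3*m3*cc+m4*m4*dd+2*m1*m2*ab+2*m1*m3*ac+2*m1*m4*ad+2*m2*m3*bc
    +2*m2*m4*bd+2*m3*m4*cd with hc
  have hrc : r*c = g^2 := by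
    have : r*c = g^2*(m1*A+m2*B+m3*C+m4*D)^2 := by
      rw [hc]
      linear_combination (-m1*m1)*haa-m2*m2*hbb-m3*m3*hcc-m4*m4*hdd-2*m1*m2*hab-2*m1*m3*hac
        -2*m1*m4*had-2*m2*m3*hbc-2*m2*m4*hbd-2*m3*m4*hcd
    rw [this, hm]; ring
  clear_value c
  have key : ∀ s u v : ℤ, (g*u)*(g*v) = r*s → s = c*(u*v) := fun s u v h => by
    apply mul_left_cancel₀ hr
    linear_combination -h - u*v*hrc
  have e1 := key _ _ _ haa
  have e2 := key _ _ _ hbb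
  have e3 := key _ _ _ hcc
  have e4 := key _ _ _ hdd
  refine ⟨c, A, B, C, D, ?_, e1, e2, e3, e4, key _ _ _ hab, key _ _ _ hac, key _ _ _ had,
    key _ _ _ hbc, key _ _ _ hbd, key _ _ _ hcd⟩
  have : 0 < c*(2*A^2+2*B^2+C^2+D^2) := by
    rw [e1, e2, e3, e4] at tr; linarith
  exact pos_of_mul_pos_left this (by positivity)

lemma rank1 (aa bb cc dd ab ac ad bc bd cd : ℤ)
    (tr : 0 < 2*aa+2*bb+cc+dd)
    (q1 : ab*ab = aa*bb) (q2 : ac*ac = aa*cc) (q3 : ad*ad = aa*dd) (q4 : bc*bc = bb*cc)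
    (q5 : bd*bd = bb*dd) (q6 : cd*cd = cc*dd)
    (a1 : ab*ac = aa*bc) (a2 : ab*ad = aa*bd) (a3 : ac*ad = aa*cd)
    (b1 : ab*bc = bb*ac) (b2 : ab*bd = bb*ad) (b3 : bc*bd = bb*cd)
    (c1 : ac*bc = cc*ab) (c2 : ac*cd = cc*ad) (c3 : bc*cd = cc*bd)
    (d1 : ad*bd = dd*ab) (d2 : ad*cd = dd*ac) (d3 : bd*cd = dd*bc) :
    ∃ c A B C D : ℤ, 0 < c ∧ aa = c*(A*A) ∧ bb = c*(B*B) ∧ cc = c*(C*C) ∧ dd = c*(D*D) ∧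
      ab = c*(A*B) ∧ ac = c*(A*C) ∧ ad = c*(A*D) ∧ bc = c*(B*C) ∧ bd = c*(B*D) ∧ cd = c*(C*D) := by
  by_cases ha : aa = 0
  · by_cases hb : bb = 0
    · by_cases hcc : cc = 0
      · have hd : dd ≠ 0 := by rintro rfl; subst ha hb hcc; simp at tr
        exact rank1_aux aa bb cc dd ab ac ad bc bd cd ad bd cd dd dd hd tr (by linarith) (by linarith)
          (by linarith) (by linarith) (by linarith) (by linarith) (by linarith) (by linarith)
          (by linarith) (by linarith)
      · exact rank1_aux aa bb cc dd ab ac ad bc bd cd ac bc cc cd cc hcc tr (by linarith) (by linarith)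
          (by linarith) (by linarith) (by linarith) (by linarith) (by linarith) (by linarith)
          (by linarith) (by linarith)
    · exact rank1_aux aa bb cc dd ab ac ad bc bd cd ab bb bc bd bb hb tr (by linarith) (by linarith)
          (by linarith) (by linarith) (by linarith) (by linarith) (by linarith) (by linarith)
          (by linarith) (by linarith)
  · exact rank1_aux aa bb cc dd ab ac ad bc bd cd aa ab ac ad aa ha tr (by linarith) (by linarith)
          (by linarith) (by linarith) (by linarith) (by linarith) (by linarith) (by linarith)
          (by linarith) (by linarith)

lemma exists_div {h m n : ℤ} (e : m^2 = h^2*n) : ∃ g, g*h = m := by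
  have : h^2 ∣ m^2 := ⟨n, e⟩
  rw [Int.pow_dvd_pow_iff two_ne_zero] at this
  obtain ⟨g, rfl⟩ := this
  exact ⟨g, mul_comm _ _⟩

/-- The algebraic heart: dividing by `1 + i`. -/
lemma core_alg (x z y t h6 k h2 : ℤ) (a1 : h6^2 = x^2-z^2) (a2 : k^2 = y^2-(t+z)^2)
    (a3 : k*h6 = (t-z)*x-t*y) (a4 : h2^2 = t^2+z^2) (h0 : 0 < h2*(t*(t-z)+x*y)) :
    ∃ G c A B C D : ℤ, 0 < c ∧ 0 < G ∧ G^2 = (t-z)^2+2*x^2+y^2-2*z^2 ∧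
      8*(t-z) = c*(2*(A*A)+C*C-2*(B*B)-D*D) ∧ 4*t = c*(A*C-B*D) ∧ 4*y = c*(2*(A*B)+C*D) ∧
      4*x = c*(A*D+B*C) ∧ 8*G = c*(2*(A*A)+2*(B*B)+C*C+D*D) ∧
      2*(x-h6) = c*(A*D) ∧ 2*(x+h6) = c*(B*C) ∧
      8*(y-k) = c*(2*(A+B)^2-(C-D)^2) ∧ 8*(y+k) = c*((C+D)^2-2*(A-B)^2) ∧
      -8*z = c*(2*A^2-2*A*C+C^2-2*B^2+2*B*D-D^2) ∧ 4*z^2 = c^2*(A*B*C*D) := by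
  have hh : h2 ≠ 0 := by rintro rfl; simp at h0
  have hF : ((t-z)*x-t*y)^2 = (y^2-(t+z)^2)*(x^2-z^2) := by rw [← a1, ← a2, ← a3]; ring
  obtain ⟨G, b1⟩ : ∃ g, g*h2 = t*(t-z)+x*y :=
    exists_div (n := (t-z)^2+2*x^2+y^2-2*z^2) (by rw [a4]; linear_combination -hF)
  obtain ⟨f, b2⟩ : ∃ g, g*h2 = t*k+y*h6 :=
    exists_div (n := 2*x^2-(t+z)^2) (by
      rw [a4]; linear_combination t^2*a2+2*t*y*a3+y^2*a1-hF)
  obtain ⟨h4, b3⟩ : ∃ g, g*h2 = x*k-(t-z)*h6 :=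
    exists_div (n := y^2-2*z^2) (by
      rw [a4]; linear_combination x^2*a2-2*x*(t-z)*a3+(t-z)^2*a1-hF)
  have rGG : G^2 = (t-z)^2+2*x^2+y^2-2*z^2 := by
    apply mul_left_cancel₀ (pow_ne_zero 2 hh)
    linear_combination (G*h2+(t*(t-z)+x*y))*b1-((t-z)^2+2*x^2+y^2-2*z^2)*a4-hF
  have rGk : G*k = (t-z)*f+y*h4 := by
    apply mul_left_cancel₀ hh; linear_combination k*b1-(t-z)*b2-y*b3
  have rGh6 : G*h6 = x*f-t*h4 := by
    apply mul_left_cancel₀ hh; linear_combination h6*b1-x*b2+t*b3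
  have rh2k : h2*k = t*f+x*h4 := by
    apply mul_left_cancel₀ hh; linear_combination k*a4-t*b2-x*b3-h6*a3+k*a1
  have rh2h6 : 2*(h2*h6) = y*f-(t-z)*h4 := by
    apply mul_left_cancel₀ hh; linear_combination 2*h6*a4-y*b2+(t-z)*b3-k*a3+h6*a2
  have rfk : f*k = (t-z)*G-2*t*h2 := by
    apply mul_left_cancel₀ hh; linear_combination k*b2+t*a2+y*a3-(t-z)*b1+2*t*a4
  have rh4k : h4*k = y*G-2*x*h2 := by
    apply mul_left_cancel₀ hh; linear_combination k*b3+x*a2-(t-z)*a3-y*b1+2*x*a4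
  have rfh6 : f*h6 = x*G-y*h2 := by
    apply mul_left_cancel₀ hh; linear_combination h6*b2+t*a3+y*a1-x*b1+y*a4
  have rh4h6 : h4*h6 = (t-z)*h2-t*G := by
    apply mul_left_cancel₀ hh; linear_combination h6*b3+x*a3-(t-z)*a1-(t-z)*a4+t*b1
  have rGf : G*f = (t-z)*k+2*x*h6 := by
    apply mul_left_cancel₀ hh; linear_combination f*b1-(t-z)*rh2k-x*rh2h6
  have rGh4 : G*h4 = y*k-2*t*h6 := by
    apply mul_left_cancel₀ hh; linear_combination h4*b1-y*rh2k+t*rh2h6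
  have rff : f^2 = 2*x^2-(t+z)^2 := by
    apply mul_left_cancel₀ hh; linear_combination f*b2+t*rfk+y*rfh6-G*b1+h2*rGG
  have rh4h4 : h4^2 = y^2-2*z^2 := by
    apply mul_left_cancel₀ hh; linear_combination h4*b3+x*rh4k-(t-z)*rh4h6-G*b1+h2*rGG
  have rfh4 : f*h4 = (t-z)*y-2*t*x := by
    apply mul_left_cancel₀ hh; linear_combination f*b3+x*rfk-(t-z)*rfh6
  have hG : 0 < G := by
    rw [← b1] at h0
    have : 0 < G*h2^2 := by linarith
    exact pos_of_mul_pos_left this (by positivity)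
  have tr : 0 < 2*(t-z+G-f-k)+2*(G+f-t+z-k)+2*(t-z+G+f+k)+2*(G-t+z-f+k) := by linarith
  have R := rank1 (t-z+G-f-k) (G+f-t+z-k) (2*(t-z+G+f+k)) (2*(G-t+z-f+k)) (y-h4) (2*(t+h2))
    (2*(x-h6)) (2*(x+h6)) (2*(h2-t)) (2*(y+h4)) tr
    (by linear_combination (-1)*a2+(-1)*rGG+(2)*rGk+(1)*rff+(1)*rh4h4)
    (by linear_combination (2)*a2+(4)*a4+(-2)*rGG+(4)*rfk+(2)*rff)
    (by linear_combination (4)*a1+(2)*a2+(-2)*rGG+(4)*rGf+(-2)*rff)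
    (by linear_combination (4)*a1+(2)*a2+(-2)*rGG+(-4)*rGf+(-2)*rff)
    (by linear_combination (2)*a2+(4)*a4+(-2)*rGG+(-4)*rfk+(2)*rff)
    (by linear_combination (-4)*a2+(-4)*rGG+(-8)*rGk+(4)*rff+(4)*rh4h4)
    (by linear_combination (2)*a3+(-2)*b3+(-2)*rGh6+(2)*rfh6)
    (by linear_combination (-2)*b1+(2)*b2+(2)*rh2k+(2)*rh4h6)
    (by linear_combination (-2)*rh2h6+(2)*rh4k+(-2)*rGh4+(2)*rfh4)
    (by linear_combination (-2)*b1+(-2)*b2+(2)*rh2k+(-2)*rh4h6)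
    (by linear_combination (-2)*a3+(-2)*b3+(2)*rGh6+(2)*rfh6)
    (by linear_combination (2)*rh2h6+(2)*rh4k+(-2)*rGh4+(-2)*rfh4)
    (by linear_combination (2)*rh2h6+(2)*rh4k+(2)*rGh4+(2)*rfh4)
    (by linear_combination (4)*a3+(4)*b3+(4)*rGh6+(4)*rfh6)
    (by linear_combination (-4)*b1+(-4)*b2+(-4)*rh2k+(4)*rh4h6)
    (by linear_combination (-2)*rh2h6+(2)*rh4k+(2)*rGh4+(-2)*rfh4)
    (by linear_combination (-4)*b1+(4)*b2+(-4)*rh2k+(-4)*rh4h6)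
    (by linear_combination (-4)*a3+(4)*b3+(-4)*rGh6+(4)*rfh6)
  obtain ⟨c, A, B, C, D, hc, haa, hbb, hcc, hdd, hab, hac, had, hbc, hbd, hcd⟩ := R
  refine ⟨G, c, A, B, C, D, hc, hG, rGG, ?_, ?_, ?_, ?_, ?_, had, hbc, ?_, ?_, ?_, ?_⟩
  · linear_combination 2*haa+hcc-2*hbb-hdd
  · linear_combination hac-hbd
  · linear_combination 2*hab+hcd
  · linear_combination had+hbc
  · linear_combination 2*haa+hcc+2*hbb+hdd
  · linear_combination 2*haa+2*hbb+4*hab-hcc-hdd+2*hcd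
  · linear_combination -2*haa-2*hbb+4*hab+hcc+hdd+2*hcd
  · linear_combination 2*haa-2*hbb-2*hac+hcc-hdd+2*hbd
  · linear_combination c*(A*C)*hbd + (2*(h2-t))*hac - 4*a4

end X16


namespace X16

lemma two_sq {B C : ℤ} (h : C^2 = 2*B^2) : B = 0 := by
  by_contra hB
  have : IsSquare (2:ℤ) := isSquare_of_mul (m := B^2) (by positivity) (IsSquare.sq _)
    ⟨C, by linear_combination -h⟩
  obtain ⟨r, hr⟩ := this
  have h1 : r < 2 := by nlinarith
  have h2 : -2 < r := by nlinarith
  interval_cases r <;> omega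

/-- two vanishing coordinates force a special point -/
lemma Sp_AB {A B C D : ℤ} (F : (EE A B C D)^2 = 16*A*B*C*D) (hA : A = 0) (hB : B = 0) :
    Sp A B C D := by
  subst hA hB
  have : EE 0 0 C D = 0 := by simpa using F
  have h : (C-D)*(C+D) = 0 := by unfold EE at this; linear_combination this
  unfold Sp
  rcases mul_eq_zero.1 h with h | h
  · left; omega
  · right; left; omega
lemma Sp_CD {A B C D : ℤ} (F : (EE A B C D)^2 = 16*A*B*C*D) (hA : C = 0) (hB : D = 0) :
    Sp A B C D := by
  subst hA hB
  have : EE A B 0 0 = 0 := by simpa using F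
  have h : (A-B)*(A+B) = 0 := by unfold EE at this; linarith
  unfold Sp
  rcases mul_eq_zero.1 h with h | h
  · right; right; left; omega
  · right; right; right; left; omega
lemma Sp_AD {A B C D : ℤ} (F : (EE A B C D)^2 = 16*A*B*C*D) (hA : A = 0) (hB : D = 0) :
    Sp A B C D := by
  subst hA hB
  have h0 : EE 0 B C 0 = 0 := by simpa using F
  have : B = 0 := two_sq (C := C) (by unfold EE at h0; linear_combination h0)
  exact Sp_AB F rfl this
lemma Sp_BC {A B C D : ℤ} (F : (EE A B C D)^2 = 16*A*B*C*D) (hA : B = 0) (hB : C = 0) :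
    Sp A B C D := by
  subst hA hB
  have h0 : EE A 0 0 D = 0 := by simpa using F
  have : A = 0 := two_sq (C := D) (by unfold EE at h0; linear_combination -h0)
  exact Sp_AB F this rfl
lemma H1_ne {A B C D : ℤ} (F : (EE A B C D)^2 = 16*A*B*C*D) (hs : ¬ Sp A B C D) :
    0 < H1 A B C D := by
  have h0 : 0 ≤ H1 A B C D := by unfold H1; positivity
  rcases h0.lt_or_eq with h | h
  · exact h
  exfalso
  unfold H1 at h
  have e1 : A - B = 0 := by nlinarith [sq_nonneg (A-B), sq_nonneg (C-D-A+B)]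
  have e2 : C - D - A + B = 0 := by nlinarith [sq_nonneg (A-B), sq_nonneg (C-D-A+B)]
  obtain rfl : A = B := by omega
  obtain rfl : C = D := by omega
  have : A*C = 0 := by
    have : (A*C)^2 = 0 := by unfold EE at F; ring_nf at F ⊢; omega
    simpa using this
  rcases mul_eq_zero.1 this with h | h
  · exact hs (Sp_AB F h h)
  · exact hs (Sp_CD F h h)

lemma Sp_back {A B C D c a b e d : ℤ} (h1 : 8*(C-D-2*A+2*B) = c*(2*(a*a)+e*e-2*(b*b)-d*d)) (h2 : 4*(C-D-A+B) = c*(a*e-b*d))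
      (h3 : 4*(C+D) = c*(2*(a*b)+e*d)) (h4 : 4*(A+B) = c*(a*d+b*e)) (h : Sp a b e d) :
      Sp A B C D := by
  unfold Sp at *
  rcases h with ⟨rfl, rfl, rfl⟩|⟨rfl, rfl, rfl⟩|⟨rfl, rfl, rfl⟩|⟨rfl, rfl, rfl⟩|⟨rfl, rfl, rfl⟩|⟨rfl, rfl, rfl⟩|⟨rfl, rfl, rfl⟩|⟨rfl, rfl, rfl⟩|⟨rfl, rfl, rfl⟩|⟨rfl, rfl, rfl⟩|⟨rfl, rfl, rfl⟩|⟨rfl, rfl, rfl⟩ <;>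
  ring_nf at h1 h2 h3 h4 <;>
  repeat' first | exact Or.inl ⟨by omega, by omega, by omega⟩ | exact ⟨by omega, by omega, by omega⟩ | apply Or.inr

set_option maxHeartbeats 1000000 in
lemma core {A B C D α β γ δ : ℤ} (hA : A = 2*α^2) (hB : B = 2*β^2) (hC : C = γ^2) (hD : D = δ^2)
    (P : PP A B C D) (hs : ¬ Sp A B C D) :
    ∃ a b e d : ℤ, PP a b e d ∧ 0 < NN a b e d ∧
      (NN a b e d)^2 ≤ 64*(2*NN A B C D - 4*(C-D)*(A-B)) ∧ (Sp a b e d → Sp A B C D) := by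
  have F := P.F
  obtain ⟨α, hA, hE⟩ : ∃ α : ℤ, A = 2*α^2 ∧ EE A B C D = -(8*α*β*γ*δ) := by
    have : (EE A B C D)^2 = (8*α*β*γ*δ)^2 := by rw [F, hA, hB, hC, hD]; ring
    rcases sq_eq_sq_iff_eq_or_eq_neg.1 this with h | h
    · exact ⟨-α, by rw [hA]; ring, by rw [h]; ring⟩
    · exact ⟨α, hA, h⟩
  have hA0 : 0 ≤ A := by rw [hA]; positivity
  have hB0 : 0 ≤ B := by rw [hB]; positivity
  have hC0 : 0 ≤ C := by rw [hC]; positivity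
  have hD0 : 0 ≤ D := by rw [hD]; positivity
  have hH1 := H1_ne F hs
  have sqH1 : IsSquare (H1 A B C D) := by
    by_cases h : α*γ = 0
    · have hAC : A = 0 ∨ C = 0 := by
        rcases mul_eq_zero.1 h with h | h
        · left; rw [hA, h]; rfl
        · right; rw [hC, h]; rfl
      have hB1 : B ≠ 0 := fun hB1 => hs (hAC.elim (fun h => Sp_AB F h hB1) (fun h => Sp_BC F hB1 h))
      have hD1 : D ≠ 0 := fun hD1 => hs (hAC.elim (fun h => Sp_AD F h hD1) (fun h => Sp_CD F h hD1))
      have hb : β ≠ 0 := by rintro rfl; simp at hB; exact hB1 hB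
      have hd : δ ≠ 0 := by rintro rfl; simp at hD; exact hD1 hD
      have hH3 : IsSquare (H3 A B C D) := by
        refine isSquare_of_mul (m := (2*β*δ)^2) (by positivity) (IsSquare.sq _) ?_
        have := P.g3
        unfold G3 at this
        convert this using 1
        rw [hB, hD]; ring
      have hH3' : H3 A B C D ≠ 0 := by
        have : 0 < A + B := by omega
        unfold H3; positivity
      refine isSquare_of_mul hH3' hH3 ?_
      rw [mul_comm, G13 F]; exact IsSquare.sq _
    · refine isSquare_of_mul (m := (2*α*γ)^2) (by
        have : α ≠ 0 := left_ne_zero_of_mul h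
        have : γ ≠ 0 := right_ne_zero_of_mul h
        positivity) (IsSquare.sq _) ?_
      have := P.g1
      unfold G1 at this
      convert this using 1
      rw [hA, hC]; ring
  obtain ⟨h2, e2⟩ := sqH1
  have hGG : ((C-D-A+B)*((C-D-A+B)-(A-B))+(A+B)*(C+D)) ≠ 0 := by
    intro h
    have e : (0:ℤ)^2 = H1 A B C D * (2*H1 A B C D + 4*C*D+8*A*B) := by
      rw [← h]; unfold H1; unfold EE at F; linear_combination -F
    have : 0 < H1 A B C D * (2*H1 A B C D + 4*C*D+8*A*B) := by positivity
    omega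
  obtain ⟨h2, e2, hpos⟩ : ∃ h2 : ℤ, H1 A B C D = h2^2 ∧
      0 < h2*((C-D-A+B)*((C-D-A+B)-(A-B))+(A+B)*(C+D)) := by
    have h20 : h2 ≠ 0 := by rintro rfl; omega
    rcases lt_or_gt_of_ne (mul_ne_zero h20 hGG) with h | h
    · exact ⟨-h2, by rw [e2]; ring, by linarith⟩
    · exact ⟨h2, by rw [e2]; ring, h⟩
  obtain ⟨G, c, a, b, e, d, hc, hG, eG, n1, n2, n3, n4, nN, q1, q2, q3, q4, q5, q6⟩ :=
    core_alg (A+B) (A-B) (C+D) (C-D-A+B) (4*α*β) (2*γ*δ) h2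
    (by rw [hA, hB]; ring) (by rw [hC, hD]; ring)
    (by unfold EE at hE; linear_combination hE) (by rw [← e2]; unfold H1; ring) hpos
  have hc0 : c ≠ 0 := hc.ne'
  have FV : (EE a b e d)^2 = 16*a*b*e*d := by
    apply mul_left_cancel₀ (pow_ne_zero 2 hc0)
    have : (-8*(A-B))^2 = (c*EE a b e d)^2 := by rw [q5]; unfold EE; rfl
    linear_combination -this + 16*q6
  have e2V : c^2*G2 a b e d = (8*(α-β)*(γ-δ))^2 := by
    have : c^2*G2 a b e d = 2*(c*(a*d))*(c*(2*(a+b)^2-(e-d)^2)) := by unfold G2 Q2; ring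
    rw [this, ← q1, ← q3, hA, hB, hC, hD]; ring
  have e4V : c^2*G4 a b e d = (8*(α+β)*(γ+δ))^2 := by
    have : c^2*G4 a b e d = 2*(c*(b*e))*(c*((e+d)^2-2*(a-b)^2)) := by unfold G4 Q4; ring
    rw [this, ← q2, ← q4, hA, hB, hC, hD]; ring
  have hPV : PP a b e d := by
    by_cases h1 : (α-β)*(γ-δ) = 0
    · by_cases h2 : (α+β)*(γ+δ) = 0
      · exfalso
        have hAB : α = β ∨ α = -β → A = B := by
          rintro (rfl | rfl) <;> rw [hA, hB]; ring
        have hCD : γ = δ ∨ γ = -δ → C = D := by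
          rintro (rfl | rfl) <;> rw [hC, hD]; ring
        have hH : ¬ (A = B ∧ C = D) := by
          rintro ⟨rfl, rfl⟩
          simp [H1] at hH1
        rcases mul_eq_zero.1 h1 with h1 | h1 <;> rcases mul_eq_zero.1 h2 with h2 | h2
        · obtain rfl : α = 0 := by omega
          obtain rfl : β = 0 := by omega
          exact hs (Sp_AB F (by simpa using hA) (by simpa using hB))
        · exact hH ⟨hAB (Or.inl (by omega)), hCD (Or.inr (by omega))⟩
        · exact hH ⟨hAB (Or.inr (by omega)), hCD (Or.inl (by omega))⟩
        · obtain rfl : γ = 0 := by omega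
          obtain rfl : δ = 0 := by omega
          exact hs (Sp_CD F (by simpa using hC) (by simpa using hD))
      · refine PP_of_4 FV (isSquare_of_mul (pow_ne_zero 2 hc0) (IsSquare.sq _) (e4V ▸ IsSquare.sq _)) ?_
        intro h
        rw [h, mul_zero] at e4V
        have := pow_eq_zero_iff (two_ne_zero) |>.1 e4V.symm
        apply h2; linarith
    · refine PP_of_2 FV (isSquare_of_mul (pow_ne_zero 2 hc0) (IsSquare.sq _) (e2V ▸ IsSquare.sq _)) ?_
      intro h
      rw [h, mul_zero] at e2V
      have := pow_eq_zero_iff (two_ne_zero) |>.1 e2V.symm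
      apply h1; linarith
  have nN' : 8*G = c*NN a b e d := by rw [nN]; unfold NN; ring
  have hNpos : 0 < NN a b e d := pos_of_mul_pos_right (by rw [← nN']; linarith) hc.le
  refine ⟨a, b, e, d, hPV, hNpos, ?_, ?_⟩
  · have h1 : NN a b e d ≤ 8*G := by
      rw [nN']; exact le_mul_of_one_le_left hNpos.le (by omega)
    have h2 : (NN a b e d)^2 ≤ (8*G)^2 := by gcongr
    refine h2.trans (le_of_eq ?_)
    rw [mul_pow, eG]; unfold NN; ring
  · intro hsp
    exact Sp_back (by linear_combination n1) n2 n3 n4 hsp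

end X16


namespace X16

lemma odd_not_sq {p : ℕ} [Fact p.Prime] {A U : ℤ} (hA : A ≠ 0)
    (ho : ¬ Even (padicValInt p A)) (hU : ¬ (p:ℤ) ∣ U) : ¬ IsSquare (A*U) := by
  rintro ⟨k, hk⟩
  have hU0 : U ≠ 0 := by rintro rfl; simp at hU
  have hk0 : k ≠ 0 := by rintro rfl; simp [hA, hU0] at hk
  have h1 := padicValInt.mul (p := p) hA hU0
  rw [hk, padicValInt.mul hk0 hk0, padicValInt.eq_zero_of_not_dvd hU] at h1
  exact ho ⟨padicValInt p k, by omega⟩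

lemma fld {K : Type*} [Field K] (h2 : (2:K) ≠ 0) (b c d : K)
    (hF : c^2-2*b^2+2*b*d-d^2 = 0) (d1 : c = 0 ∨ b^2+(c-d+b)^2 = 0)
    (d2 : d = 0 ∨ 2*b^2-(c-d)^2 = 0) : b = 0 ∧ c = d := by
  rcases d1 with rfl | d1
  · rcases d2 with rfl | d2
    · have : b = 0 := by
        have : 2*(b*b) = 0 := by linear_combination -hF
        simpa [h2] using this
      exact ⟨this, rfl⟩
    · have h : 2*(d*(d-b)) = 0 := by linear_combination -hF-d2
      rcases mul_eq_zero.1 ((mul_eq_zero.1 h).resolve_left h2) with rfl | h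
      · have : 2*(b*b) = 0 := by linear_combination -hF
        exact ⟨by simpa [h2] using this, rfl⟩
      · obtain rfl : d = b := by linear_combination h
        have : d*d = 0 := by linear_combination d2
        have : d = 0 := by simpa using this
        exact ⟨this, this.symm⟩
  · have key : 2*b^2-(c-d)^2 = 0 → b = 0 ∧ c = d := by
      intro d2
      have h : 2*(b*(b+b+(c-d))) = 0 := by linear_combination d1 + d2
      have hb : b = 0 := by
        rcases mul_eq_zero.1 ((mul_eq_zero.1 h).resolve_left h2) with h | h
        · exact h
        · have : 2*(b*b) = 0 := by linear_combination -d2 + (2*b-(c-d))*h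
          simpa [h2] using this
      subst hb
      have : (c-d)*(c-d) = 0 := by linear_combination -d2
      have : c-d = 0 := by simpa using this
      exact ⟨rfl, by linear_combination this⟩
    rcases d2 with rfl | d2
    · exact key (by linear_combination -hF)
    · exact key d2

lemma par_A {p : ℕ} [Fact p.Prime] (hp : p ≠ 2) {A B C D : ℤ} (P : PP A B C D)
    (prim : ¬ ((p:ℤ) ∣ A ∧ (p:ℤ) ∣ B ∧ (p:ℤ) ∣ C ∧ (p:ℤ) ∣ D)) (hA : A ≠ 0) :
    Even (padicValInt p A) := by
  by_contra ho
  have hdv : ∀ n : ℤ, (p:ℤ) ∣ n ↔ (n : ZMod p) = 0 := fun n => (ZMod.intCast_zmod_eq_zero_iff_dvd n p).symm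
  have h2 : (2 : ZMod p) ≠ 0 := by
    have : ¬ (p:ℤ) ∣ 2 := by
      intro h
      have : p ∣ 2 := by exact_mod_cast h
      exact hp ((Nat.prime_dvd_prime_iff_eq Fact.out Nat.prime_two).1 this)
    rw [hdv] at this
    simpa using this
  have hA0 : (A : ZMod p) = 0 := by
    rw [← hdv]
    by_contra h
    apply ho
    rw [padicValInt.eq_zero_of_not_dvd h]; exact Even.zero
  simp only [hdv] at prim
  have key : ∀ U : ℤ, (U : ZMod p) ≠ 0 → ¬ IsSquare (A*U) := fun U hU =>
    odd_not_sq hA ho (by rwa [hdv])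
  have F := P.F
  have hF : (C : ZMod p)^2-2*(B : ZMod p)^2+2*(B : ZMod p)*(D : ZMod p)-(D : ZMod p)^2 = 0 := by
    have h := congrArg (Int.cast : ℤ → ZMod p) F
    unfold EE at h
    push_cast at h
    rw [hA0] at h
    have h' : ((C : ZMod p)^2-2*(B : ZMod p)^2+2*(B : ZMod p)*(D : ZMod p)-(D : ZMod p)^2)^2 = 0 := by
      linear_combination h
    exact pow_eq_zero_iff two_ne_zero |>.1 h'
  have d1 : (C : ZMod p) = 0 ∨ (B : ZMod p)^2+((C : ZMod p)-D+B)^2 = 0 := by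
    by_contra! h
    refine key (2*C*H1 A B C D) ?_ ?_
    · unfold H1; push_cast; rw [hA0]
      refine mul_ne_zero (mul_ne_zero h2 h.1) ?_
      convert h.2 using 1; ring
    · convert P.g1 using 1; unfold G1; ring
  have d2 : (D : ZMod p) = 0 ∨ 2*(B : ZMod p)^2-((C : ZMod p)-D)^2 = 0 := by
    by_contra! h
    refine key (2*D*Q2 A B C D) ?_ ?_
    · unfold Q2; push_cast; rw [hA0]
      refine mul_ne_zero (mul_ne_zero h2 h.1) ?_
      convert h.2 using 1; ring
    · convert P.g2 using 1; unfold G2; ring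
  obtain ⟨hb, hcd⟩ := fld h2 _ _ _ hF d1 d2
  have hc : (C : ZMod p) ≠ 0 := fun h => prim ⟨hA0, hb, h, hcd ▸ h⟩
  have hd : (D : ZMod p) ≠ 0 := hcd ▸ hc
  by_cases hB : B = 0
  · subst hB
    have hE : EE A 0 C D = 0 := by simpa using F
    unfold EE at hE
    refine key (2*C*((C+D)^2+(C-D-2*A)^2)) ?_ ?_
    · push_cast; rw [hA0, ← hcd]
      have : (2:ZMod p)*C*((C+C)^2+(C-C-2*0)^2) = 2*2*2*C*C*C := by ring
      rw [this]
      simp [h2, hc]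
    · refine isSquare_of_mul (m := A^2) (by positivity) (IsSquare.sq _) ?_
      convert isSquare_mul_sq (c := C+D) P.g1 using 1
      unfold G1 H1
      linear_combination (-2*A*C)*(-2*A^2+2*A*C+(C-D)*(C+D)-2*A*(C+D))*hE
  · refine key (32*C^2*D*Q4 A B C D) ?_ ?_
    · unfold Q4; push_cast; rw [hA0, hb, ← hcd]
      have : (32:ZMod p)*C^2*C*((C+C)^2-2*(0-0)^2) = 2*2*2*2*2*2*2*C*C*C*C*C := by ring
      rw [this]
      simp [h2, hc]
    · refine isSquare_of_mul (m := B^2) (by positivity) (IsSquare.sq _) ?_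
      convert isSquare_mul_sq (c := EE A B C D) P.g4 using 1
      unfold G4
      rw [F]; ring

def Prim (A B C D : ℤ) : Prop :=
  ∀ p : ℕ, p.Prime → ¬ ((p:ℤ) ∣ A ∧ (p:ℤ) ∣ B ∧ (p:ℤ) ∣ C ∧ (p:ℤ) ∣ D)

lemma cls {A : ℤ} (h0 : 0 ≤ A) (h : ∀ p : ℕ, p.Prime → p ≠ 2 → A ≠ 0 → Even (padicValInt p A)) :
    (∃ m : ℕ, A = m^2) ∨ (∃ m : ℕ, A = 2*m^2) := by
  by_cases hA : A = 0
  · exact Or.inl ⟨0, by simp [hA]⟩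
  obtain ⟨n, rfl⟩ := Int.eq_ofNat_of_zero_le h0
  obtain ⟨a, b, rfl, hsq⟩ := Nat.sq_mul_squarefree n
  have hab : a ≠ 0 ∧ b ≠ 0 := by
    constructor <;> rintro rfl <;> simp at hA
  have two : ∀ p : ℕ, p.Prime → p ∣ a → p = 2 := by
    intro p hp hpa
    by_contra hp2
    have := Fact.mk hp
    have := h p hp hp2 hA
    rw [padicValInt.of_nat, padicValNat.mul (pow_ne_zero 2 hab.2) hab.1, padicValNat.pow] at this
    have h1 : padicValNat p a = 1 := by
      have h1 : padicValNat p a ≠ 0 := by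
        have := one_le_padicValNat_of_dvd hab.1 hpa
        omega
      have h2 : padicValNat p a < 2 := by
        by_contra! h2
        have := (padicValNat_dvd_iff_le hab.1).2 h2
        rw [pow_two] at this
        have := hsq p this
        exact hp.one_lt.ne' (Nat.isUnit_iff.1 this)
      omega
    rw [h1] at this
    rcases this with ⟨r, hr⟩
    omega
  by_cases ha1 : a = 1
  · subst ha1; exact Or.inl ⟨b, by push_cast; ring⟩
  · have h2a : 2 ∣ a := by
      have := two _ (Nat.minFac_prime ha1) (Nat.minFac_dvd a)
      rw [← this]; exact Nat.minFac_dvd a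
    obtain ⟨a', rfl⟩ := h2a
    have : a' = 1 := by
      by_contra ha'
      have := two _ (Nat.minFac_prime ha') ((Nat.minFac_dvd a').trans (Dvd.intro_left 2 rfl))
      have h2 : 2 ∣ a' := by rw [← this]; exact Nat.minFac_dvd a'
      have := hsq 2 (Nat.mul_dvd_mul_left 2 h2)
      simp at this
    subst this
    exact Or.inr ⟨b, by push_cast; ring⟩

lemma cls4 {A B C D : ℤ} (P : PP A B C D) (prim : Prim A B C D) (hA : 0 ≤ A) (hB : 0 ≤ B)
    (hC : 0 ≤ C) (hD : 0 ≤ D) :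
    ((∃ m : ℕ, A = m^2) ∨ (∃ m : ℕ, A = 2*m^2)) ∧ ((∃ m : ℕ, B = m^2) ∨ (∃ m : ℕ, B = 2*m^2)) ∧
    ((∃ m : ℕ, C = m^2) ∨ (∃ m : ℕ, C = 2*m^2)) ∧ ((∃ m : ℕ, D = m^2) ∨ (∃ m : ℕ, D = 2*m^2)) := by
  have hd2 : ∀ p : ℕ, p.Prime → p ≠ 2 → ∀ n : ℤ, (p:ℤ) ∣ 2*n → (p:ℤ) ∣ n := by
    intro p hp h2 n h
    rcases (Nat.prime_iff_prime_int.1 hp).dvd_or_dvd h with h | h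
    · have : p ∣ 2 := by exact_mod_cast h
      exact absurd ((Nat.prime_dvd_prime_iff_eq hp Nat.prime_two).1 this) h2
    · exact h
  refine ⟨cls hA ?_, cls hB ?_, cls hC ?_, cls hD ?_⟩
  · intro p hp h2 h0
    have := Fact.mk hp
    exact par_A h2 P (prim p hp) h0
  · intro p hp h2 h0
    have := Fact.mk hp
    refine par_A h2 (PP_T0 P) ?_ h0
    have := prim p hp
    simp only [dvd_neg]
    tauto
  · intro p hp h2 h0
    have := Fact.mk hp
    refine par_A h2 (PP_Ti P) ?_ h0
    rintro ⟨a, b, c, d⟩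
    exact prim p hp ⟨hd2 p hp h2 _ c, hd2 p hp h2 _ d, a, b⟩
  · intro p hp h2 h0
    have := Fact.mk hp
    refine par_A h2 (PP_T0 (PP_Ti P)) ?_ h0
    rintro ⟨a, b, c, d⟩
    rw [dvd_neg] at b d
    exact prim p hp ⟨hd2 p hp h2 _ d, hd2 p hp h2 _ c, b, a⟩

end X16


namespace X16

instance (A B C D : ℤ) : Decidable (Sp A B C D) := by unfold Sp; infer_instance

lemma box1 : ∀ α : ℕ, α < 3 → ∀ β : ℕ, β < 3 → ∀ γ : ℕ, γ < 4 → ∀ δ : ℕ, δ < 4 →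
    (EE (2*((α:ℕ):ℤ)^2) (2*((β:ℕ):ℤ)^2) (((γ:ℕ):ℤ)^2) (((δ:ℕ):ℤ)^2))^2 =
      16*(2*((α:ℕ):ℤ)^2)*(2*((β:ℕ):ℤ)^2)*(((γ:ℕ):ℤ)^2)*(((δ:ℕ):ℤ)^2) →
    Sp (2*((α:ℕ):ℤ)^2) (2*((β:ℕ):ℤ)^2) (((γ:ℕ):ℤ)^2) (((δ:ℕ):ℤ)^2) := by
  decide +kernel
lemma box2 : ∀ α : ℕ, α < 5 → ∀ β : ℕ, β < 5 → ∀ γ : ℕ, γ < 4 → ∀ δ : ℕ, δ < 4 →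
    (EE (((α:ℕ):ℤ)^2) (((β:ℕ):ℤ)^2) (2*((γ:ℕ):ℤ)^2) (2*((δ:ℕ):ℤ)^2))^2 =
      16*(((α:ℕ):ℤ)^2)*(((β:ℕ):ℤ)^2)*(2*((γ:ℕ):ℤ)^2)*(2*((δ:ℕ):ℤ)^2) →
    Sp (((α:ℕ):ℤ)^2) (((β:ℕ):ℤ)^2) (2*((γ:ℕ):ℤ)^2) (2*((δ:ℕ):ℤ)^2) := by
  decide +kernel
lemma box3 : ∀ α : ℕ, α < 6 → ∀ β : ℕ, β < 6 → ∀ γ : ℕ, γ < 7 → ∀ δ : ℕ, δ < 7 →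
    (EE (((α:ℕ):ℤ)^2) (((β:ℕ):ℤ)^2) (((γ:ℕ):ℤ)^2) (((δ:ℕ):ℤ)^2))^2 =
      16*(((α:ℕ):ℤ)^2)*(((β:ℕ):ℤ)^2)*(((γ:ℕ):ℤ)^2)*(((δ:ℕ):ℤ)^2) →
    Sp (((α:ℕ):ℤ)^2) (((β:ℕ):ℤ)^2) (((γ:ℕ):ℤ)^2) (((δ:ℕ):ℤ)^2) := by
  decide +kernel

lemma core' {A B C D α β γ δ : ℤ} (hA : A = 2*α^2) (hB : B = 2*β^2) (hC : C = γ^2) (hD : D = δ^2)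
    (P : PP A B C D) (hs : ¬ Sp A B C D) :
    ∃ a b e d : ℤ, PP a b e d ∧ 0 < NN a b e d ∧
      (NN a b e d)^2 ≤ 224*NN A B C D ∧ (Sp a b e d → Sp A B C D) := by
  obtain ⟨a, b, e, d, h1, h2, h3, h4⟩ := core hA hB hC hD P hs
  refine ⟨a, b, e, d, h1, h2, h3.trans ?_, h4⟩
  have hA0 : 0 ≤ A := by rw [hA]; positivity
  have hB0 : 0 ≤ B := by rw [hB]; positivity
  have hC0 : 0 ≤ C := by rw [hC]; positivity
  have hD0 : 0 ≤ D := by rw [hD]; positivity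
  have e1 := mul_nonneg hA0 hB0
  have e2 := mul_nonneg hC0 hD0
  unfold NN
  nlinarith [sq_nonneg (3*(C-D)+4*(A-B)), sq_nonneg (A-B)]

lemma even_of_sq {n : ℤ} (h : 2 ∣ n^2) : 2 ∣ n := Int.prime_two.dvd_of_dvd_pow h

lemma four_dvd {A B C D : ℤ} (F : (EE A B C D)^2 = 16*A*B*C*D) : 4 ∣ EE A B C D := by
  rw [← Int.pow_dvd_pow_iff two_ne_zero, F]
  exact ⟨A*B*C*D, by ring⟩

lemma bad1 {A B C D : ℤ} (F : (EE A B C D)^2 = 16*A*B*C*D)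
    (h : (2 ∣ A ∧ 2 ∣ D) ∨ (2 ∣ B ∧ 2 ∣ D) ∨ (2 ∣ A ∧ 2 ∣ C) ∨ (2 ∣ B ∧ 2 ∣ C)) :
    2 ∣ A ∧ 2 ∣ B ∧ 2 ∣ C ∧ 2 ∣ D := by
  obtain ⟨r, hr⟩ := four_dvd F
  have key : 2 ∣ C ∨ 2 ∣ D → (2 ∣ C ∧ 2 ∣ D) := by
    unfold EE at hr
    rintro (⟨c, rfl⟩ | ⟨c, rfl⟩)
    · exact ⟨⟨c, rfl⟩, even_of_sq ⟨A^2-2*A*c+2*c^2-B^2+B*D-2*r, by linear_combination -hr⟩⟩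
    · exact ⟨even_of_sq ⟨-A^2+A*C+2*c^2+B^2-2*B*c+2*r, by linear_combination hr⟩, ⟨c, rfl⟩⟩
  have hCD : 2 ∣ C ∧ 2 ∣ D := key (by tauto)
  obtain ⟨⟨c, rfl⟩, ⟨d, rfl⟩⟩ := hCD
  have hAB : 2 ∣ A ∨ 2 ∣ B → (2 ∣ A ∧ 2 ∣ B) := by
    unfold EE at hr
    rintro (⟨a, rfl⟩ | ⟨a, rfl⟩)
    · refine ⟨⟨a, rfl⟩, even_of_sq ⟨2*a^2-2*a*c+c^2+B*d-d^2-r, ?_⟩⟩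
      have : 2*B^2 = 2*(2*(2*a^2-2*a*c+c^2+B*d-d^2-r)) := by linear_combination -hr
      linarith
    · refine ⟨even_of_sq ⟨2*a^2-2*a*d+d^2+A*c-c^2+r, ?_⟩, ⟨a, rfl⟩⟩
      have : 2*A^2 = 2*(2*(2*a^2-2*a*d+d^2+A*c-c^2+r)) := by linear_combination hr
      linarith
  have := hAB (by tauto)
  exact ⟨this.1, this.2, Dvd.intro c rfl, Dvd.intro d rfl⟩

lemma odd_pat {A B C D q : ℤ} (F : (EE A B C D)^2 = 16*A*B*C*D) (h : A*B*C*D = 2*q^2) :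
    A = 0 ∨ B = 0 ∨ C = 0 ∨ D = 0 := by
  have : 4*q = 0 := two_sq (C := EE A B C D) (by linear_combination F + 16*h)
  have : q = 0 := by omega
  rw [this] at h
  simpa [or_assoc] using h

lemma pow4_lt {m k : ℕ} (h : m^4 < k^4) : m < k := lt_of_pow_lt_pow_left₀ 4 (Nat.zero_le _) h

lemma pat1100 {A B C D : ℤ} (P : PP A B C D) (hs : ¬ Sp A B C D) (hN : 0 < NN A B C D)
    (IH : ∀ a b e d : ℤ, PP a b e d → 0 < NN a b e d → NN a b e d < NN A B C D → Sp a b e d)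
    (hA : ∃ m : ℕ, A = 2*m^2) (hB : ∃ m : ℕ, B = 2*m^2) (hC : ∃ m : ℕ, C = m^2)
    (hD : ∃ m : ℕ, D = m^2) : False := by
  obtain ⟨α, hA⟩ := hA
  obtain ⟨β, hB⟩ := hB
  obtain ⟨γ, hC⟩ := hC
  obtain ⟨δ, hD⟩ := hD
  obtain ⟨a, b, e, d, h1, h2, h3, h4⟩ := core' hA hB hC hD P hs
  have h5 : NN A B C D ≤ NN a b e d := by
    by_contra! h
    exact hs (h4 (IH _ _ _ _ h1 h2 h))
  have h6 : NN A B C D ≤ 224 := by nlinarith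
  have F := P.F
  have e : NN A B C D = ((8*α^4+8*β^4+γ^4+δ^4 : ℕ) : ℤ) := by
    rw [hA, hB, hC, hD]; unfold NN; push_cast; ring
  rw [e] at h6
  have h7 : 8*α^4+8*β^4+γ^4+δ^4 ≤ 224 := by exact_mod_cast h6
  rw [hA, hB, hC, hD] at F hs
  exact hs (box1 α (pow4_lt (by norm_num; omega)) β (pow4_lt (by norm_num; omega))
    γ (pow4_lt (by norm_num; omega)) δ (pow4_lt (by norm_num; omega)) F)

lemma pat0011 {A B C D : ℤ} (P : PP A B C D) (hs : ¬ Sp A B C D) (hN : 0 < NN A B C D)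
    (IH : ∀ a b e d : ℤ, PP a b e d → 0 < NN a b e d → NN a b e d < NN A B C D → Sp a b e d)
    (hA : ∃ m : ℕ, A = m^2) (hB : ∃ m : ℕ, B = m^2) (hC : ∃ m : ℕ, C = 2*m^2)
    (hD : ∃ m : ℕ, D = 2*m^2) : False := by
  obtain ⟨α, hA⟩ := hA
  obtain ⟨β, hB⟩ := hB
  obtain ⟨γ, hC⟩ := hC
  obtain ⟨δ, hD⟩ := hD
  have P2 := (PP_scale (c := 2) two_ne_zero).2 P
  have hs2 : ¬ Sp (2*A) (2*B) (2*C) (2*D) := by rwa [Sp_scale two_ne_zero]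
  obtain ⟨a, b, e, d, h1, h2, h3, h4⟩ := core' (α := α) (β := β) (γ := 2*γ) (δ := 2*δ)
    (by rw [hA]) (by rw [hB]) (by rw [hC]; ring) (by rw [hD]; ring) P2 hs2
  have h5 : NN A B C D ≤ NN a b e d := by
    by_contra! h
    exact hs2 (h4 (IH _ _ _ _ h1 h2 h))
  have eN : NN (2*A) (2*B) (2*C) (2*D) = 4*NN A B C D := by unfold NN; ring
  rw [eN] at h3
  have h6 : NN A B C D ≤ 896 := by nlinarith
  have F := P.F
  have e : NN A B C D = ((2*α^4+2*β^4+4*γ^4+4*δ^4 : ℕ) : ℤ) := by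
    rw [hA, hB, hC, hD]; unfold NN; push_cast; ring
  rw [e] at h6
  have h7 : 2*α^4+2*β^4+4*γ^4+4*δ^4 ≤ 896 := by exact_mod_cast h6
  rw [hA, hB, hC, hD] at F hs
  exact hs (box2 α (pow4_lt (by norm_num; omega)) β (pow4_lt (by norm_num; omega))
    γ (pow4_lt (by norm_num; omega)) δ (pow4_lt (by norm_num; omega)) F)

lemma pat0000 {A B C D : ℤ} (P : PP A B C D) (hs : ¬ Sp A B C D) (hN : 0 < NN A B C D)
    (IH : ∀ a b e d : ℤ, PP a b e d → 0 < NN a b e d → NN a b e d < NN A B C D → Sp a b e d)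
    (hA : ∃ m : ℕ, A = m^2) (hB : ∃ m : ℕ, B = m^2) (hC : ∃ m : ℕ, C = m^2)
    (hD : ∃ m : ℕ, D = m^2) : False := by
  obtain ⟨α, hA⟩ := hA
  obtain ⟨β, hB⟩ := hB
  obtain ⟨γ, hC⟩ := hC
  obtain ⟨δ, hD⟩ := hD
  have P2 := (PP_scale (c := 2) two_ne_zero).2 (PP_Ti P)
  have hs2 : ¬ Sp (2*C) (2*D) (2*(2*A)) (2*(2*B)) := by
    rw [Sp_scale two_ne_zero]
    exact fun h => hs (Sp_Ti h)
  obtain ⟨a, b, e, d, h1, h2, h3, h4⟩ := core' (α := γ) (β := δ) (γ := 2*α) (δ := 2*β)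
    (by rw [hC]) (by rw [hD]) (by rw [hA]; ring) (by rw [hB]; ring) P2 hs2
  have h5 : NN A B C D ≤ NN a b e d := by
    by_contra! h
    exact hs2 (h4 (IH _ _ _ _ h1 h2 h))
  have eN : NN (2*C) (2*D) (2*(2*A)) (2*(2*B)) = 8*NN A B C D := by unfold NN; ring
  rw [eN] at h3
  have h6 : NN A B C D ≤ 1792 := by nlinarith
  have F := P.F
  have e : NN A B C D = ((2*α^4+2*β^4+γ^4+δ^4 : ℕ) : ℤ) := by
    rw [hA, hB, hC, hD]; unfold NN; push_cast; ring
  rw [e] at h6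
  have h7 : 2*α^4+2*β^4+γ^4+δ^4 ≤ 1792 := by exact_mod_cast h6
  rw [hA, hB, hC, hD] at F hs
  exact hs (box3 α (pow4_lt (by norm_num; omega)) β (pow4_lt (by norm_num; omega))
    γ (pow4_lt (by norm_num; omega)) δ (pow4_lt (by norm_num; omega)) F)

lemma step_nonneg {A B C D : ℤ} (hA0 : 0 ≤ A) (hB0 : 0 ≤ B) (hC0 : 0 ≤ C) (hD0 : 0 ≤ D)
    (P : PP A B C D) (hs : ¬ Sp A B C D) (hN : 0 < NN A B C D) (prim : Prim A B C D)
    (IH : ∀ a b e d : ℤ, PP a b e d → 0 < NN a b e d → NN a b e d < NN A B C D → Sp a b e d) :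
    False := by
  have F := P.F
  have bad : ((2 ∣ A ∧ 2 ∣ D) ∨ (2 ∣ B ∧ 2 ∣ D) ∨ (2 ∣ A ∧ 2 ∣ C) ∨ (2 ∣ B ∧ 2 ∣ C)) → False :=
    fun h => prim 2 Nat.prime_two (by exact_mod_cast bad1 F h)
  have ev : ∀ {n : ℤ}, (∃ m : ℕ, n = 2*m^2) → 2 ∣ n := by
    rintro n ⟨m, rfl⟩; exact Dvd.intro _ rfl
  have z1 : ∀ n : ℤ, n = 0 → (∃ m : ℕ, n = m^2) := by rintro n rfl; exact ⟨0, by simp⟩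
  have z2 : ∀ n : ℤ, n = 0 → (∃ m : ℕ, n = 2*m^2) := by rintro n rfl; exact ⟨0, by simp⟩
  have q1 := pat1100 P hs hN IH
  have q2 := pat0011 P hs hN IH
  have q3 := pat0000 P hs hN IH
  obtain ⟨hA, hB, hC, hD⟩ := cls4 P prim hA0 hB0 hC0 hD0
  have zero : (A = 0 ∨ B = 0 ∨ C = 0 ∨ D = 0) → False := by
    rintro (h | h | h | h)
    · have a1 := z1 _ h
      have a2 := z2 _ h
      rcases hB with hB | hB <;> rcases hC with hC | hC <;> rcases hD with hD | hD <;>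
      first | exact q1 (by assumption) (by assumption) (by assumption) (by assumption) | exact q2 (by assumption) (by assumption) (by assumption) (by assumption) | exact q3 (by assumption) (by assumption) (by assumption) (by assumption) | exact bad (Or.inl ⟨ev (by assumption), ev (by assumption)⟩) | exact bad (Or.inr (Or.inl ⟨ev (by assumption), ev (by assumption)⟩)) | exact bad (Or.inr (Or.inr (Or.inl ⟨ev (by assumption), ev (by assumption)⟩))) | exact bad (Or.inr (Or.inr (Or.inr ⟨ev (by assumption), ev (by assumption)⟩)))
    · have a1 := z1 _ h
      have a2 := z2 _ h
      rcases hA with hA | hA <;> rcases hC with hC | hC <;> rcases hD with hD | hD <;>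
      first | exact q1 (by assumption) (by assumption) (by assumption) (by assumption) | exact q2 (by assumption) (by assumption) (by assumption) (by assumption) | exact q3 (by assumption) (by assumption) (by assumption) (by assumption) | exact bad (Or.inl ⟨ev (by assumption), ev (by assumption)⟩) | exact bad (Or.inr (Or.inl ⟨ev (by assumption), ev (by assumption)⟩)) | exact bad (Or.inr (Or.inr (Or.inl ⟨ev (by assumption), ev (by assumption)⟩))) | exact bad (Or.inr (Or.inr (Or.inr ⟨ev (by assumption), ev (by assumption)⟩)))
    · have a1 := z1 _ h
      have a2 := z2 _ h
      rcases hA with hA | hA <;> rcases hB with hB | hB <;> rcases hD with hD | hD <;>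
      first | exact q1 (by assumption) (by assumption) (by assumption) (by assumption) | exact q2 (by assumption) (by assumption) (by assumption) (by assumption) | exact q3 (by assumption) (by assumption) (by assumption) (by assumption) | exact bad (Or.inl ⟨ev (by assumption), ev (by assumption)⟩) | exact bad (Or.inr (Or.inl ⟨ev (by assumption), ev (by assumption)⟩)) | exact bad (Or.inr (Or.inr (Or.inl ⟨ev (by assumption), ev (by assumption)⟩))) | exact bad (Or.inr (Or.inr (Or.inr ⟨ev (by assumption), ev (by assumption)⟩)))
    · have a1 := z1 _ h
      have a2 := z2 _ h
      rcases hA with hA | hA <;> rcases hB with hB | hB <;> rcases hC with hC | hC <;>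
      first | exact q1 (by assumption) (by assumption) (by assumption) (by assumption) | exact q2 (by assumption) (by assumption) (by assumption) (by assumption) | exact q3 (by assumption) (by assumption) (by assumption) (by assumption) | exact bad (Or.inl ⟨ev (by assumption), ev (by assumption)⟩) | exact bad (Or.inr (Or.inl ⟨ev (by assumption), ev (by assumption)⟩)) | exact bad (Or.inr (Or.inr (Or.inl ⟨ev (by assumption), ev (by assumption)⟩))) | exact bad (Or.inr (Or.inr (Or.inr ⟨ev (by assumption), ev (by assumption)⟩)))
  rcases hA with hA | hA <;> rcases hB with hB | hB <;> rcases hC with hC | hC <;>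
    rcases hD with hD | hD <;>
  first | exact q1 hA hB hC hD | exact q2 hA hB hC hD | exact q3 hA hB hC hD | exact bad (Or.inl ⟨ev hA, ev hD⟩) | exact bad (Or.inr (Or.inl ⟨ev hB, ev hD⟩)) | exact bad (Or.inr (Or.inr (Or.inl ⟨ev hA, ev hC⟩))) | exact bad (Or.inr (Or.inr (Or.inr ⟨ev hB, ev hC⟩))) | skip
  all_goals
    obtain ⟨α, hA⟩ := hA
    obtain ⟨β, hB⟩ := hB
    obtain ⟨γ, hC⟩ := hC
    obtain ⟨δ, hD⟩ := hD
    refine zero (odd_pat (q := α*β*γ*δ) F ?_)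
    rw [hA, hB, hC, hD]; ring

theorem main_aux : ∀ n : ℕ, ∀ A B C D : ℤ, NN A B C D = n → 0 < NN A B C D → PP A B C D →
    Sp A B C D := by
  intro n
  induction n using Nat.strong_induction_on with
  | _ n ih =>
  intro A B C D hn hN P
  by_contra hs
  have IH : ∀ a b e d : ℤ, PP a b e d → 0 < NN a b e d → NN a b e d < NN A B C D → Sp a b e d := by
    intro a b e d h1 h2 h3
    refine ih (NN a b e d).toNat ?_ a b e d ?_ h2 h1 <;> omega
  have prim : Prim A B C D := by
    rintro p hp ⟨⟨a, rfl⟩, ⟨b, rfl⟩, ⟨c, rfl⟩, ⟨d, rfl⟩⟩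
    have hp0 : (p:ℤ) ≠ 0 := by exact_mod_cast hp.ne_zero
    rw [PP_scale hp0] at P
    rw [Sp_scale hp0] at hs
    have e : NN (p*a) (p*b) (p*c) (p*d) = p^2*NN a b c d := by unfold NN; ring
    have h2 : (2:ℤ) ≤ p := by exact_mod_cast hp.two_le
    rw [e] at hN
    have h3 : 0 < NN a b c d := pos_of_mul_pos_right hN (by positivity)
    refine hs (IH _ _ _ _ P h3 ?_)
    rw [e]
    have h4 : (4:ℤ) ≤ (p:ℤ)^2 := by nlinarith
    nlinarith
  have P0 := PP_T0 P
  have hs0 : ¬ Sp B (-A) D (-C) := fun h => hs (Sp_T0 h)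
  have hH1 := H1_ne P.F hs
  have hH3 := H1_ne P0.F hs0
  have hAC : 0 ≤ A*C := by
    have := P.g1.nonneg
    unfold G1 at this
    nlinarith
  have hBD : 0 ≤ B*D := by
    have := P0.g1.nonneg
    unfold G1 at this
    nlinarith
  have eN : ∀ a b c d : ℤ, NN a b c d = NN (-a) (-b) (-c) (-d) := by intros; unfold NN; ring
  have eN0 : NN B (-A) D (-C) = NN A B C D := by unfold NN; ring
  have prim0 : Prim B (-A) D (-C) := by
    rintro p hp ⟨a, b, c, d⟩
    rw [dvd_neg] at b d
    exact prim p hp ⟨b, a, d, c⟩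
  have primneg : ∀ {a b c d : ℤ}, Prim a b c d → Prim (-a) (-b) (-c) (-d) := by
    rintro a b c d h p hp ⟨a, b, c, d⟩
    rw [dvd_neg] at a b c d
    exact h p hp ⟨a, b, c, d⟩
  rcases mul_nonneg_iff.1 hAC with ⟨hA, hC⟩ | ⟨hA, hC⟩ <;>
  rcases mul_nonneg_iff.1 hBD with ⟨hB, hD⟩ | ⟨hB, hD⟩
  · exact step_nonneg hA hB hC hD P hs hN prim IH
  · refine step_nonneg (A := - B) (B := - - A) (C := - D) (D := - - C) (by omega) (by omega) (by omega)
      (by omega) (PP_neg P0) (fun h => hs0 (Sp_neg h)) ?_ (primneg prim0) ?_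
    · rw [← eN, eN0]; exact hN
    · rw [← eN, eN0]; exact IH
  · refine step_nonneg (by omega) (by omega) (by omega)
      (by omega) P0 hs0 ?_ prim0 ?_
    · rw [eN0]; exact hN
    · rw [eN0]; exact IH
  · refine step_nonneg (by omega) (by omega) (by omega)
      (by omega) (PP_neg P) (fun h => hs (Sp_neg h)) ?_ (primneg prim) ?_
    · rw [← eN]; exact hN
    · rw [← eN]; exact IH

theorem main_int {A B C D : ℤ} (h : A ≠ 0) (P : PP A B C D) : Sp A B C D := by
  have hN : 0 < NN A B C D := by unfold NN; positivity
  exact main_aux (NN A B C D).toNat A B C D (by omega) hN P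

end X16


namespace X16

lemma common_den (r s t : ℚ) : ∃ m B C D : ℤ, m ≠ 0 ∧ (B:ℚ) = m*r ∧ (C:ℚ) = m*s ∧ (D:ℚ) = m*t := by
  refine ⟨r.den*s.den*t.den, r.num*s.den*t.den, r.den*s.num*t.den, r.den*s.den*t.num, ?_, ?_, ?_, ?_⟩
  · have := r.den_ne_zero
    have := s.den_ne_zero
    have := t.den_ne_zero
    positivity
  · push_cast
    linear_combination -(s.den:ℚ)*t.den*(Rat.mul_den_eq_num r)
  · push_cast
    linear_combination -(r.den:ℚ)*t.den*(Rat.mul_den_eq_num s)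
  · push_cast
    linear_combination -(r.den:ℚ)*s.den*(Rat.mul_den_eq_num t)

lemma two_sq_rat {u v : ℚ} (h : v^2 = 2*u^2) : u = 0 ∧ v = 0 := by
  have hu : u = 0 := by
    by_contra hu
    have h2 : (v/u)^2 = 2 := by field_simp; linarith
    have : IsSquare (2:ℚ) := ⟨v/u, by rw [← h2]; ring⟩
    have : IsSquare (2:ℤ) := by
      rw [← Rat.isSquare_intCast_iff]; exact_mod_cast this
    obtain ⟨z, hz⟩ := this
    have := two_sq (B := 1) (C := z) (by linarith)
    omega
  subst hu
  exact ⟨rfl, by simpa using h⟩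

set_option maxHeartbeats 1000000 in
lemma rat_part {p q a b k : ℚ} (hb : b^2 = k+2+2*p^2+p^3-p*q) (h0 : a^2 = q*(k+p*q+2*q))
    (h1 : 2*a*b = 1+p*k+2*p^2*q+4*p*q-q^2) (irr : ∀ r : ℚ, r^2+p*r+q ≠ 0) :
    (p = 0 ∧ q = 1) ∨ (p = -2 ∧ q = -1) := by
  have hq : q ≠ 0 := fun h => irr 0 (by simp [h])
  have F : (p*k+1-q^2)^2 = 4*q*(k+p+2)*(k-p+2*q) := by
    linear_combination (-(2*a*b+(1+p*k+2*p^2*q+4*p*q-q^2)))*h1 + 4*b^2*h0+4*(q*(k+p*q+2*q))*hb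
  have g1 : (k+p+2)*((q-1)^2+p^2) = (b*(q-1)-a*p)^2 := by
    linear_combination p*(q-1)*h1 - p^2*h0 - (q-1)^2*hb
  have g2 : (k-p+2*q)*(2*(q+1)^2-(p+1-q)^2) = (a*(2+p)-b*(1+q))^2 := by
    linear_combination (p+2)*(1+q)*h1 - (p+2)^2*h0 - (1+q)^2*hb
  obtain ⟨m, B, C, D, hm, hB, hC, hD⟩ := common_den (2*q) (k+p+2) (k-p+2*q)
  have hm' : (m:ℚ) ≠ 0 := by exact_mod_cast hm
  have F' : (EE (2*m) B C D)^2 = 16*(2*m)*B*C*D := by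
    have : ((EE (2*m) B C D : ℤ):ℚ)^2 = 16*(2*m)*B*C*D := by
      unfold EE; push_cast; rw [hB, hC, hD]
      linear_combination 16*(m:ℚ)^4*F
    exact_mod_cast this
  have e1 : ((G1 (2*m) B C D : ℤ):ℚ) = 16*m^4*((k+p+2)*((q-1)^2+p^2)) := by
    unfold G1 H1; push_cast; rw [hB, hC, hD]; ring
  have e2 : ((G2 (2*m) B C D : ℤ):ℚ) = 16*m^4*((k-p+2*q)*(2*(q+1)^2-(p+1-q)^2)) := by
    unfold G2 Q2; push_cast; rw [hB, hC, hD]; ring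
  by_cases z1 : (q-1)^2+p^2 = 0
  · left
    have w1 : p^2 = 0 := by linarith [sq_nonneg (q-1), sq_nonneg p]
    have w2 : (q-1)^2 = 0 := by linarith [sq_nonneg (q-1), sq_nonneg p]
    exact ⟨pow_eq_zero_iff two_ne_zero |>.1 w1, sub_eq_zero.1 (pow_eq_zero_iff two_ne_zero |>.1 w2)⟩
  by_cases z2 : 2*(q+1)^2-(p+1-q)^2 = 0
  · right
    obtain ⟨h3, h4⟩ := two_sq_rat (u := q+1) (v := p+1-q) (by linarith)
    constructor <;> linarith
  have P : PP (2*m) B C D := by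
    by_cases s1 : k+p+2 = 0
    · by_cases s2 : k-p+2*q = 0
      · exfalso
        have w : q = p+1 := by linarith
        have hk : k = -p-2 := by linarith
        have F2 : (p*k+1-q^2)^2 = 0 := by rw [F, s1]; ring
        have F3 : p*k+1-q^2 = 0 := (pow_eq_zero_iff two_ne_zero).1 F2
        have F4 : p*(p+2) = 0 := by
          rw [hk, w] at F3; linear_combination -F3/2
        rcases mul_eq_zero.1 F4 with h | h
        · exact z1 (by rw [w, h]; norm_num)
        · have hp : p = -2 := by linarith
          exact z2 (by rw [w, hp]; norm_num)
      · refine PP_of_2 F' ?_ ?_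
        · rw [← Rat.isSquare_intCast_iff, e2, g2]
          exact ⟨4*m^2*(a*(2+p)-b*(1+q)), by ring⟩
        · have : ((G2 (2*m) B C D : ℤ):ℚ) ≠ 0 := by
            rw [e2]; exact mul_ne_zero (by positivity) (mul_ne_zero s2 z2)
          exact_mod_cast this
    · refine PP_of_1 F' ?_ ?_
      · rw [← Rat.isSquare_intCast_iff, e1, g1]
        exact ⟨4*m^2*(b*(q-1)-a*p), by ring⟩
      · have : ((G1 (2*m) B C D : ℤ):ℚ) ≠ 0 := by
          rw [e1]; exact mul_ne_zero (by positivity) (mul_ne_zero s1 z1)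
        exact_mod_cast this
  have S := main_int (by omega) P
  have i1 := irr 1
  have i2 := irr (-1)
  have canc : ∀ {u v : ℚ}, (m:ℚ)*u = m*v → u = v := fun h => mul_left_cancel₀ hm' h
  have t0 : 2*m ≠ 0 := by omega
  have tB : B ≠ 0 := by
    intro h; rw [h] at hB; push_cast at hB
    have := mul_ne_zero hm' hq
    apply this; linarith
  unfold Sp at S
  rcases S with h|h|h|h|h|h|h|h|h|h|h|h <;> obtain ⟨h1, h2, h3⟩ := h
  all_goals first | exact absurd h1 t0 | exact absurd h1 tB | skip
  all_goals
    qify at h1 h2 h3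
    simp only [hB, hC, hD] at h1 h2 h3
    exfalso
  · have a1 : q = 1 := canc (by linarith)
    have a2 : p = 0 := canc (by linarith)
    exact z1 (by rw [a1, a2]; norm_num)
  · have a1 : q = -1 := canc (by linarith)
    have a2 : p = -2 := canc (by linarith)
    exact z2 (by rw [a1, a2]; norm_num)
  · have a1 : q = 1 := canc (by linarith)
    have a2 : p = -2 := canc (by linarith)
    exact i1 (by rw [a1, a2]; norm_num)
  · have a1 : q = 1 := canc (by linarith)
    have a2 : p = 2 := canc (by linarith)
    exact i2 (by rw [a1, a2]; norm_num)
  · have a1 : q = -1 := canc (by linarith)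
    have a2 : p = 0 := canc (by linarith)
    exact i1 (by rw [a1, a2]; norm_num)
  · have a1 : q = -1 := canc (by linarith)
    have a2 : p = 0 := canc (by linarith)
    exact i1 (by rw [a1, a2]; norm_num)

open IntermediateField

lemma span_two {x y : ℂ} (h : Module.finrank ℚ ℚ⟮x, y⟯ = 2) (hx : ¬∃ r : ℚ, x = (r : ℂ))
    {z : ℂ} (hz : z ∈ ℚ⟮x, y⟯) : ∃ a b : ℚ, z = a + b*x := by
  have hxm : x ∈ ℚ⟮x, y⟯ := subset_adjoin _ _ (by simp)
  have li : LinearIndependent ℚ ![(1 : ℚ⟮x, y⟯), ⟨x, hxm⟩] := by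
    rw [LinearIndependent.pair_iff]
    intro s t hst
    have h2 : (s:ℂ) + t*x = 0 := by
      have := congrArg (Subtype.val) hst
      simpa [Algebra.smul_def] using this
    have ht : t = 0 := by
      by_contra ht
      have ht' : (t:ℂ) ≠ 0 := by exact_mod_cast ht
      refine hx ⟨-s/t, ?_⟩
      push_cast
      field_simp
      linear_combination h2
    subst ht
    simpa using h2
  have sp := li.span_eq_top_of_card_eq_finrank (by simp [h])
  have hm : (⟨z, hz⟩ : ℚ⟮x, y⟯) ∈ Submodule.span ℚ (Set.range ![(1 : ℚ⟮x, y⟯), ⟨x, hxm⟩]) := by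
    rw [sp]; trivial
  rw [Matrix.range_cons, Matrix.range_cons, Matrix.range_empty, Set.union_empty,
    Set.singleton_union, Submodule.mem_span_pair] at hm
  obtain ⟨a, b, hab⟩ := hm
  refine ⟨a, b, ?_⟩
  have := congrArg (Subtype.val) hab
  simpa [Algebra.smul_def, eq_comm] using this

lemma forward {x y : ℂ} (hE : y^2 = -x*(x^2+1)*(x^2-2*x-1))
    (h : Module.finrank ℚ ℚ⟮x, y⟯ = 2) (hx : ¬∃ r : ℚ, x = (r : ℂ)) :
    (x^2+1 = 0 ∨ x^2-2*x-1 = 0) ∧ y = 0 := by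
  have hxm : x ∈ ℚ⟮x, y⟯ := subset_adjoin _ _ (by simp)
  have hym : y ∈ ℚ⟮x, y⟯ := subset_adjoin _ _ (by simp)
  obtain ⟨q, p, hpq⟩ := span_two h hx (neg_mem (pow_mem hxm 2))
  obtain ⟨a, b, hab⟩ := span_two h hx hym
  have hu : x^2+p*x+q = 0 := by linear_combination -hpq
  obtain ⟨k, hk⟩ : ∃ k : ℚ, k = b^2-2-2*p^2-p^3+p*q := ⟨_, rfl⟩
  have hkC : (k:ℂ) = b^2-2-2*p^2-p^3+p*q := by rw [hk]; push_cast; ring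
  have hc : ((a^2-q*(k+p*q+2*q) : ℚ) : ℂ) +
      ((2*a*b-(1+p*k+2*p^2*q+4*p*q-q^2) : ℚ):ℂ)*x = 0 := by
    rw [hab] at hE
    push_cast
    rw [hkC]
    linear_combination hE - (x^3+(-2-p)*x^2+(p^2+2*p-q)*x+(b^2-2-2*p^2-p^3+p*q+p*q+2*q))*hu
  have c1 : 2*a*b-(1+p*k+2*p^2*q+4*p*q-q^2) = 0 := by
    by_contra ht
    refine hx ⟨-(a^2-q*(k+p*q+2*q))/(2*a*b-(1+p*k+2*p^2*q+4*p*q-q^2)), ?_⟩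
    have ht' : ((2*a*b-(1+p*k+2*p^2*q+4*p*q-q^2) : ℚ):ℂ) ≠ 0 := by exact_mod_cast ht
    rw [Rat.cast_div, eq_div_iff ht', Rat.cast_neg]
    linear_combination hc
  rw [c1] at hc
  have c0 : a^2-q*(k+p*q+2*q) = 0 := by
    have : ((a^2-q*(k+p*q+2*q) : ℚ) : ℂ) = 0 := by simpa using hc
    exact_mod_cast this
  have irr : ∀ r : ℚ, r^2+p*r+q ≠ 0 := by
    intro r hr
    have hr' : (r:ℂ)^2+p*r+q = 0 := by exact_mod_cast hr
    have : (x-r)*(x+r+p) = 0 := by linear_combination hu - hr'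
    rcases mul_eq_zero.1 this with h|h
    · exact hx ⟨r, by linear_combination h⟩
    · exact hx ⟨-r-p, by push_cast; linear_combination h⟩
  have hd : x^2+1 = 0 ∨ x^2-2*x-1 = 0 := by
    rcases rat_part (p := p) (q := q) (a := a) (b := b) (k := k) (by linarith) (by linarith)
      (by linarith) irr with ⟨rfl, rfl⟩ | ⟨rfl, rfl⟩
    · left; push_cast at hu; linear_combination hu
    · right; push_cast at hu; linear_combination hu
  refine ⟨hd, ?_⟩
  have : y^2 = 0 := by
    rcases hd with h|h <;> rw [hE, h] <;> ring
  simpa using this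

lemma backward {x : ℂ} (p q : ℚ) (hu : x^2+p*x+q = 0) (irr : ¬∃ r : ℚ, x = (r : ℂ)) :
    Module.finrank ℚ ℚ⟮x, (0:ℂ)⟯ = 2 := by
  have e : ℚ⟮x, (0:ℂ)⟯ = ℚ⟮x⟯ := by
    apply le_antisymm
    · rw [adjoin_le_iff]
      rintro z (rfl | rfl)
      · exact mem_adjoin_simple_self _ _
      · exact zero_mem _
    · exact adjoin.mono _ _ _ (by simp)
  rw [e]
  have hm : (Polynomial.X^2 + Polynomial.C p * Polynomial.X + Polynomial.C q : Polynomial ℚ).Monic := by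
    monicity!
  have hr : Polynomial.aeval x (Polynomial.X^2 + Polynomial.C p * Polynomial.X + Polynomial.C q : Polynomial ℚ) = 0 := by
    simpa using hu
  have hi : IsIntegral ℚ x := ⟨_, hm, hr⟩
  rw [adjoin.finrank hi]
  apply le_antisymm
  · refine (Polynomial.natDegree_le_of_dvd (minpoly.dvd ℚ x hr) hm.ne_zero).trans ?_
    compute_degree
  · rw [minpoly.two_le_natDegree_iff hi]
    rintro ⟨r, hr⟩
    exact irr ⟨r, by simpa using hr.symm⟩

lemma I_irr : ∀ z : ℂ, z^2+1 = 0 → ¬∃ r : ℚ, z = (r : ℂ) := by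
  rintro z hz ⟨r, rfl⟩
  have : r^2+1 = 0 := by exact_mod_cast hz
  nlinarith [sq_nonneg r]

lemma s_irr : ∀ z : ℂ, z^2-2*z-1 = 0 → ¬∃ r : ℚ, z = (r : ℂ) := by
  rintro z hz ⟨r, rfl⟩
  have : r^2-2*r-1 = 0 := by exact_mod_cast hz
  have := two_sq_rat (u := 1) (v := r-1) (by linarith)
  exact one_ne_zero this.1

lemma sqrt2C : ((Real.sqrt 2 : ℝ):ℂ)^2 = 2 := by
  rw [← Complex.ofReal_pow, Real.sq_sqrt (by norm_num)]; norm_num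

end X16

open IntermediateField

/-- The non-obvious quadratic points on the affine model `y² = -x(x² + 1)(x² - 2x - 1)` of the
modular curve `X₁(16)` are exactly `(i, 0)`, `(-i, 0)`, `(1 + √2, 0)` and `(1 - √2, 0)`. -/
theorem X1_16_nonobvious_quadratic_points :
    {p : ℂ × ℂ |
        p.2 ^ 2 = -p.1 * (p.1 ^ 2 + 1) * (p.1 ^ 2 - 2 * p.1 - 1) ∧
        Module.finrank ℚ ℚ⟮p.1, p.2⟯ = 2 ∧
        ¬∃ r : ℚ, p.1 = (r : ℂ)} =
      {(Complex.I, 0), (-Complex.I, 0),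
        (1 + (Real.sqrt 2 : ℂ), 0), (1 - (Real.sqrt 2 : ℂ), 0)} := by
  ext ⟨x, y⟩
  simp only [Set.mem_ofPred_eq, Set.mem_insert_iff, Set.mem_singleton_iff, Prod.mk.injEq]
  constructor
  · rintro ⟨h1, h2, h3⟩
    obtain ⟨h | h, rfl⟩ := X16.forward h1 h2 h3
    · have : (x-Complex.I)*(x+Complex.I) = 0 := by
        linear_combination h - Complex.I_sq
      rcases mul_eq_zero.1 this with h|h
      · left; exact ⟨by linear_combination h, rfl⟩
      · right; left; exact ⟨by linear_combination h, rfl⟩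
    · have : (x-(1+(Real.sqrt 2 : ℂ)))*(x-(1-(Real.sqrt 2 : ℂ))) = 0 := by
        linear_combination h - X16.sqrt2C
      rcases mul_eq_zero.1 this with h|h
      · right; right; left; exact ⟨by linear_combination h, rfl⟩
      · right; right; right; exact ⟨by linear_combination h, rfl⟩
  · intro h
    have hy : y = 0 := by tauto
    subst hy
    have hx : x^2+1 = 0 ∨ x^2-2*x-1 = 0 := by
      rcases h with ⟨rfl, -⟩|⟨rfl, -⟩|⟨rfl, -⟩|⟨rfl, -⟩
      · left; simp
      · left; simp
      · right; linear_combination X16.sqrt2C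
      · right; linear_combination X16.sqrt2C
    rcases hx with h|h
    · refine ⟨by rw [h]; ring, ?_, X16.I_irr x h⟩
      exact X16.backward 0 1 (by push_cast; linear_combination h) (X16.I_irr x h)
    · refine ⟨by rw [h]; ring, ?_, X16.s_irr x h⟩
      exact X16.backward (-2) (-1) (by push_cast; linear_combination h) (X16.s_irr x h)
end

section
/- Let K be a quadratic field and let c ∈ K be such that the map f_c(z) = z² + c has a point p ∈ K of exact period 4 (as holds in particular when the preperiodic graph G(f_c, K) is of type 8(4)). Then there is a rational number x ∉ {0, 1, −1} such that c = (x² − 4x − 1)(x⁴ + x³ + 2x² − x + 1) / (4x(x−1)²(x+1)²) and K = ℚ(√(−x(x² + 1)(x² − 2x − 1))). In particular, c ∈ ℚ. -/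
open IntermediateField

namespace G84

/-- The Kummer quartic. -/
def kF {R : Type*} [CommRing R] (A B C D : R) : R :=
  (C^2-D^2-2*B*C+2*A*D-2*A^2+2*B^2)^2 - 16*A*B*C*D

def kQ {R : Type*} [CommRing R] (A B C D : R) : R := 2*(A+B)^2-(C-D)^2

def pS0 {R : Type*} [CommRing R] (A B C D : R) : R := D^2-C^2+2*A^2-2*B^2
def pS1 {R : Type*} [CommRing R] (A B C D : R) : R := 2*C*D+4*A*B
def pR0 {R : Type*} [CommRing R] (A B C D : R) : R := 2*(D*A-C*B)
def pR1 {R : Type*} [CommRing R] (A B C D : R) : R := 2*(D*B+C*A)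

/-- `PhiEq v m k` says that `φ(v) = m k`. -/
def PhiEq {R : Type*} [CommRing R] (A B C D m A' B' C' D' : R) : Prop :=
  pS0 A B C D - pR0 A B C D - pR1 A B C D = m * A' ∧
  - pS0 A B C D + pR0 A B C D - pR1 A B C D = m * B' ∧
  - pS0 A B C D - pS1 A B C D + 2 * pR0 A B C D = m * C' ∧
  pS0 A B C D - pS1 A B C D - 2 * pR0 A B C D = m * D'

def sSq (A B C D : ℚ) : Prop :=
  IsSquare (2*A*C*kQ A B C D) ∧ IsSquare (2*B*D*kQ A B C D)


lemma transferAC {A B C D m A' B' C' D' : ℚ} (hm : m ≠ 0) (h : PhiEq A B C D m A' B' C' D')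
    (hF : kF A B C D = 0) (hs : IsSquare (2*A'*C')) (h0 : A'*C' ≠ 0) : sSq A B C D := by
  obtain ⟨h1, -, h3, -⟩ := h
  obtain ⟨r, hr⟩ := hs
  have hr0 : r ≠ 0 := by
    rintro rfl
    apply h0
    linarith
  unfold pS0 pR0 pR1 at h1
  unfold pS0 pS1 pR0 at h3
  unfold kF at hF
  constructor
  · have key : 4 * (m*A') * (m*C') * (A*C*kQ A B C D) = ((4)*A^4 + (4)*A^3*B + (-8)*A^3*C + (-8)*A^3*D + (-4)*A^2*B^2 + (-4)*A^2*B*D + (-4)*A^2*C^2 + (10)*A^2*C*D + (6)*A^2*D^2 + (-4)*A*B^3 + (4)*A*B^2*C + (4)*A*B^2*D + (-10)*A*B*C^2 + (-8)*A*B*C*D + (2)*A*B*D^2 + (4)*A*C^3 + (-2)*A*C*D^2 + (-2)*A*D^3 + (-4)*B^3*C + (6)*B^2*C^2 + (-2)*B^2*C*D + (-4)*B*C^3 + (2)*B*C^2*D + (2)*B*C*D^2 + (1)*C^4 + (-1)*C^3*D + (-1)*C^2*D^2 + (1)*C*D^3)^2 := by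
      rw [← h1, ← h3]
      unfold kQ
      linear_combination ((-4)*A^4 + (-8)*A^3*B + (8)*A^3*C + (8)*A^3*D + (-4)*A^2*B^2 + (-8)*A^2*B*C + (8)*A^2*B*D + (-4)*A^2*C^2 + (-12)*A^2*C*D + (-4)*A^2*D^2 + (-16)*A*B^2*C + (12)*A*B*C^2 + (-4)*A*B*C*D + (-4)*A*C^3 + (-4)*A*C^2*D + (8)*A*C*D^2 + (-4)*B^2*C^2 + (4)*B*C^3 + (-4)*B*C^2*D + (-1)*C^4 + (2)*C^3*D + (-1)*C^2*D^2) * hF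
    generalize ((4)*A^4 + (4)*A^3*B + (-8)*A^3*C + (-8)*A^3*D + (-4)*A^2*B^2 + (-4)*A^2*B*D + (-4)*A^2*C^2 + (10)*A^2*C*D + (6)*A^2*D^2 + (-4)*A*B^3 + (4)*A*B^2*C + (4)*A*B^2*D + (-10)*A*B*C^2 + (-8)*A*B*C*D + (2)*A*B*D^2 + (4)*A*C^3 + (-2)*A*C*D^2 + (-2)*A*D^3 + (-4)*B^3*C + (6)*B^2*C^2 + (-2)*B^2*C*D + (-4)*B*C^3 + (2)*B*C^2*D + (2)*B*C*D^2 + (1)*C^4 + (-1)*C^3*D + (-1)*C^2*D^2 + (1)*C*D^3) = s at key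
    refine ⟨s / (m * r), ?_⟩
    field_simp
    linear_combination key - 2*m^2*A*C*kQ A B C D * hr
  · have key : 4 * (m*A') * (m*C') * (B*D*kQ A B C D) = ((4)*A^4 + (4)*A^3*B + (-8)*A^3*D + (-4)*A^2*B^2 + (8)*A^2*B*C + (-12)*A^2*B*D + (-4)*A^2*C^2 + (2)*A^2*C*D + (6)*A^2*D^2 + (-4)*A*B^3 + (4)*A*B^2*C + (-4)*A*B^2*D + (-2)*A*B*C^2 + (-8)*A*B*C*D + (10)*A*B*D^2 + (4)*A*C^2*D + (-2)*A*C*D^2 + (-2)*A*D^3 + (-4)*B^3*C + (6)*B^2*C^2 + (-10)*B^2*C*D + (-4)*B*C^3 + (6)*B*C^2*D + (-2)*B*C*D^2 + (1)*C^4 + (-1)*C^3*D + (-1)*C^2*D^2 + (1)*C*D^3)^2 := by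
      rw [← h1, ← h3]
      unfold kQ
      linear_combination ((-4)*A^4 + (-8)*A^3*B + (8)*A^3*D + (-4)*A^2*B^2 + (-8)*A^2*B*C + (16)*A^2*B*D + (4)*A^2*C^2 + (-4)*A^2*C*D + (-4)*A^2*D^2 + (-8)*A*B^2*C + (4)*A*B*C^2 + (-4)*A*B*C*D + (-8)*A*B*D^2 + (-4)*A*C^2*D + (4)*A*C*D^2 + (-8)*B^3*D + (-4)*B^2*C^2 + (8)*B^2*C*D + (-8)*B^2*D^2 + (4)*B*C^3 + (-8)*B*C^2*D + (4)*B*D^3 + (-1)*C^4 + (2)*C^3*D + (-1)*C^2*D^2) * hF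
    generalize ((4)*A^4 + (4)*A^3*B + (-8)*A^3*D + (-4)*A^2*B^2 + (8)*A^2*B*C + (-12)*A^2*B*D + (-4)*A^2*C^2 + (2)*A^2*C*D + (6)*A^2*D^2 + (-4)*A*B^3 + (4)*A*B^2*C + (-4)*A*B^2*D + (-2)*A*B*C^2 + (-8)*A*B*C*D + (10)*A*B*D^2 + (4)*A*C^2*D + (-2)*A*C*D^2 + (-2)*A*D^3 + (-4)*B^3*C + (6)*B^2*C^2 + (-10)*B^2*C*D + (-4)*B*C^3 + (6)*B*C^2*D + (-2)*B*C*D^2 + (1)*C^4 + (-1)*C^3*D + (-1)*C^2*D^2 + (1)*C*D^3) = s at key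
    refine ⟨s / (m * r), ?_⟩
    field_simp
    linear_combination key - 2*m^2*B*D*kQ A B C D * hr

lemma transfer {A B C D m A' B' C' D' : ℚ} (hm : m ≠ 0) (h : PhiEq A B C D m A' B' C' D')
    (hF : kF A B C D = 0) (hs : IsSquare (2*A'*C')) (hs' : IsSquare (2*B'*D'))
    (h0 : A'*C' ≠ 0 ∨ B'*D' ≠ 0) : sSq A B C D := by
  rcases h0 with h0 | h0
  · exact transferAC hm h hF hs h0
  · obtain ⟨h1, h2, h3, h4⟩ := h
    have h' : PhiEq B A D C m B' A' D' C' := by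
      unfold PhiEq pS0 pS1 pR0 pR1 at *
      refine ⟨?_, ?_, ?_, ?_⟩
      · linear_combination h2
      · linear_combination h1
      · linear_combination h4
      · linear_combination h3
    have hF' : kF B A D C = 0 := by
      unfold kF at *; linear_combination hF
    obtain ⟨ha, hb⟩ := transferAC hm h' hF' hs' h0
    have e : kQ B A D C = kQ A B C D := by unfold kQ; ring
    rw [e] at ha hb
    exact ⟨hb, ha⟩


lemma gaussA {S0 S1 r0 r1 g h u0 u1 L : ℚ}
    (e3 : S0^2+S1^2-2*(r0^2+r1^2) = h^2-2*g^2)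
    (e4 : r1*S0-r0*S1 = -(g*h))
    (z0 : 2*(u0*S0-u1*S1) = u0^2-u1^2+2*(r0^2-r1^2))
    (z1 : 2*(u0*S1+u1*S0) = 2*u0*u1+4*r0*r1)
    (hL : L = 4*(u0^2+u1^2)) (hLpos : 0 < L) (hn : h^2+2*g^2 ≠ 0) :
    ∃ m : ℚ, m^2 = L ∧ u0*2 + m ≠ 0 := by
  obtain ⟨E0, hE0⟩ : ∃ z : ℚ, z = (u0^2+u1^2)-2*(r0^2+r1^2) := ⟨_, rfl⟩
  obtain ⟨E1, hE1⟩ : ∃ z : ℚ, z = 2*(r1*u0-r0*u1) := ⟨_, rfl⟩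
  have f1 : E0^2-2*E1^2 = (h^2-2*g^2)*L := by
    have : 4*(u0^2+u1^2)*(S0^2+S1^2) = (u0^2-u1^2+2*(r0^2-r1^2))^2+(2*u0*u1+4*r0*r1)^2 := by
      rw [← z0, ← z1]; ring
    rw [← e3, hL, hE0, hE1]; linear_combination -this
  have f2 : E0*E1 = -(g*h)*L := by
    rw [← e4, hL, hE0, hE1]
    linear_combination -2*(r0*u1+r1*u0)*z0 + 2*(r0*u0-r1*u1) * z1
  have f3 : (E0*h-2*E1*g)^2-2*(E0*g+E1*h)^2 = (h^2+2*g^2)^2*L := by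
    linear_combination (h^2-2*g^2)*f1 - 8*g*h*f2
  have f4 : (E0*h-2*E1*g)*(E0*g+E1*h) = 0 := by
    linear_combination g*h*f1 + (h^2-2*g^2)*f2
  have hn2 : 0 < (h^2+2*g^2)^2*L := by positivity
  have f5 : E0*g+E1*h = 0 := by
    rcases mul_eq_zero.1 f4 with h0 | h0
    · exfalso
      rw [h0] at f3
      have := sq_nonneg (E0*g+E1*h)
      linarith
    · exact h0
  rw [f5] at f3
  obtain ⟨m, hm⟩ : ∃ m : ℚ, m^2 = L := by
    refine ⟨(E0*h-2*E1*g)/(h^2+2*g^2), ?_⟩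
    rw [div_pow, div_eq_iff (by positivity)]
    linear_combination f3
  by_cases hq : u0*2+m = 0
  · refine ⟨-m, by rw [neg_sq, hm], fun h' => ?_⟩
    have : m = 0 := by linarith
    subst this
    linarith
  · exact ⟨m, hm, hq⟩

lemma gaussB {S0 S1 r0 r1 u0 u1 L m w w' n : ℚ}
    (hu0 : u0 = S0 - w) (hu1 : u1 = S1 + w')
    (e5 : w^2+w'^2 = n)
    (z0 : 2*(u0*S0-u1*S1) = u0^2-u1^2+2*(r0^2-r1^2))
    (z1 : 2*(u0*S1+u1*S0) = 2*u0*u1+4*r0*r1)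
    (hL : L = 4*(u0^2+u1^2)) (hLpos : 0 < L) (hm : m^2 = L) (hq : u0*2+m ≠ 0) :
    ∃ P0 P1 Q0 Q1 t : ℚ, t ≠ 0 ∧ P0^2-P1^2+2*(Q0^2-Q1^2) = t*S0 ∧ 2*P0*P1+4*Q0*Q1 = t*S1 ∧
      2*(P0*Q0-P1*Q1) = -t*r0 ∧ 2*(P0*Q1+P1*Q0) = -t*r1 ∧
      (P0^2-P1^2-2*(Q0^2-Q1^2))^2 + (2*P0*P1-4*Q0*Q1)^2 = t^2*n := by
  have hm0 : m ≠ 0 := by rintro rfl; norm_num at hm; linarith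
  rw [hL] at hm
  obtain ⟨t, ht⟩ : ∃ t, t = m^2*(4*u0+2*m) := ⟨_, rfl⟩
  obtain ⟨P0, hP0⟩ : ∃ z, z = m*(m+2*u0)/2 := ⟨_, rfl⟩
  obtain ⟨P1, hP1⟩ : ∃ z, z = m*u1 := ⟨_, rfl⟩
  obtain ⟨Q0, hQ0⟩ : ∃ z, z = -(r0*(m+2*u0)+r1*(2*u1)) := ⟨_, rfl⟩
  obtain ⟨Q1, hQ1⟩ : ∃ z, z = -(r1*(m+2*u0)-r0*(2*u1)) := ⟨_, rfl⟩
  have a0 : P0^2-P1^2 = t*u0/2 := by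
    subst hP0 hP1 ht; linear_combination (m^2/4)*hm
  have a1 : 2*P0*P1 = t*u1/2 := by
    subst hP0 hP1 ht; ring
  have c0 : (m+2*u0)^2-(2*u1)^2 = 2*u0*(4*u0+2*m) := by linear_combination hm
  have b0 : 2*(Q0^2-Q1^2) = t*(S0+w)/2 := by
    have w0 : S0 + w = 2*S0-u0 := by linarith
    rw [w0]; subst hQ0 hQ1 ht
    have : 2*(r0^2-r1^2) = 2*(u0*S0-u1*S1) - (u0^2-u1^2) := by linarith
    have h2 : 4*r0*r1 = 2*(u0*S1+u1*S0) - 2*u0*u1 := by linarith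
    have : 2*((-(r0*(m+2*u0)+r1*(2*u1)))^2-(-(r1*(m+2*u0)-r0*(2*u1)))^2) =
      2*(r0^2-r1^2)*((m+2*u0)^2-(2*u1)^2) + 4*r0*r1*(2*(m+2*u0)*(2*u1)) := by ring
    rw [this, ‹2*(r0^2-r1^2) = _›, h2, c0, hm]; ring
  have b1 : 4*Q0*Q1 = t*(S1-w')/2 := by
    have w0 : S1-w' = 2*S1-u1 := by linarith
    rw [w0]; subst hQ0 hQ1 ht
    have : 2*(r0^2-r1^2) = 2*(u0*S0-u1*S1) - (u0^2-u1^2) := by linarith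
    have h2 : 4*r0*r1 = 2*(u0*S1+u1*S0) - 2*u0*u1 := by linarith
    have : 4*(-(r0*(m+2*u0)+r1*(2*u1)))*(-(r1*(m+2*u0)-r0*(2*u1))) =
      4*r0*r1*((m+2*u0)^2-(2*u1)^2) - 2*(r0^2-r1^2)*(2*(m+2*u0)*(2*u1)) := by ring
    rw [this, ‹2*(r0^2-r1^2) = _›, h2, c0, hm]; ring
  have d0 : (m+2*u0)^2+(2*u1)^2 = m*(4*u0+2*m) := by linear_combination -hm
  refine ⟨P0, P1, Q0, Q1, t, ?_, ?_, ?_, ?_, ?_, ?_⟩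
  · rw [ht]
    refine mul_ne_zero (pow_ne_zero _ hm0) fun h => hq (by linarith)
  · rw [a0, b0, hu0]; ring
  · rw [a1, b1, hu1]; ring
  · rw [hP0, hP1, hQ0, hQ1, ht]; linear_combination (-m*r0) * d0
  · rw [hP0, hP1, hQ0, hQ1, ht]; linear_combination (-m*r1) * d0
  · rw [a0, b0, a1, b1, ← e5, hu0, hu1]; ring

lemma exPre {A B C D g h w w' : ℚ} (hg : g^2 = A*B) (hh : h^2 = C*D)
    (hgh : 4*(g*h) = C^2-D^2-2*B*C+2*A*D-2*A^2+2*B^2)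
    (hw : 4*w^2 = 2*(A+B)^2-(C-D)^2) (hw' : 4*w'^2 = (C+D)^2-2*(A-B)^2)
    (hww : 4*(w*w') = C^2-D^2+4*A*D-4*B*C-2*A^2+2*B^2)
    (hn : h^2+2*g^2 ≠ 0) :
    ∃ A' B' C' D' m : ℚ, m ≠ 0 ∧ PhiEq A' B' C' D' m A B C D ∧ kF A' B' C' D' = 0 := by
  obtain ⟨S1, hS1⟩ : ∃ z : ℚ, z = -(C+D)/2 := ⟨_, rfl⟩
  obtain ⟨r1, hr1⟩ : ∃ z : ℚ, z = (A+B)/2 := ⟨_, rfl⟩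
  obtain ⟨r0, hr0⟩ : ∃ z : ℚ, z = (D-C-A+B)/2 := ⟨_, rfl⟩
  obtain ⟨S0, hS0⟩ : ∃ z : ℚ, z = (A-B)-(D-C)/2 := ⟨_, rfl⟩
  have e1 : S0^2-S1^2-2*r0^2+2*r1^2 = w^2-w'^2 := by
    subst hS0 hS1 hr0 hr1; linear_combination (-1/4)*hw + (1/4)*hw'
  have e2 : 2*S0*S1-4*r0*r1 = -2*(w*w') := by
    subst hS0 hS1 hr0 hr1; linear_combination (1/2)*hww
  have e3 : S0^2+S1^2-2*(r0^2+r1^2) = h^2-2*g^2 := by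
    subst hS0 hS1 hr0 hr1; linear_combination 2*hg-hh
  have e4 : r1*S0-r0*S1 = -(g*h) := by
    subst hS0 hS1 hr0 hr1; linear_combination (1/4)*hgh
  have e5 : w^2+w'^2 = h^2+2*g^2 := by linear_combination (1/4)*hw + (1/4)*hw' - 2*hg-hh
  have main : ∃ w w' : ℚ, S0^2-S1^2-2*r0^2+2*r1^2 = w^2-w'^2 ∧ 2*S0*S1-4*r0*r1 = -2*(w*w') ∧
      w^2+w'^2 = h^2+2*g^2 ∧ (S0-w)^2+(S1+w')^2 ≠ 0 := by
    by_cases hd : (S0-w)^2+(S1+w')^2 = 0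
    · refine ⟨-w, -w', by linear_combination e1, by linear_combination e2,
        by linear_combination e5, fun hd' => hn ?_⟩
      rw [← e5]
      have k1 := sq_nonneg S0
      have k2 := sq_nonneg S1
      have k3 := sq_nonneg w
      have k4 := sq_nonneg w'
      linarith
    · exact ⟨w, w', e1, e2, e5, hd⟩
  clear e1 e2 e5 hw hw' hww w w'
  obtain ⟨w, w', e1, e2, e5, hd⟩ := main
  obtain ⟨u0, hu0⟩ : ∃ z : ℚ, z = S0 - w := ⟨_, rfl⟩
  obtain ⟨u1, hu1⟩ : ∃ z : ℚ, z = S1 + w' := ⟨_, rfl⟩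
  rw [← hu0, ← hu1] at hd
  have z0 : 2*(u0*S0-u1*S1) = u0^2-u1^2+2*(r0^2-r1^2) := by
    subst hu0 hu1; linear_combination e1
  have z1 : 2*(u0*S1+u1*S0) = 2*u0*u1+4*r0*r1 := by
    subst hu0 hu1; linear_combination e2
  have hLpos : 0 < 4*(u0^2+u1^2) := by
    have : 0 ≤ u0^2+u1^2 := by positivity
    have := lt_of_le_of_ne this (Ne.symm hd)
    linarith
  obtain ⟨m, hm, hq⟩ := gaussA e3 e4 z0 z1 rfl hLpos hn
  obtain ⟨P0, P1, Q0, Q1, t, ht, q1, q2, q3, q4, q5⟩ :=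
    gaussB hu0 hu1 e5 z0 z1 rfl hLpos hm hq
  clear hm hq hLpos z0 z1 hd hu0 hu1 e1 e2 e3 e4 e5
  have g1 : pS0 Q0 Q1 P1 P0 = t*S0 := by unfold pS0; linear_combination q1
  have g2 : pS1 Q0 Q1 P1 P0 = t*S1 := by unfold pS1; linear_combination q2
  have g3 : pR0 Q0 Q1 P1 P0 = -t*r0 := by unfold pR0; linear_combination q3
  have g4 : pR1 Q0 Q1 P1 P0 = -t*r1 := by unfold pR1; linear_combination q4
  have hphi : PhiEq Q0 Q1 P1 P0 t A B C D := by
    unfold PhiEq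
    rw [g1, g2, g3, g4]
    subst hS0 hS1 hr0 hr1
    refine ⟨?_, ?_, ?_, ?_⟩ <;> ring
  refine ⟨Q0, Q1, P1, P0, t, ht, hphi, ?_⟩
  obtain ⟨h1, h2, h3, h4⟩ := hphi
  have key : (t*C)*(t*D)+2*(t*A)*(t*B) - ((P0^2-P1^2-2*(Q0^2-Q1^2))^2 + (2*P0*P1-4*Q0*Q1)^2)
      = -4 * kF Q0 Q1 P1 P0 := by
    rw [← h1, ← h2, ← h3, ← h4]
    unfold pS0 pS1 pR0 pR1 kF
    ring
  rw [q5, hh, hg] at key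
  linear_combination (1/4)*key


/-- `X²+sX+t ∣ f - (aX+b)²`. -/
def Mum (s t a b : ℚ) : Prop :=
  2*a*b-a^2*s = -(s^4-3*s^2*t+t^2)+2*(-s^3+2*s*t)-2*s+1 ∧
  b^2-a^2*t = t*(-s^3+2*s*t+2*t-2*s^2-2)

lemma mumOf {s t κ o1 o2 N : ℚ} (hN : N = 2*(1+t)^2-(t-s-1)^2) (hN0 : N ≠ 0)
    (h1 : o1^2 = (κ-s+2*t)*N) (h2 : o2^2 = t*(κ+s+2)*N)
    (h3 : 8*(o1*o2) = ((κ-s+2*t)^2-(κ+s+2)^2-4*t*(κ-s+2*t)+4*(κ+s+2)-8+8*t^2)*N) :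
    ∃ a b, Mum s t a b ∧ (a = 0 → b = 0 → o1 = 0 ∧ o2 = 0) := by
  obtain ⟨a, ha⟩ : ∃ a, a = -((s^2-t+2*s-1)*o1+(s+2)*o2)/N := ⟨_, rfl⟩
  obtain ⟨b, hb⟩ : ∃ b, b = -((t+1)*o2+t*(s+2)*o1)/N := ⟨_, rfl⟩
  have ha' : N*a = -((s^2-t+2*s-1)*o1+(s+2)*o2) := by rw [ha]; field_simp
  have hb' : N*b = -((t+1)*o2+t*(s+2)*o1) := by rw [hb]; field_simp
  have hN2 : N^2 ≠ 0 := pow_ne_zero _ hN0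
  have aa : a^2 = κ+2+2*s^2+s^3-s*t := by
    apply mul_left_cancel₀ hN2
    have : N^2*a^2 = (N*a)^2 := by ring
    rw [this, ha']
    have : (-((s^2-t+2*s-1)*o1+(s+2)*o2))^2 = (s^2-t+2*s-1)^2*o1^2+(s+2)^2*o2^2
      + (s^2-t+2*s-1)*(s+2)/4*(8*(o1*o2)) := by ring
    rw [this, h1, h2, h3, hN]; ring
  have ab : 2*a*b = s*a^2 + (-(s^4-3*s^2*t+t^2)+2*(-s^3+2*s*t)-2*s+1) := by
    rw [aa]
    apply mul_left_cancel₀ hN2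
    have : N^2*(2*a*b) = 2*(N*a)*(N*b) := by ring
    rw [this, ha', hb']
    have : 2*(-((s^2-t+2*s-1)*o1+(s+2)*o2))*(-((t+1)*o2+t*(s+2)*o1)) =
      2*(s^2-t+2*s-1)*t*(s+2)*o1^2+2*(s+2)*(t+1)*o2^2
      + ((s^2-t+2*s-1)*(t+1)+(s+2)^2*t)/4*(8*(o1*o2)) := by ring
    rw [this, h1, h2, h3, hN]; ring
  have bb : b^2 = t*a^2 + t*(-s^3+2*s*t+2*t-2*s^2-2) := by
    rw [aa]
    apply mul_left_cancel₀ hN2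
    have : N^2*b^2 = (N*b)^2 := by ring
    rw [this, hb']
    have : (-((t+1)*o2+t*(s+2)*o1))^2 =
      (t*(s+2))^2*o1^2+(t+1)^2*o2^2
      + (t+1)*t*(s+2)/4*(8*(o1*o2)) := by ring
    rw [this, h1, h2, h3, hN]; ring
  refine ⟨a, b, ⟨by linear_combination ab, by linear_combination bb⟩, fun a0 b0 => ?_⟩
  rw [a0] at ha'
  rw [b0] at hb'
  constructor
  · apply mul_left_cancel₀ hN0
    rw [hN]; linear_combination (-(t+1))*ha' + (s+2)*hb'
  · apply mul_left_cancel₀ hN0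
    rw [hN]; linear_combination (s+2)*t*ha' - (s^2-t+2*s-1)*hb'

lemma mumOfK {A B C D : ℚ} (hF : kF A B C D = 0) (hS : sSq A B C D) (hA : A ≠ 0)
    (hQ : kQ A B C D ≠ 0) :
    ∃ a b, Mum (-(C-D+A-B)/A) (B/A) a b ∧ (a = 0 → b = 0 → A*C = 0 ∧ B*D = 0) := by
  obtain ⟨⟨p1, hp1⟩, ⟨p2, hp2⟩⟩ := hS
  have hp : ∃ p2, 2*B*D*kQ A B C D = p2*p2 ∧
      2*(p1*p2) = (C^2-D^2-2*B*C+2*A*D-2*A^2+2*B^2) * kQ A B C D := by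
    have : (2*(p1*p2))^2 = ((C^2-D^2-2*B*C+2*A*D-2*A^2+2*B^2) * kQ A B C D)^2 := by
      unfold kF at hF
      have : (2*(p1*p2))^2 = 4*(p1*p1)*(p2*p2) := by ring
      rw [this, ← hp1, ← hp2]
      linear_combination (-(kQ A B C D)^2)*hF
    rcases sq_eq_sq_iff_eq_or_eq_neg.1 this with h | h
    · exact ⟨p2, hp2, h⟩
    · exact ⟨-p2, by rw [hp2]; ring, by linear_combination -h⟩
  clear hp2 p2
  obtain ⟨p2, hp2, hp3⟩ := hp
  have hA2 : A^2 ≠ 0 := pow_ne_zero _ hA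
  have hc : (2*C/A - (C-D+A-B)/A - 2*(B/A)) - (-(C-D+A-B)/A) + 2*(B/A) = 2*C/A := by ring
  have hd : (2*C/A - (C-D+A-B)/A - 2*(B/A)) + (-(C-D+A-B)/A) + 2 = 2*D/A := by
    field_simp; ring
  have := @mumOf (-(C-D+A-B)/A) (B/A) (2*C/A - (C-D+A-B)/A - 2*(B/A)) (p1/A^2) (p2/A^2)
    (kQ A B C D/A^2) (by unfold kQ; field_simp; ring) (div_ne_zero hQ hA2)
    (by rw [hc]; field_simp; linear_combination -hp1)
    (by rw [hd]; field_simp; linear_combination -hp2)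
    (by rw [hc, hd]; field_simp; linear_combination 4*hp3)
  obtain ⟨a, b, hm, hz⟩ := this
  refine ⟨a, b, hm, fun a0 b0 => ?_⟩
  obtain ⟨q1, q2⟩ := hz a0 b0
  have q1' : p1 = 0 := by simpa [hA] using q1
  have q2' : p2 = 0 := by simpa [hA] using q2
  rw [q1'] at hp1
  rw [q2'] at hp2
  constructor
  · have : A*C*kQ A B C D = 0 := by linarith
    exact (mul_eq_zero.1 this).resolve_right hQ
  · have : B*D*kQ A B C D = 0 := by linarith
    exact (mul_eq_zero.1 this).resolve_right hQ

lemma sqrt2 {a b : ℚ} (h : 2*a^2 = b^2) : a = 0 ∧ b = 0 := by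
  by_cases ha : a = 0
  · subst ha; exact ⟨rfl, by simpa using h.symm⟩
  · exfalso
    have : (b/a)^2 = 2 := by field_simp; linarith
    have h2 : ¬ IsSquare (2:ℚ) := by
      rw [Rat.isSquare_iff]; norm_num
    exact h2 ⟨b/a, by rw [← this]; ring⟩

def Good (A B C D : ℚ) : Prop :=
  kF A B C D = 0 ∧ sSq A B C D ∧ A ≠ 0 ∧ ¬ IsSquare ((C-D+A-B)^2-4*A*B) ∧ ¬ (C = 0 ∧ D = 0)

lemma Good.Bne {A B C D : ℚ} (h : Good A B C D) : B ≠ 0 := by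
  rintro rfl
  exact h.2.2.2.1 ⟨C-D+A, by ring⟩

lemma Good.Qne {A B C D : ℚ} (h : Good A B C D) : kQ A B C D ≠ 0 := by
  intro hQ
  unfold kQ at hQ
  obtain ⟨h1, h2⟩ := sqrt2 (a := A+B) (b := C-D) (by linarith)
  have hB : B = -A := by linarith
  have hD : D = C := by linarith
  have := h.1
  unfold kF at this
  subst hB hD
  have h3 : A^2*D^2 = 0 := by linarith
  have h4 : D = 0 := by simpa [h.2.2.1] using h3
  exact h.2.2.2.2 ⟨h4, h4⟩

lemma goodOf {s t a b : ℚ} (h : Mum s t a b) (hns : ¬ IsSquare (s^2-4*t)) (h0 : ¬ (a = 0 ∧ b = 0)) :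
    ∃ A B C D, Good A B C D := by
  obtain ⟨e1, e2⟩ := h
  obtain ⟨κ, hκ⟩ : ∃ κ, κ = a^2-2-2*s^2-s^3+s*t := ⟨_, rfl⟩
  obtain ⟨N, hN⟩ : ∃ N, N = 2*(1+t)^2-(t-s-1)^2 := ⟨_, rfl⟩
  obtain ⟨o1, ho1⟩ : ∃ o1, o1 = a*(t+1)-b*(s+2) := ⟨_, rfl⟩
  obtain ⟨o2, ho2⟩ : ∃ o2, o2 = -a*t*(s+2)+b*(s^2-t+2*s-1) := ⟨_, rfl⟩
  have hN0 : N ≠ 0 := by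
    intro hN'
    rw [hN'] at hN
    obtain ⟨h1, h2⟩ := sqrt2 (a := 1+t) (b := t-s-1) (by linarith)
    have ht : t = -1 := by linarith
    have hs : s = -2 := by linarith
    subst ht hs
    apply h0
    constructor <;> nlinarith [sq_nonneg a, sq_nonneg b]
  have h1 : o1^2 = (κ-s+2*t)*N := by
    rw [ho1, hκ, hN]; linear_combination (-(t+1)*(s+2))*e1 + (s+2)^2*e2
  have h2 : o2^2 = t*(κ+s+2)*N := by
    rw [ho2, hκ, hN]
    linear_combination (-t*(s+2)*(s^2-t+2*s-1))*e1 + (s^2-t+2*s-1)^2*e2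
  have h3 : 8*(o1*o2) = ((κ-s+2*t)^2-(κ+s+2)^2-4*t*(κ-s+2*t)+4*(κ+s+2)-8+8*t^2)*N := by
    rw [ho1, ho2, hκ, hN]
    linear_combination 4*((t+1)*(s^2-t+2*s-1)+t*(s+2)^2)*e1 - 8*(s+2)*(s^2-t+2*s-1)*e2
  refine ⟨2, 2*t, κ-s+2*t, κ+s+2, ?_, ⟨⟨4*o1, ?_⟩, ⟨4*o2, ?_⟩⟩, by norm_num, ?_, ?_⟩
  · have hN2 : N^2 ≠ 0 := pow_ne_zero _ hN0
    have : N^2 * kF 2 (2*t) (κ-s+2*t) (κ+s+2) = 0 := by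
      have h4 : (8*(o1*o2))^2 = 64*(o1^2*o2^2) := by ring
      rw [h3, h1, h2] at h4
      unfold kF
      linear_combination h4
    exact (mul_eq_zero.1 this).resolve_left hN2
  · unfold kQ; linear_combination -16*h1-16*(κ-s+2*t)*hN
  · unfold kQ; linear_combination -16*h2-16*t*(κ+s+2)*hN
  · rintro ⟨r, hr⟩
    exact hns ⟨r/2, by linear_combination (1/4)*hr⟩
  · rintro ⟨c0, d0⟩
    rw [c0] at h1
    rw [d0] at h2
    have h1' : o1 = 0 := by simpa using h1
    have h2' : o2 = 0 := by simpa using h2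
    rw [h1'] at ho1
    rw [h2'] at ho2
    apply h0
    constructor
    · apply mul_left_cancel₀ hN0
      rw [hN]; linear_combination (s^2-t+2*s-1)*ho1 + (s+2)*ho2
    · apply mul_left_cancel₀ hN0
      rw [hN]; linear_combination (t+1)*ho2 + t*(s+2)*ho1


lemma mem_pair_of {R : Type*} [CommRing R] (n d : R) (X : Ideal R) (h1 : n*n ∈ X) (h2 : n*d ∈ X)
    (h3 : d*d ∈ X) : (Ideal.span {n, d})^2 ≤ X := by
  rw [pow_two, Ideal.span_mul_span', Ideal.span_le]
  rintro z ⟨a, ha, b, hb, rfl⟩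
  simp only [Set.mem_insert_iff, Set.mem_singleton_iff] at ha hb
  rcases ha with rfl | rfl <;> rcases hb with rfl | rfl
  · exact h1
  · exact h2
  · simpa [mul_comm] using h2
  · exact h3

lemma mem_pair_of3 {R : Type*} [CommRing R] (n d : R) (X : Ideal R) (h1 : 4*n^3 ∈ X)
    (h2 : 4*(n^2*d) ∈ X) (h3 : 4*(n*d^2) ∈ X) (h4 : 4*d^3 ∈ X) :
    (Ideal.span {n, d})^3 * Ideal.span {4} ≤ X := by
  rw [pow_succ, pow_two, Ideal.span_mul_span', Ideal.span_mul_span', Ideal.span_mul_span',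
    Ideal.span_le]
  rintro z ⟨a', ⟨a, ⟨u, hu, v, hv, rfl⟩, b, hb, rfl⟩, c, hc, rfl⟩
  simp only [Set.mem_insert_iff, Set.mem_singleton_iff] at hu hv hb hc
  simp only [SetLike.mem_coe]
  subst hc
  rcases hu with rfl | rfl <;> rcases hv with rfl | rfl <;> rcases hb with rfl | rfl
  · convert h1 using 1; ring
  · convert h2 using 1; ring
  · convert h2 using 1; ring
  · convert h3 using 1; ring
  · convert h2 using 1; ring
  · convert h3 using 1; ring
  · convert h3 using 1; ring
  · convert h4 using 1; ring

lemma sq_of_cop {R : Type*} [CommRing R] [IsDedekindDomain R] {X Y Z : Ideal R}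
    (h : X ⊔ Y = ⊤) (h2 : X * Y = Z^2) : ∃ J, X = J^2 := by
  let _ : GCDMonoid (Ideal R) := UniqueFactorizationMonoid.toGCDMonoid _
  exact exists_eq_pow_of_mul_eq_pow_of_coprime (Ideal.isCoprime_iff_sup_eq.2 h) h2

lemma sq_dvd_sq' {R : Type*} [CommRing R] [IsDedekindDomain R] {X Y : Ideal R}
    (h : X^2 ∣ Y^2) : X ∣ Y := by
  exact (UniqueFactorizationMonoid.pow_dvd_pow_iff_dvd (by norm_num)).1 h

lemma dedA {R : Type*} [CommRing R] [IsDedekindDomain R] (n d w : R)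
    (hn : n ≠ 0) (hw : w ≠ 0)
    (h : w^2 = -(n*d*(n^2+d^2)*(n^2-2*n*d-d^2))) :
    ∃ I J G J1 : Ideal R, Ideal.span {n} * Ideal.span {d} = (I*J)^2 ∧
      Ideal.span {n^2+d^2} = I^2*(G*J1^2) ∧ G ∣ Ideal.span {4} := by
  obtain ⟨I, hI⟩ : ∃ I, I = Ideal.span {n, d} := ⟨_, rfl⟩
  have nI : n ∈ I := hI ▸ Ideal.subset_span (by simp)
  have dI : d ∈ I := hI ▸ Ideal.subset_span (by simp)
  have I0 : I ≠ 0 := by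
    rintro rfl
    exact hn (by simpa using nI)
  have nnI : n*n ∈ I^2 := by rw [pow_two]; exact Ideal.mul_mem_mul nI nI
  have ndI : n*d ∈ I^2 := by rw [pow_two]; exact Ideal.mul_mem_mul nI dI
  have ddI : d*d ∈ I^2 := by rw [pow_two]; exact Ideal.mul_mem_mul dI dI
  have m1 : n^2+d^2 ∈ I^2 := by
    have := add_mem nnI ddI; convert this using 1; ring
  have m2 : n^2-2*n*d-d^2 ∈ I^2 := by
    have := sub_mem (sub_mem nnI (Ideal.mul_mem_left _ 2 ndI)) ddI
    convert this using 1; ring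
  obtain ⟨N', hN'⟩ : I ∣ Ideal.span {n} := Ideal.dvd_span_singleton.2 nI
  obtain ⟨D', hD'⟩ : I ∣ Ideal.span {d} := Ideal.dvd_span_singleton.2 dI
  obtain ⟨M, hM⟩ : I^2 ∣ Ideal.span {n^2+d^2} := Ideal.dvd_span_singleton.2 m1
  obtain ⟨W, hW⟩ : I^2 ∣ Ideal.span {n^2-2*n*d-d^2} := Ideal.dvd_span_singleton.2 m2
  have I20 : I^2 ≠ 0 := pow_ne_zero _ I0
  have I30 : I^3 ≠ 0 := pow_ne_zero _ I0
  have top_of : ∀ X : Ideal R, n*n ∈ I^2*X → n*d ∈ I^2*X → d*d ∈ I^2*X → X = ⊤ := by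
    intro X h1 h2 h3
    have h4 := mem_pair_of n d _ h1 h2 h3
    rw [← hI] at h4
    have h5 : I^2 * X ∣ I^2 * 1 := by rw [mul_one]; exact Ideal.dvd_iff_le.2 h4
    have h6 := (mul_dvd_mul_iff_left I20).1 h5
    rw [← Ideal.one_eq_top]
    exact (Ideal.isUnit_iff.1 (isUnit_of_dvd_one h6)).trans Ideal.one_eq_top.symm
  have inN : ∀ z ∈ I, n * z ∈ I^2*N' := by
    intro z hz
    rw [pow_two, mul_assoc, ← hN', mul_comm n]
    exact Ideal.mul_mem_mul hz (Ideal.mem_span_singleton_self n)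
  have inD : ∀ z ∈ I, d * z ∈ I^2*D' := by
    intro z hz
    rw [pow_two, mul_assoc, ← hD', mul_comm d]
    exact Ideal.mul_mem_mul hz (Ideal.mem_span_singleton_self d)
  have inM : n^2+d^2 ∈ I^2*M := by rw [← hM]; exact Ideal.mem_span_singleton_self _
  have inW : n^2-2*n*d-d^2 ∈ I^2*W := by rw [← hW]; exact Ideal.mem_span_singleton_self _
  have le1 : ∀ X Y : Ideal R, I^2*X ≤ I^2*(X ⊔ Y) := fun X Y => Ideal.mul_mono_right le_sup_left
  have le2 : ∀ X Y : Ideal R, I^2*Y ≤ I^2*(X ⊔ Y) := fun X Y => Ideal.mul_mono_right le_sup_right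
  have NM : N' ⊔ M = ⊤ := by
    have a1 := le1 N' M (inN n nI)
    have a2 := le1 N' M (inN d dI)
    have a3 := le2 N' M inM
    refine top_of _ a1 a2 ?_
    have := sub_mem a3 a1
    convert this using 1; ring
  have NW : N' ⊔ W = ⊤ := by
    have a1 := le1 N' W (inN n nI)
    have a2 := le1 N' W (inN d dI)
    have a3 := le2 N' W inW
    refine top_of _ a1 a2 ?_
    have := sub_mem (sub_mem a1 (Ideal.mul_mem_left _ 2 a2)) a3
    convert this using 1; ring
  have DM : D' ⊔ M = ⊤ := by
    have a1 := le1 D' M (inD d dI)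
    have a2 := le1 D' M (inD n nI)
    have a3 := le2 D' M inM
    refine top_of _ ?_ (by rwa [mul_comm n]) a1
    have := sub_mem a3 a1
    convert this using 1; ring
  have DW : D' ⊔ W = ⊤ := by
    have a1 := le1 D' W (inD d dI)
    have a2 := le1 D' W (inD n nI)
    have a3 := le2 D' W inW
    refine top_of _ ?_ (by rwa [mul_comm n]) a1
    have := add_mem (add_mem a1 (Ideal.mul_mem_left _ 2 a2)) a3
    convert this using 1; ring
  -- the product is a square
  have hprod : I^6 * ((N'*D')*(M*W)) = (Ideal.span {w})^2 := by
    rw [Ideal.span_singleton_pow, h, Ideal.span_singleton_neg,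
      ← Ideal.span_singleton_mul_span_singleton, ← Ideal.span_singleton_mul_span_singleton,
      ← Ideal.span_singleton_mul_span_singleton, hN', hD', hM, hW]
    ring
  have hdv : I^3 ∣ Ideal.span {w} := by
    have : (I^3)^2 ∣ (Ideal.span {w})^2 := ⟨(N'*D')*(M*W), by rw [← hprod]; ring⟩
    exact sq_dvd_sq' this
  obtain ⟨V, hV⟩ := hdv
  have hV2 : (N'*D')*(M*W) = V^2 := by
    apply mul_left_cancel₀ (pow_ne_zero 6 I0)
    rw [hprod, hV]; ring
  have cop : (N'*D') ⊔ (M*W) = ⊤ := by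
    rw [← Ideal.isCoprime_iff_sup_eq] at *
    exact IsCoprime.mul_left (IsCoprime.mul_right NM NW) (IsCoprime.mul_right DM DW)
  obtain ⟨J, hJ⟩ := sq_of_cop cop hV2
  obtain ⟨J', hJ'⟩ := sq_of_cop (sup_comm (N'*D') (M*W) ▸ cop) (mul_comm (N'*D') (M*W) ▸ hV2)
  obtain ⟨G, hG⟩ : ∃ G, G = M ⊔ W := ⟨_, rfl⟩
  have hG4 : G ∣ Ideal.span {4} := by
    have : I^3*G ∣ I^3 * Ideal.span {4} := by
      rw [Ideal.dvd_iff_le, hI]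
      have hX : ∀ a ∈ I, ∀ b ∈ I, a*(n^2+d^2)+b*(n^2-2*n*d-d^2) ∈ Ideal.span {n, d}^3 * G := by
        intro a ha b hb
        rw [← hI, hG]
        have e : I^3*(M⊔W) = I*(I^2*(M⊔W)) := by ring
        rw [e]
        exact add_mem (Ideal.mul_mem_mul ha (le1 _ _ inM)) (Ideal.mul_mem_mul hb (le2 _ _ inW))
      have q : ∀ a b : R, a*n+b*d ∈ I := fun a b =>
        add_mem (Ideal.mul_mem_left _ _ nI) (Ideal.mul_mem_left _ _ dI)
      apply mem_pair_of3
      · convert hX _ (q 3 1) _ (q 1 1) using 1; ring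
      · convert hX _ (q 1 1) _ (q (-1) 1) using 1; ring
      · convert hX _ (q 1 (-1)) _ (q (-1) (-1)) using 1; ring
      · convert hX _ (q (-1) 3) _ (q 1 (-1)) using 1; ring
    exact (mul_dvd_mul_iff_left I30).1 this
  have hG0 : G ≠ 0 := by
    rintro hG0
    rw [hG0] at hG
    have hM0 : M = ⊥ := (sup_eq_bot_iff.1 hG.symm).1
    have : w^2 = 0 := by
      rw [h]
      rw [hM0] at hM
      have : n^2+d^2 = 0 := by simpa using hM
      rw [this]; ring
    exact hw (by simpa using this)
  obtain ⟨M1, hM1⟩ : G ∣ M := Ideal.dvd_iff_le.2 (hG ▸ le_sup_left)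
  obtain ⟨W1, hW1⟩ : G ∣ W := Ideal.dvd_iff_le.2 (hG ▸ le_sup_right)
  have cop1 : M1 ⊔ W1 = ⊤ := by
    have : G * (M1 ⊔ W1) = G * 1 := by
      rw [Ideal.mul_sup, ← hM1, ← hW1, ← hG, mul_one]
    rw [← Ideal.one_eq_top]
    exact mul_left_cancel₀ hG0 this
  have : G^2 * (M1*W1) = J'^2 := by rw [← hJ', hM1, hW1]; ring
  obtain ⟨V', hV'⟩ : G ∣ J' := sq_dvd_sq' ⟨_, this.symm⟩
  have h7 : M1*W1 = V'^2 := by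
    apply mul_left_cancel₀ (pow_ne_zero 2 hG0)
    rw [this, hV']; ring
  obtain ⟨J1, hJ1⟩ := sq_of_cop cop1 h7
  refine ⟨I, J, G, J1, ?_, ?_, hG4⟩
  · rw [hN', hD', mul_pow, ← hJ]; ring
  · rw [hM, hM1, hJ1]


lemma absNorm_span_cast {L : Type*} [Field L] [NumberField L] (z : NumberField.RingOfIntegers L) :
    ((Ideal.absNorm (Ideal.span {z}) : ℕ) : ℚ) = |Algebra.norm ℚ (z : L)| := by
  rw [Ideal.absNorm_span_singleton, ← Algebra.coe_norm_int, Nat.cast_natAbs, Int.cast_abs]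

lemma nfA {L : Type*} [Field L] [NumberField L] (x y : L) (hx : x ≠ 0) (hy : y ≠ 0)
    (h : y^2 = -x*(x^2+1)*(x^2-2*x-1)) :
    (∃ r : ℚ, |Algebra.norm ℚ x| = r^2) ∧
    (∃ r : ℚ, ∃ k : ℕ, |Algebra.norm ℚ (x^2+1)| = 2^k * r^2) := by
  obtain ⟨n, d, hd, hxy⟩ := IsFractionRing.div_surjective (A := NumberField.RingOfIntegers L) x
  have hd0 : d ≠ 0 := nonZeroDivisors.ne_zero hd
  have hdL : (d : L) ≠ 0 := by simpa using hd0
  have hxL : x * (d : L) = (n : L) := by rw [← hxy]; field_simp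
  have hn' : algebraMap (NumberField.RingOfIntegers L) L n
      = x * algebraMap (NumberField.RingOfIntegers L) L d := hxL.symm
  have hn : n ≠ 0 := by
    rintro rfl
    simp [hdL, hx] at hxL
  have hsq : ((d:L)^3*y)^2 =
      ((-(n*d*(n^2+d^2)*(n^2-2*n*d-d^2)) : NumberField.RingOfIntegers L) : L) := by
    change ((algebraMap (NumberField.RingOfIntegers L) L d)^3*y)^2 =
      algebraMap (NumberField.RingOfIntegers L) L (-(n*d*(n^2+d^2)*(n^2-2*n*d-d^2)))
    simp only [map_neg, map_mul, map_add, map_sub, map_pow, map_ofNat]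
    rw [hn', mul_pow, h]; ring
  obtain ⟨w, hw⟩ := IsIntegrallyClosed.exists_algebraMap_eq_of_isIntegral_pow
    (R := NumberField.RingOfIntegers L) (x := (d:L)^3*y) (n := 2) (by norm_num)
    (by rw [hsq]; exact isIntegral_algebraMap)
  have hw2 : w^2 = -(n*d*(n^2+d^2)*(n^2-2*n*d-d^2)) := by
    apply NumberField.RingOfIntegers.ext
    rw [← hsq, ← hw]; simp
  have hw0 : w ≠ 0 := by
    rintro rfl
    rw [map_zero] at hw
    exact mul_ne_zero (pow_ne_zero _ hdL) hy hw.symm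
  obtain ⟨I, J, G, J1, e1, e2, e3⟩ := dedA n d w hn hw0 hw2
  have e1' := congrArg (fun I => ((Ideal.absNorm I : ℕ) : ℚ)) e1
  have e2' := congrArg (fun I => ((Ideal.absNorm I : ℕ) : ℚ)) e2
  simp only [map_mul, map_pow, Nat.cast_mul, Nat.cast_pow] at e1' e2'
  rw [absNorm_span_cast, absNorm_span_cast] at e1'
  rw [absNorm_span_cast] at e2'
  have hN0 : Algebra.norm ℚ (d:L) ≠ 0 := by simpa using hdL
  have hnn : Algebra.norm ℚ (n:L) = Algebra.norm ℚ x * Algebra.norm ℚ (d:L) := by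
    rw [← hxL, map_mul]
  have hn2 : Algebra.norm ℚ ((n^2+d^2 : NumberField.RingOfIntegers L):L)
      = Algebra.norm ℚ (x^2+1) * (Algebra.norm ℚ (d:L))^2 := by
    rw [← map_pow, ← map_mul]; congr 1
    change algebraMap (NumberField.RingOfIntegers L) L (n^2+d^2) =
      (x^2+1)*(algebraMap (NumberField.RingOfIntegers L) L d)^2
    simp only [map_add, map_pow]
    rw [hn']; ring
  constructor
  · rw [hnn, abs_mul] at e1'
    refine ⟨(Ideal.absNorm I * Ideal.absNorm J) / |Algebra.norm ℚ (d:L)|, ?_⟩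
    have : |Algebra.norm ℚ (d:L)| ≠ 0 := abs_ne_zero.2 hN0
    field_simp
    linear_combination e1'
  · rw [hn2, abs_mul, abs_pow] at e2'
    have h4 : Ideal.absNorm G ∣ 2^(2*Module.finrank ℚ L) := by
      have := map_dvd Ideal.absNorm e3
      rw [Ideal.absNorm_span_singleton] at this
      have h5 : Algebra.norm ℤ (4 : NumberField.RingOfIntegers L) = 4^(Module.finrank ℚ L) := by
        have := Algebra.norm_algebraMap_of_basis (NumberField.RingOfIntegers.basis L) (4:ℤ)
        rw [NumberField.RingOfIntegers.rank L |>.symm, Module.finrank_eq_card_chooseBasisIndex]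
        simpa using this
      have e : ((4:ℤ)^(Module.finrank ℚ L)).natAbs = 2^(2*Module.finrank ℚ L) := by
        rw [Int.natAbs_pow, pow_mul]; norm_num
      rw [h5, e] at this
      exact this
    obtain ⟨k, -, hk⟩ := (Nat.dvd_prime_pow Nat.prime_two).1 h4
    refine ⟨(Ideal.absNorm I * Ideal.absNorm J1) / |Algebra.norm ℚ (d:L)|, k, ?_⟩
    have : |Algebra.norm ℚ (d:L)| ≠ 0 := abs_ne_zero.2 hN0
    rw [hk] at e2'
    push_cast at e2'
    field_simp
    linear_combination e2'

/-- normalized form of the second conclusion -/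
lemma two_pow_norm {z r : ℚ} {k : ℕ} (h : z = 2^k*r^2) : ∃ r, z = r^2 ∨ z = 2*r^2 := by
  rcases Nat.even_or_odd' k with ⟨j, rfl | rfl⟩
  · exact ⟨2^j*r, Or.inl (by rw [h]; ring)⟩
  · exact ⟨2^j*r, Or.inr (by rw [h]; ring)⟩

open QuadraticAlgebra in
lemma quadA {s t a b : ℚ} (hM : Mum s t a b) (hns : ¬ IsSquare (s^2-4*t))
    (h0 : ¬ (a = 0 ∧ b = 0)) :
    (∃ r : ℚ, |t| = r^2) ∧ ∃ r, ((t-1)^2+s^2 = r^2 ∨ (t-1)^2+s^2 = 2*r^2) := by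
  have hF : ∀ r : ℚ, r^2 ≠ -t + (-s)*r := by
    intro r hr
    exact hns ⟨2*r+s, by linear_combination (-4)*hr⟩
  have : Fact (∀ r : ℚ, r^2 ≠ -t + (-s)*r) := ⟨hF⟩
  let L := QuadraticAlgebra ℚ (-t) (-s)
  have hfin : FiniteDimensional ℚ L := inferInstance
  have : CharZero L := inferInstance
  have : NumberField L := ⟨⟩
  have hnorm : ∀ z : L, Algebra.norm ℚ z = QuadraticAlgebra.norm z := by
    intro z
    rw [← QuadraticAlgebra.det_toLinearMap_eq_norm, Algebra.norm_apply]
    rfl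
  have hx0 : (⟨0, 1⟩ : L) ≠ 0 := by
    intro h; have := congrArg QuadraticAlgebra.im h; simp at this
  have hy0 : (⟨b, a⟩ : L) ≠ 0 := by
    intro h
    have h1 := congrArg QuadraticAlgebra.im h
    have h2 := congrArg QuadraticAlgebra.re h
    exact h0 ⟨by simpa using h1, by simpa using h2⟩
  obtain ⟨m1, m2⟩ := hM
  obtain ⟨⟨r1, h1⟩, r2, k, h2⟩ := nfA (L := L) ⟨0, 1⟩ ⟨b, a⟩ hx0 hy0 (by
    apply QuadraticAlgebra.ext
    · simp [L, pow_two]; linear_combination m2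
    · simp [L, pow_two]; linear_combination m1)
  rw [hnorm] at h1 h2
  constructor
  · refine ⟨r1, ?_⟩
    rw [← h1, QuadraticAlgebra.norm_def]; simp
  · have : QuadraticAlgebra.norm ((⟨0,1⟩:L)^2+1) = (t-1)^2+s^2 := by
      rw [QuadraticAlgebra.norm_def, pow_two]; simp; ring
    rw [this, abs_of_nonneg (by positivity)] at h2
    exact two_pow_norm h2

lemma normQ (i : Algebra ℚ ℚ) (z : ℚ) : @Algebra.norm ℚ ℚ _ _ i z = z := by
  obtain rfl : i = Algebra.id ℚ := Subsingleton.elim _ _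
  rw [Algebra.norm_self]; rfl

lemma ratA {x y : ℚ} (hx : x ≠ 0) (hy : y ≠ 0) (h : y^2 = -x*(x^2+1)*(x^2-2*x-1)) :
    (∃ r : ℚ, |x| = r^2) ∧ ∃ r, (x^2+1 = r^2 ∨ x^2+1 = 2*r^2) := by
  obtain ⟨⟨r1, h1⟩, r2, k, h2⟩ := nfA (L := ℚ) x y hx hy h
  rw [normQ] at h1 h2
  rw [abs_of_nonneg (by positivity)] at h2
  exact ⟨⟨r1, h1⟩, two_pow_norm h2⟩


lemma congAux (m n q : ℤ) (hq : q ≠ 0) (hc : IsCoprime m n) (hpar : (m + n) % 2 = 1)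
    (h : q^2 = m*n*(m+n)*(m-n)) :
    ∃ P Q U V : ℤ, P ≠ 0 ∧ Q ≠ 0 ∧ P^2+Q^2 = U^2 ∧ P^2-Q^2 = V^2 ∧ P^2 < m^2+n^2 := by
  have hq2 : 0 < q^2 := by positivity
  have hm : m ≠ 0 := by rintro rfl; simp at h; exact hq h
  have hn : n ≠ 0 := by rintro rfl; simp at h; exact hq h
  have c1 : IsCoprime m (m+n) := by
    have := hc.add_mul_left_right 1; rwa [mul_one, add_comm] at this
  have c2 : IsCoprime m (m-n) := by
    have := (hc.neg_right).add_mul_left_right 1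
    have e : -n + m*1 = m - n := by ring
    rwa [e] at this
  have c3 : IsCoprime n (m+n) := by
    have := (hc.symm).add_mul_left_right 1; rwa [mul_one] at this
  have c4 : IsCoprime n (m-n) := by
    have := (hc.symm).add_mul_left_right (-1)
    have e : m + n * (-1) = m - n := by ring
    rwa [e] at this
  have c5 : IsCoprime (m+n) (m-n) := by
    have h2 : IsCoprime (m+n) 2 := ⟨1, -((m+n)/2), by omega⟩
    have := (h2.mul_right c1.symm).add_mul_left_right (-1)
    have e : 2*m + (m+n) * (-1) = m - n := by ring
    rwa [e] at this
  obtain ⟨a, ha⟩ := Int.sq_of_isCoprime (a := m) (b := n*(m+n)*(m-n)) (c := q)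
    ((hc.mul_right c1).mul_right c2) (by rw [h]; ring)
  obtain ⟨b, hb⟩ := Int.sq_of_isCoprime (a := n) (b := m*(m+n)*(m-n)) (c := q)
    ((hc.symm.mul_right c3).mul_right c4) (by rw [h]; ring)
  obtain ⟨c, hc'⟩ := Int.sq_of_isCoprime (a := m+n) (b := m*n*(m-n)) (c := q)
    ((c1.symm.mul_right c3.symm).mul_right c5) (by rw [h]; ring)
  obtain ⟨d, hd⟩ := Int.sq_of_isCoprime (a := m-n) (b := m*n*(m+n)) (c := q)
    ((c2.symm.mul_right c4.symm).mul_right c5.symm) (by rw [h]; ring)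
  have ha0 : a ≠ 0 := by rintro rfl; apply hm; simpa using ha
  have hb0 : b ≠ 0 := by rintro rfl; apply hn; simpa using hb
  have pa : 0 < a^2 := by positivity
  have pb : 0 < b^2 := by positivity
  have pc : 0 ≤ c^2 := by positivity
  have pd : 0 ≤ d^2 := by positivity
  have pp : 0 ≤ a^2*b^2*c^2*d^2 := by positivity
  have sa : a^2 < m^2+n^2 := by
    have : a^2 ≤ m^2 := by rcases ha with ha | ha <;> rw [ha] <;> nlinarith
    have : 0 < n^2 := by positivity
    omega
  have sb : b^2 < m^2+n^2 := by
    have : b^2 ≤ n^2 := by rcases hb with ha | ha <;> rw [ha] <;> nlinarith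
    have : 0 < m^2 := by positivity
    omega
  rcases ha with ha | ha <;> rcases hb with hb | hb <;> rcases hc' with hc' | hc' <;>
    rcases hd with hd | hd <;> rw [hc', hd, ha, hb] at h <;>
    first
    | (exfalso; linarith)
    | exact ⟨a, b, c, d, ha0, hb0, by linarith, by linarith, sa⟩
    | exact ⟨b, a, d, c, hb0, ha0, by linarith, by linarith, sb⟩

theorem cong (N : ℕ) : ∀ p q u v : ℤ, p.natAbs = N → p ≠ 0 → q ≠ 0 → p^2+q^2 = u^2 →
    p^2-q^2 = v^2 → False := by
  induction N using Nat.strong_induction_on with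
  | _ N ih =>
  intro p q u v hN hp hq h1 h2
  by_cases hc : IsCoprime p q
  · have hcg : Int.gcd p q = 1 := Int.isCoprime_iff_gcd_eq_one.1 hc
    have key : ∀ a : ℤ, a^2 % 4 = a % 2 := by
      intro a
      rcases Int.emod_two_eq_zero_or_one a with h | h
      · obtain ⟨k, rfl⟩ : ∃ k, a = 2*k := ⟨a/2, by omega⟩
        have : (2*k)^2 = 4*k^2 := by ring
        omega
      · obtain ⟨k, rfl⟩ : ∃ k, a = 2*k+1 := ⟨a/2, by omega⟩
        have : (2*k+1)^2 = 4*(k^2+k)+1 := by ring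
        omega
    have kp := key p
    have kq := key q
    have ku := key u
    have kv := key v
    have hpq : ¬ (p % 2 = 0 ∧ q % 2 = 0) := by
      rintro ⟨a, b⟩
      have := Int.dvd_gcd (Int.dvd_of_emod_eq_zero a) (Int.dvd_of_emod_eq_zero b)
      rw [hcg] at this
      norm_num at this
    have hq2 : q % 2 = 0 := by omega
    have hu2 : u % 2 = 1 := by omega
    have hv2 : v % 2 = 1 := by omega
    obtain ⟨a, ha⟩ : ∃ a, u + v = 2*a := ⟨(u+v)/2, by omega⟩
    obtain ⟨q1, hq1⟩ : ∃ a, q = 2*a := ⟨q/2, by omega⟩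
    have hu : u = 2*a - v := by linarith
    obtain ⟨b, hb⟩ : ∃ b, b = a - v := ⟨_, rfl⟩
    have hv : v = a - b := by linarith
    have hu' : u = a + b := by linarith
    subst hv hu'
    have ht : a^2+b^2 = p^2 := by linarith
    have hab : a*b = 2*q1^2 := by rw [hq1] at h1; nlinarith
    have hpy : PythagoreanTriple a b p := by unfold PythagoreanTriple; linarith
    have hgab : Int.gcd a b = 1 := by
      rw [← Int.isCoprime_iff_gcd_eq_one]
      rw [Int.isCoprime_iff_gcd_eq_one]
      by_contra hne
      obtain ⟨l, hl, hla⟩ := Nat.exists_prime_and_dvd hne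
      have hl' : Prime (l:ℤ) := Nat.prime_iff_prime_int.1 hl
      have d1 : (l:ℤ) ∣ a := (Int.natCast_dvd_natCast.2 hla).trans (Int.gcd_dvd_left ..)
      have d2 : (l:ℤ) ∣ b := (Int.natCast_dvd_natCast.2 hla).trans (Int.gcd_dvd_right ..)
      have d3 : (l:ℤ) ∣ p := by
        apply hl'.dvd_of_dvd_pow (n := 2)
        rw [← ht]
        exact dvd_add (dvd_pow d1 (by norm_num)) (dvd_pow d2 (by norm_num))
      have d4 : (l:ℤ) ∣ q := by
        apply hl'.dvd_of_dvd_pow (n := 2)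
        have : q^2 = a*(2*b) := by rw [hq1]; linarith
        rw [this]
        exact d1.mul_right _
      have := Int.dvd_gcd d3 d4
      rw [hcg] at this
      exact hl.one_lt.ne' (by simpa using this)
    obtain ⟨m, n, hmn, hpe, hg, hpar⟩ := (PythagoreanTriple.coprime_classification).1 ⟨hpy, hgab⟩
    have hq10 : q1 ≠ 0 := by rintro rfl; simp at hq1; exact hq hq1
    have hpr : q1^2 = m*n*(m+n)*(m-n) := by
      rcases hmn with ⟨x, y⟩ | ⟨x, y⟩ <;> rw [x, y] at hab <;> linarith
    obtain ⟨P, Q, U, V, hP, hQ, e1, e2, hlt⟩ := congAux m n q1 hq10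
      (Int.isCoprime_iff_gcd_eq_one.2 hg) (by omega) hpr
    refine ih P.natAbs ?_ P Q U V rfl hP hQ e1 e2
    have h5 : (P.natAbs : ℤ) ≤ P^2 := by
      rw [Int.natCast_natAbs, ← sq_abs]
      have : 0 < |P| := abs_pos.2 hP
      nlinarith
    have h6 : m^2+n^2 ≤ (p.natAbs : ℤ) := by
      rcases hpe with h | h
      · rw [h]; exact Int.le_natAbs
      · rw [h, Int.natAbs_neg]; exact Int.le_natAbs
    rw [← hN]
    exact Int.ofNat_lt.1 (lt_of_le_of_lt h5 (lt_of_lt_of_le hlt h6))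
  · rw [Int.isCoprime_iff_gcd_eq_one] at hc
    obtain ⟨l, hl, hla⟩ := Nat.exists_prime_and_dvd hc
    have hl0 : (l:ℤ) ≠ 0 := by exact_mod_cast hl.ne_zero
    obtain ⟨p', hp'⟩ : (l:ℤ) ∣ p := (Int.natCast_dvd_natCast.2 hla).trans (Int.gcd_dvd_left ..)
    obtain ⟨q', hq'⟩ : (l:ℤ) ∣ q := (Int.natCast_dvd_natCast.2 hla).trans (Int.gcd_dvd_right ..)
    obtain ⟨u', hu'⟩ : (l:ℤ) ∣ u := by
      rw [← Int.pow_dvd_pow_iff (n := 2) (by norm_num)]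
      exact ⟨p'^2+q'^2, by rw [← h1, hp', hq']; ring⟩
    obtain ⟨v', hv'⟩ : (l:ℤ) ∣ v := by
      rw [← Int.pow_dvd_pow_iff (n := 2) (by norm_num)]
      exact ⟨p'^2-q'^2, by rw [← h2, hp', hq']; ring⟩
    have hl2 : (l:ℤ)^2 ≠ 0 := pow_ne_zero _ hl0
    subst hp' hq' hu' hv'
    have hp0 : p' ≠ 0 := by rintro rfl; simp at hp
    refine ih p'.natAbs ?_ p' q' u' v' rfl hp0 (by rintro rfl; simp at hq)
      (mul_left_cancel₀ hl2 (by linear_combination h1)) (mul_left_cancel₀ hl2 (by linear_combination h2))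
    rw [← hN, Int.natAbs_mul, Int.natAbs_natCast]
    have := hl.two_le
    have : 0 < p'.natAbs := Int.natAbs_pos.2 hp0
    nlinarith

lemma congQ {a b c d : ℚ} (ha : a ≠ 0) (h1 : a^2+b^2 = c^2) (h2 : a^2-b^2 = d^2) : b = 0 := by
  by_contra hb
  obtain ⟨N, hN, A, B, C, D, rfl, rfl, rfl, rfl⟩ : ∃ N : ℤ, N ≠ 0 ∧ ∃ A B C D : ℤ,
      a = A/N ∧ b = B/N ∧ c = C/N ∧ d = D/N := by
    refine ⟨a.den*b.den*c.den*d.den, by positivity, a.num*b.den*c.den*d.den,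
      b.num*a.den*c.den*d.den, c.num*a.den*b.den*d.den, d.num*a.den*b.den*c.den, ?_, ?_, ?_, ?_⟩
    · nth_rw 1 [← Rat.num_div_den a]; push_cast; field_simp
    · nth_rw 1 [← Rat.num_div_den b]; push_cast; field_simp
    · nth_rw 1 [← Rat.num_div_den c]; push_cast; field_simp
    · nth_rw 1 [← Rat.num_div_den d]; push_cast; field_simp
  have hN' : (N:ℚ) ≠ 0 := by exact_mod_cast hN
  field_simp at h1 h2
  refine cong _ A B C D rfl ?_ ?_ (by exact_mod_cast h1) (by exact_mod_cast h2)
  · rintro rfl; simp at ha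
  · rintro rfl; simp at hb

lemma f42Q {r u : ℚ} (hr : r ≠ 0) (h : r^4+1 = u^2) : False := by
  have h1 := Rat.num_div_den r
  have h2 := Rat.num_div_den u
  have d1 : (r.den:ℚ) ≠ 0 := by exact_mod_cast r.den_ne_zero
  have d2 : (u.den:ℚ) ≠ 0 := by exact_mod_cast u.den_ne_zero
  rw [← h1, ← h2] at h
  field_simp at h
  have h3 : (r.num*u.den:ℤ)^4 + (r.den*u.den:ℤ)^4 = (u.num*u.den*r.den^2)^2 := by
    have : ((r.num*u.den)^4 + (r.den*u.den)^4:ℚ) = (u.num*u.den*r.den^2)^2 := by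
      linear_combination (u.den:ℚ)^2*h
    exact_mod_cast this
  exact not_fermat_42 (mul_ne_zero (by simpa using hr) (by simp))
    (mul_ne_zero (by simp) (by simp)) h3

theorem CQ {x y : ℚ} (h : y^2 = -x*(x^2+1)*(x^2-2*x-1)) : x = 0 ∨ x = 1 ∨ x = -1 := by
  by_cases hx : x = 0
  · exact Or.inl hx
  right
  by_cases hy : y = 0
  · exfalso
    rw [hy] at h
    have h3 : x^2-2*x-1 = 0 := by
      have h1 : x^2+1 ≠ 0 := by positivity
      have : x*(x^2+1)*(x^2-2*x-1) = 0 := by linarith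
      rcases mul_eq_zero.1 this with h | h
      · exact absurd h (mul_ne_zero hx h1)
      · exact h
    have := (sqrt2 (a := 1) (b := x-1) (by linarith)).1
    norm_num at this
  obtain ⟨⟨r, hr⟩, u, hu⟩ := ratA hx hy h
  have hr0 : r ≠ 0 := by rintro rfl; simp at hr; exact hx hr
  have hr4 : x^2 = r^4 := by rw [← sq_abs, hr]; ring
  rw [hr4] at hu
  rcases hu with hu | hu
  · exact (f42Q hr0 hu).elim
  · have := congQ (a := (r^2+1)/2) (b := (r^2-1)/2) (c := u) (d := r) (by positivity)
      (by linarith) (by ring)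
    have h1 : r^2 = 1 := by linarith
    rw [h1] at hr
    rcases abs_eq (by norm_num : (0:ℚ) ≤ 1) |>.1 hr with h | h <;> simp [h]

lemma exPre2 {A B C D : ℚ} (hF : kF A B C D = 0)
    (h1 : ∃ g : ℚ, g ≠ 0 ∧ (g^2 = A*B ∨ g^2 = C*D))
    (h2 : ∃ w : ℚ, w ≠ 0 ∧ (4*w^2 = 2*(A+B)^2-(C-D)^2 ∨ 4*w^2 = (C+D)^2-2*(A-B)^2)) :
    ∃ A' B' C' D' m : ℚ, m ≠ 0 ∧ PhiEq A' B' C' D' m A B C D ∧ kF A' B' C' D' = 0 := by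
  unfold kF at hF
  obtain ⟨g, h, hg, hh, hgh, hn⟩ : ∃ g h : ℚ, g^2 = A*B ∧ h^2 = C*D ∧
      4*(g*h) = C^2-D^2-2*B*C+2*A*D-2*A^2+2*B^2 ∧ h^2+2*g^2 ≠ 0 := by
    obtain ⟨g, g0, hg | hg⟩ := h1
    · obtain ⟨h, hh⟩ : ∃ h, h = (C^2-D^2-2*B*C+2*A*D-2*A^2+2*B^2)/(4*g) := ⟨_, rfl⟩
      have hgh : 4*(g*h) = C^2-D^2-2*B*C+2*A*D-2*A^2+2*B^2 := by rw [hh]; field_simp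
      refine ⟨g, h, hg, ?_, hgh, by positivity⟩
      have hg2 : 16*g^2 ≠ 0 := by positivity
      apply mul_left_cancel₀ hg2
      rw [← hgh] at hF
      linear_combination hF - 16*C*D*hg
    · obtain ⟨h, hh⟩ : ∃ h, h = (C^2-D^2-2*B*C+2*A*D-2*A^2+2*B^2)/(4*g) := ⟨_, rfl⟩
      have hgh : 4*(h*g) = C^2-D^2-2*B*C+2*A*D-2*A^2+2*B^2 := by rw [hh]; field_simp
      refine ⟨h, g, ?_, hg, hgh, by positivity⟩
      have hg2 : 16*g^2 ≠ 0 := by positivity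
      apply mul_left_cancel₀ hg2
      rw [← hgh] at hF
      linear_combination hF - 16*A*B*hg
  obtain ⟨w, w', hw, hw', hww⟩ : ∃ w w' : ℚ, 4*w^2 = 2*(A+B)^2-(C-D)^2 ∧
      4*w'^2 = (C+D)^2-2*(A-B)^2 ∧
      4*(w*w') = C^2-D^2+4*A*D-4*B*C-2*A^2+2*B^2 := by
    obtain ⟨g, g0, hg | hg⟩ := h2
    · obtain ⟨h, hh⟩ : ∃ h, h = (C^2-D^2+4*A*D-4*B*C-2*A^2+2*B^2)/(4*g) := ⟨_, rfl⟩
      have hgh : 4*(g*h) = C^2-D^2+4*A*D-4*B*C-2*A^2+2*B^2 := by rw [hh]; field_simp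
      refine ⟨g, h, hg, ?_, hgh⟩
      have hg2 : 4*g^2 ≠ 0 := by positivity
      apply mul_left_cancel₀ hg2
      have : (4*(g*h))^2 = (C^2-D^2+4*A*D-4*B*C-2*A^2+2*B^2)^2 := by rw [hgh]
      linear_combination this + 2 * hF - ((C+D)^2-2*(A-B)^2) * hg
    · obtain ⟨h, hh⟩ : ∃ h, h = (C^2-D^2+4*A*D-4*B*C-2*A^2+2*B^2)/(4*g) := ⟨_, rfl⟩
      have hgh : 4*(h*g) = C^2-D^2+4*A*D-4*B*C-2*A^2+2*B^2 := by rw [hh]; field_simp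
      refine ⟨h, g, ?_, hg, hgh⟩
      have hg2 : 4*g^2 ≠ 0 := by positivity
      apply mul_left_cancel₀ hg2
      have : (4*(h*g))^2 = (C^2-D^2+4*A*D-4*B*C-2*A^2+2*B^2)^2 := by rw [hgh]
      linear_combination this + 2 * hF - (2*(A+B)^2-(C-D)^2) * hg
  exact exPre hg hh hgh hw hw' hww hn

lemma classSel {A B C D : ℚ} (h : Good A B C D) :
    ∃ g w : ℚ, g ≠ 0 ∧ w ≠ 0 ∧ ((A*B = g^2 ∧ kQ A B C D = w^2) ∨ (A*B = g^2 ∧ kQ A B C D = 2*w^2) ∨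
      (A*B = -g^2 ∧ kQ A B C D = -w^2) ∨ (A*B = -g^2 ∧ kQ A B C D = -(2*w^2))) := by
  have hB := h.Bne
  have hQ := h.Qne
  obtain ⟨hF, hS, hA, hns, h0⟩ := h
  obtain ⟨a, b, hM, hab⟩ := mumOfK hF hS hA hQ
  obtain ⟨s, hs⟩ : ∃ s, s = -(C-D+A-B)/A := ⟨_, rfl⟩
  obtain ⟨t, ht⟩ : ∃ t, t = B/A := ⟨_, rfl⟩
  rw [← hs, ← ht] at hM
  have hab' : ¬ (a = 0 ∧ b = 0) := by
    rintro ⟨x, y⟩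
    obtain ⟨e1, e2⟩ := hab x y
    exact h0 ⟨by simpa [hA] using e1, by simpa [hB] using e2⟩
  have hdisc : ¬ IsSquare (s^2-4*t) := by
    rintro ⟨r, hr⟩
    refine hns ⟨A*r, ?_⟩
    have h1 : A*s = -(C-D+A-B) := by rw [hs]; field_simp
    have h2 : A*t = B := by rw [ht]; field_simp
    rw [← h2] at h1 ⊢
    linear_combination A^2*hr + (-(C-D+A-A*t)+A*s)*(-1)*h1
  have hQA : kQ A B C D = A^2*(2*(1+t)^2-(t-s-1)^2) := by
    rw [ht, hs]; unfold kQ; field_simp; ring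
  obtain ⟨⟨r, hr⟩, r', hr'⟩ := quadA hM hdisc hab'
  have ht0 : t ≠ 0 := by rw [ht]; exact div_ne_zero hB hA
  have hr0 : r ≠ 0 := by rintro rfl; simp at hr; exact ht0 hr
  obtain ⟨n, hn⟩ : ∃ n, n = b^2-a*b*s+a^2*t := ⟨_, rfl⟩
  have hn0 : n ≠ 0 := by
    intro h
    rw [hn] at h
    by_cases ha : a = 0
    · subst ha; simp at h; exact hab' ⟨rfl, h⟩
    · refine hdisc ⟨2*b/a-s, ?_⟩
      field_simp
      linear_combination (-4)*h
  have hn2 : n^2 = t*((t-1)^2+s^2)*(2*(1+t)^2-(t-s-1)^2) := by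
    obtain ⟨e1, e2⟩ := hM
    have : n^2 = (b^2-a^2*t)^2-s*(b^2-a^2*t)*(2*a*b-a^2*s)+t*(2*a*b-a^2*s)^2 := by
      rw [hn]; ring
    rw [this, e1, e2]; ring
  have hr'0 : r' ≠ 0 := by
    rintro rfl
    have : (t-1)^2+s^2 = 0 := by rcases hr' with h | h <;> simpa using h
    rw [this] at hn2
    simp at hn2; exact hn0 hn2
  have htB : A*B = A^2*t := by rw [ht]; field_simp
  refine ⟨A*r, ?_⟩
  obtain ⟨N, hN⟩ : ∃ N, N = 2*(1+t)^2-(t-s-1)^2 := ⟨_, rfl⟩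
  rw [hQA, htB, ← hN]
  rw [← hN] at hn2
  have hp : r^2*r'^2 ≠ 0 := by positivity
  rcases abs_choice t with ht' | ht' <;> rw [ht'] at hr
  · rcases hr' with hr' | hr' <;> rw [hr', hr] at hn2
    · refine ⟨A*n/(r*r'), mul_ne_zero hA hr0, by positivity, Or.inl ⟨by rw [hr]; ring, ?_⟩⟩
      field_simp; linear_combination -hn2
    · refine ⟨A*n/(2*r*r'), mul_ne_zero hA hr0, by positivity, Or.inr (Or.inl ⟨by rw [hr]; ring, ?_⟩)⟩
      field_simp; linear_combination -hn2
  · have hr2 : t = -r^2 := by linarith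
    rcases hr' with hr' | hr' <;> rw [hr', hr2] at hn2
    · refine ⟨A*n/(r*r'), mul_ne_zero hA hr0, by positivity, Or.inr (Or.inr (Or.inl ⟨by rw [hr2]; ring, ?_⟩))⟩
      field_simp; linear_combination hn2
    · refine ⟨A*n/(2*r*r'), mul_ne_zero hA hr0, by positivity, Or.inr (Or.inr (Or.inr ⟨by rw [hr2]; ring, ?_⟩))⟩
      field_simp; linear_combination hn2

def IsT {R : Type*} [CommRing R] (A B C D A0 B0 C0 D0 : R) : Prop :=
  (A0 = A ∧ B0 = B ∧ C0 = C ∧ D0 = D) ∨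
  (A0 = D ∧ B0 = C ∧ C0 = 2*B ∧ D0 = 2*A) ∨
  (A0 = -B ∧ B0 = A ∧ C0 = D ∧ D0 = -C) ∨
  (A0 = -C ∧ B0 = D ∧ C0 = 2*A ∧ D0 = -(2*B))

lemma stepQ {A B C D : ℚ} (h : Good A B C D) :
    ∃ A0 B0 C0 D0, IsT A B C D A0 B0 C0 D0 ∧
      (∃ A' B' C' D' m : ℚ, m ≠ 0 ∧ PhiEq A' B' C' D' m A0 B0 C0 D0 ∧ kF A' B' C' D' = 0) ∧
      IsSquare (2*A0*C0) ∧ IsSquare (2*B0*D0) ∧ (A0*C0 ≠ 0 ∨ B0*D0 ≠ 0) := by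
  obtain ⟨g, w, hg, hw, hc⟩ := classSel h
  have hB := h.Bne
  obtain ⟨hF, ⟨⟨p, hp⟩, ⟨q, hq⟩⟩, hA, hns, h0⟩ := h
  have h1 : C ≠ 0 ∨ D ≠ 0 := by
    by_contra hh
    push Not at hh
    exact h0 hh
  have hor : A*C ≠ 0 ∨ B*D ≠ 0 := by
    rcases h1 with h | h
    · exact Or.inl (mul_ne_zero hA h)
    · exact Or.inr (mul_ne_zero hB h)
  unfold kF at hF
  rcases hc with ⟨e1, e2⟩ | ⟨e1, e2⟩ | ⟨e1, e2⟩ | ⟨e1, e2⟩ <;> rw [e2] at hp hq <;> unfold kQ at e2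
  · refine ⟨A, B, C, D, Or.inl ⟨rfl, rfl, rfl, rfl⟩, exPre2 (by unfold kF; linear_combination hF)
      ⟨g, hg, Or.inl e1.symm⟩ ⟨w/2, by positivity, Or.inl (by linear_combination -e2)⟩,
      ⟨p/w, ?_⟩, ⟨q/w, ?_⟩, hor⟩
    · field_simp; linear_combination hp
    · field_simp; linear_combination hq
  · refine ⟨D, C, 2*B, 2*A, Or.inr (Or.inl ⟨rfl, rfl, rfl, rfl⟩),
      exPre2 (by unfold kF; linear_combination 4*hF)
      ⟨2*g, by positivity, Or.inr (by linear_combination -4*e1)⟩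
      ⟨w, hw, Or.inr (by linear_combination (-2)*e2)⟩,
      ⟨q/w, ?_⟩, ⟨p/w, ?_⟩, ?_⟩
    · field_simp; linear_combination hq
    · field_simp; linear_combination hp
    · rcases hor with h | h
      · exact Or.inr (fun h' => h (by linarith))
      · exact Or.inl (fun h' => h (by linarith))
  · refine ⟨-B, A, D, -C, Or.inr (Or.inr (Or.inl ⟨rfl, rfl, rfl, rfl⟩)),
      exPre2 (by unfold kF; linear_combination hF)
      ⟨g, by positivity, Or.inl (by linear_combination e1)⟩
      ⟨w/2, by positivity, Or.inr (by linear_combination e2)⟩,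
      ⟨q/w, ?_⟩, ⟨p/w, ?_⟩, ?_⟩
    · field_simp; linear_combination hq
    · field_simp; linear_combination hp
    · rcases hor with h | h
      · exact Or.inr (fun h' => h (by linarith))
      · exact Or.inl (fun h' => h (by linarith))
  · refine ⟨-C, D, 2*A, -(2*B), Or.inr (Or.inr (Or.inr ⟨rfl, rfl, rfl, rfl⟩)),
      exPre2 (by unfold kF; linear_combination 4*hF)
      ⟨2*g, by positivity, Or.inr (by linear_combination 4*e1)⟩
      ⟨w, hw, Or.inl (by linear_combination 2*e2)⟩,
      ⟨p/w, ?_⟩, ⟨q/w, ?_⟩, ?_⟩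
    · field_simp; linear_combination hp
    · field_simp; linear_combination hq
    · rcases hor with h | h
      · exact Or.inl (fun h' => h (by linarith))
      · exact Or.inr (fun h' => h (by linarith))

lemma fieldZero {F : Type*} [Field F] (h2 : (2:F) ≠ 0) {a b c d : F} (h1 : d*a = c*b)
    (h3 : d*b = -(c*a)) (h4 : d^2-c^2+2*a^2-2*b^2 = 0) (h5 : c*d = -(2*a*b)) :
    a = 0 ∧ b = 0 ∧ c = 0 ∧ d = 0 := by
  have e1 : b*(c^2+2*a^2) = 0 := by linear_combination -c*h1 + a*h5
  have e2 : a*(c^2-2*b^2) = 0 := by linear_combination c*h3 - b*h5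
  have e3 : a*(d^2+2*b^2) = 0 := by linear_combination d*h1 + b*h5
  have cd0 : a = 0 ∨ b = 0 → c*d = 0 := by
    rintro (h | h) <;> rw [h5, h] <;> ring
  have key : a = 0 ∨ b = 0 := by
    by_contra hh
    push Not at hh
    obtain ⟨ha, hb⟩ := hh
    have f1 := (mul_eq_zero.1 e1).resolve_left hb
    have f2 := (mul_eq_zero.1 e2).resolve_left ha
    have f3 := (mul_eq_zero.1 e3).resolve_left ha
    have : 2*2*2*a^2 = 0 := by linear_combination h4 + 3*f1 - 2*f2 - f3
    simp [h2, ha] at this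
  have key2 : a = 0 ∧ b = 0 := by
    by_contra hh
    have hcd : c = 0 ∧ d = 0 := by
      rcases key with h | h
      · have hb : b ≠ 0 := fun h' => hh ⟨h, h'⟩
        subst h
        refine ⟨?_, ?_⟩
        · simpa [hb] using h1.symm
        · simpa [hb] using h3
      · have hb : a ≠ 0 := fun h' => hh ⟨h', h⟩
        subst h
        refine ⟨?_, ?_⟩
        · simpa [hb] using h3.symm
        · simpa [hb] using h1
    obtain ⟨rfl, rfl⟩ := hcd
    rcases key with h | h
    · subst h
      have : 2*b^2 = 0 := by linear_combination -h4
      simp [h2] at this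
      exact hh ⟨rfl, this⟩
    · subst h
      have : 2*a^2 = 0 := by linear_combination h4
      simp [h2] at this
      exact hh ⟨this, rfl⟩
  obtain ⟨rfl, rfl⟩ := key2
  have := cd0 (Or.inl rfl)
  rcases mul_eq_zero.1 this with h | h <;> subst h <;> simp at h4 <;> simp [h4]

lemma mod4 : ∀ A B C D : ZMod 4, (C = 1 ∨ C = 3) → (D = 1 ∨ D = 3) →
    (D*D-C*C+2*A*A-2*B*B) - 2*(D*A-C*B) - 2*(D*B+C*A) = 0 →
    -(D*D-C*C+2*A*A-2*B*B) - (2*C*D+4*A*B) + 2*(2*(D*A-C*B)) ≠ 0 := by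
  decide

def Prim (A B C D : ℤ) : Prop := ∀ p : ℕ, p.Prime → (p:ℤ) ∣ A → (p:ℤ) ∣ B → (p:ℤ) ∣ C → (p:ℤ) ∣ D → False

lemma content {A B C D N : ℤ} (hp : Prim A B C D) (hC : C % 2 = 1) (hD : D % 2 = 1) (hN : N ≠ 0)
    (h1 : N ∣ pS0 A B C D - pR0 A B C D - pR1 A B C D)
    (h2 : N ∣ - pS0 A B C D + pR0 A B C D - pR1 A B C D)
    (h3 : N ∣ - pS0 A B C D - pS1 A B C D + 2 * pR0 A B C D)
    (h4 : N ∣ pS0 A B C D - pS1 A B C D - 2 * pR0 A B C D) : N^2 ≤ 4 := by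
  by_contra hlt
  have : 2 < N.natAbs := by
    by_contra hh
    apply hlt
    rw [← Int.natAbs_sq]
    have : N.natAbs ≤ 2 := by omega
    have : N.natAbs^2 ≤ 2^2 := Nat.pow_le_pow_left this 2
    exact_mod_cast this
  rcases Nat.four_dvd_or_exists_odd_prime_and_dvd_of_two_lt this with h | ⟨p, hpp, hpN, hpo⟩
  · have h4N : (4:ℤ) ∣ N := by
      have := Int.natCast_dvd.2 h
      simpa using this
    have k1 := (ZMod.intCast_zmod_eq_zero_iff_dvd _ 4).2 (h4N.trans h1)
    have k3 := (ZMod.intCast_zmod_eq_zero_iff_dvd _ 4).2 (h4N.trans h3)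
    have odd : ∀ z : ℤ, z % 2 = 1 → ((z : ZMod 4) = 1 ∨ (z : ZMod 4) = 3) := by
      intro z hz
      have : z % 4 = 1 ∨ z % 4 = 3 := by omega
      rcases this with h | h
      · left
        have := (ZMod.intCast_eq_intCast_iff z 1 4).2 h
        simpa using this
      · right
        have := (ZMod.intCast_eq_intCast_iff z 3 4).2 h
        simpa using this
    refine mod4 A B C D (odd C hC) (odd D hD) ?_ ?_
    · rw [← k1]; unfold pS0 pR0 pR1; push_cast; ring
    · rw [← k3]; unfold pS0 pS1 pR0; push_cast; ring
  · have hpN' : (p:ℤ) ∣ N := Int.natCast_dvd.2 hpN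
    have : Fact p.Prime := ⟨hpp⟩
    have k1 := (ZMod.intCast_zmod_eq_zero_iff_dvd _ p).2 (hpN'.trans h1)
    have k2 := (ZMod.intCast_zmod_eq_zero_iff_dvd _ p).2 (hpN'.trans h2)
    have k3 := (ZMod.intCast_zmod_eq_zero_iff_dvd _ p).2 (hpN'.trans h3)
    have k4 := (ZMod.intCast_zmod_eq_zero_iff_dvd _ p).2 (hpN'.trans h4)
    have two : (2 : ZMod p) ≠ 0 := by
      intro h
      have := (ZMod.natCast_eq_zero_iff 2 p).1 (by exact_mod_cast h)
      have := (Nat.prime_dvd_prime_iff_eq hpp Nat.prime_two).1 this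
      subst this
      revert hpo; decide
    have cancel : ∀ z : ZMod p, 4*z = 0 → z = 0 := by
      intro z hz
      have : 2*(2*z) = 0 := by linear_combination hz
      simpa [two] using this
    simp only [pS0, pS1, pR0, pR1] at k1 k2 k3 k4
    push_cast at k1 k2 k3 k4
    have cancel2 : ∀ z : ZMod p, 2*z = 0 → z = 0 := by
      intro z hz
      simpa [two] using hz
    obtain ⟨a, b, c, d⟩ := fieldZero two (a := (A:ZMod p)) (b := B) (c := C) (d := D)
      (by
        rw [← sub_eq_zero]; apply cancel
        linear_combination k1 - k2 - (k4 - k3))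
      (by
        rw [← sub_eq_zero]; apply cancel
        linear_combination - k1 - k2)
      (by
        apply cancel2
        linear_combination 2*(k1 - k2) - (k4 - k3))
      (by
        rw [← sub_eq_zero]; apply cancel
        linear_combination - k3 - k4)
    exact hp p hpp ((ZMod.intCast_zmod_eq_zero_iff_dvd _ p).1 a)
      ((ZMod.intCast_zmod_eq_zero_iff_dvd _ p).1 b) ((ZMod.intCast_zmod_eq_zero_iff_dvd _ p).1 c)
      ((ZMod.intCast_zmod_eq_zero_iff_dvd _ p).1 d)

lemma primInt (a b c d : ℚ) (h : ¬ (a = 0 ∧ b = 0 ∧ c = 0 ∧ d = 0)) :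
    ∃ l : ℚ, l ≠ 0 ∧ ∃ A B C D : ℤ, a = l*A ∧ b = l*B ∧ c = l*C ∧ d = l*D ∧ Prim A B C D := by
  obtain ⟨N, hN, A, B, C, D, rfl, rfl, rfl, rfl⟩ : ∃ N : ℤ, N ≠ 0 ∧ ∃ A B C D : ℤ,
      a = A/N ∧ b = B/N ∧ c = C/N ∧ d = D/N := by
    refine ⟨a.den*b.den*c.den*d.den, by positivity, a.num*b.den*c.den*d.den,
      b.num*a.den*c.den*d.den, c.num*a.den*b.den*d.den, d.num*a.den*b.den*c.den, ?_, ?_, ?_, ?_⟩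
    · nth_rw 1 [← Rat.num_div_den a]; push_cast; field_simp
    · nth_rw 1 [← Rat.num_div_den b]; push_cast; field_simp
    · nth_rw 1 [← Rat.num_div_den c]; push_cast; field_simp
    · nth_rw 1 [← Rat.num_div_den d]; push_cast; field_simp
  have hN' : (N:ℚ) ≠ 0 := by exact_mod_cast hN
  obtain ⟨g, hg⟩ : ∃ g : ℕ, g = Nat.gcd (Int.gcd A B) (Int.gcd C D) := ⟨_, rfl⟩
  have g1 : (g:ℤ) ∣ (Int.gcd A B : ℤ) := Int.natCast_dvd_natCast.2 (hg ▸ Nat.gcd_dvd_left _ _)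
  have g2 : (g:ℤ) ∣ (Int.gcd C D : ℤ) := Int.natCast_dvd_natCast.2 (hg ▸ Nat.gcd_dvd_right _ _)
  obtain ⟨A1, hA⟩ := g1.trans (Int.gcd_dvd_left A B)
  obtain ⟨B1, hB⟩ := g1.trans (Int.gcd_dvd_right A B)
  obtain ⟨C1, hC⟩ := g2.trans (Int.gcd_dvd_left C D)
  obtain ⟨D1, hD⟩ := g2.trans (Int.gcd_dvd_right C D)
  have g0 : g ≠ 0 := by
    rintro rfl
    apply h
    simp [hA, hB, hC, hD]
  have g0' : (g:ℚ) ≠ 0 := by exact_mod_cast g0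
  refine ⟨g/N, by positivity, A1, B1, C1, D1, by rw [hA]; push_cast; ring,
    by rw [hB]; push_cast; ring, by rw [hC]; push_cast; ring, by rw [hD]; push_cast; ring, ?_⟩
  intro p hp pA pB pC pD
  have e : ∀ z z1 : ℤ, z = g*z1 → (p:ℤ) ∣ z1 → ((g*p:ℕ):ℤ) ∣ z := by
    intro z z1 h1 h2
    rw [h1]; push_cast; exact mul_dvd_mul_left _ h2
  have i1 := Int.natCast_dvd_natCast.1 (Int.dvd_coe_gcd (e _ _ hA pA) (e _ _ hB pB))
  have i2 := Int.natCast_dvd_natCast.1 (Int.dvd_coe_gcd (e _ _ hC pC) (e _ _ hD pD))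
  have i3 := Nat.dvd_gcd i1 i2
  rw [← hg] at i3
  have := Nat.le_of_dvd (Nat.pos_of_ne_zero g0) i3
  have := hp.two_le
  nlinarith [Nat.pos_of_ne_zero g0]

def hT {R : Type*} [CommRing R] (A B C D : R) : R := C^2+D^2+2*A^2+2*B^2

lemma heightIneq {A B C D m A0 B0 C0 D0 : ℚ} (h : PhiEq A B C D m A0 B0 C0 D0) :
    (hT A B C D)^2 ≤ 3*m^2*hT A0 B0 C0 D0 := by
  obtain ⟨h1, h2, h3, h4⟩ := h
  have e : 3*m^2*hT A0 B0 C0 D0 = 3*((m*C0)^2+(m*D0)^2+2*(m*A0)^2+2*(m*B0)^2) := by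
    unfold hT; ring
  rw [e, ← h1, ← h2, ← h3, ← h4]
  have e2 : (hT A B C D)^2 + 8*(D*A+C*B)^2 =
      (pS0 A B C D)^2+(pS1 A B C D)^2+2*(pR0 A B C D)^2+2*(pR1 A B C D)^2 := by
    unfold hT pS0 pS1 pR0 pR1; ring
  nlinarith [sq_nonneg (D*A+C*B), sq_nonneg (pS1 A B C D), sq_nonneg (pR1 A B C D),
    sq_nonneg (pR0 A B C D), sq_nonneg (17*pS0 A B C D - 24*pR0 A B C D)]

lemma baseCase : ∀ A ∈ Finset.Icc (-3:ℤ) 3, ∀ B ∈ Finset.Icc (-3:ℤ) 3,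
    ∀ C ∈ ({-3,-1,1,3} : Finset ℤ), ∀ D ∈ ({-3,-1,1,3} : Finset ℤ), A ≠ 0 → B ≠ 0 →
    (C^2-D^2-2*B*C+2*A*D-2*A^2+2*B^2)^2 - 16*A*B*C*D ≠ 0 := by
  set_option maxRecDepth 100000 in
  decide

def Spec (A B C D : ℚ) : Prop :=
  (A = 0 ∧ B = 0) ∨ (A = B ∧ C = 0 ∧ D = 2*A) ∨ (A = B ∧ D = 0 ∧ C = 2*A)

lemma noSpec {A B C D A0 B0 C0 D0 : ℚ} (h : Good A B C D) (hT : IsT A B C D A0 B0 C0 D0) :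
    ¬ Spec A0 B0 C0 D0 := by
  have hB := h.Bne
  obtain ⟨-, -, hA, hns, h0⟩ := h
  rcases hT with ⟨rfl, rfl, rfl, rfl⟩ | ⟨rfl, rfl, rfl, rfl⟩ | ⟨rfl, rfl, rfl, rfl⟩ |
    ⟨rfl, rfl, rfl, rfl⟩
  · rintro (⟨h1, h2⟩ | ⟨h1, h2, h3⟩ | ⟨h1, h2, h3⟩)
    · exact hA h1
    · exact hns ⟨0, by rw [← h1, h2, h3]; ring⟩
    · exact hns ⟨0, by rw [← h1, h2, h3]; ring⟩
  · rintro (⟨h1, h2⟩ | ⟨h1, h2, h3⟩ | ⟨h1, h2, h3⟩)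
    · exact h0 ⟨h2, h1⟩
    · exact hB (by linarith)
    · exact hA (by linarith)
  · rintro (⟨h1, h2⟩ | ⟨h1, h2, h3⟩ | ⟨h1, h2, h3⟩)
    · exact hA h2
    · have e : C = 2*B := by linarith
      exact hns ⟨2*B, by rw [← h1, h2, e]; ring⟩
    · have e : C = 0 := by linarith
      exact hns ⟨2*B, by rw [← h1, h3, e]; ring⟩
  · rintro (⟨h1, h2⟩ | ⟨h1, h2, h3⟩ | ⟨h1, h2, h3⟩)
    · exact h0 ⟨by linarith, h2⟩
    · exact hA (by linarith)
    · exact hB (by linarith)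

lemma vGood {A B C D m A0 B0 C0 D0 : ℚ} (hm : m ≠ 0) (hphi : PhiEq A B C D m A0 B0 C0 D0)
    (hF : kF A B C D = 0) (hS : sSq A B C D) (hC : C ≠ 0) (hD : D ≠ 0) (hsp : ¬ Spec A0 B0 C0 D0) :
    Good A B C D := by
  by_contra hng
  apply hsp
  obtain ⟨h1, h2, h3, h4⟩ := hphi
  simp only [pS0, pS1, pR0, pR1] at h1 h2 h3 h4
  by_cases hA : A = 0
  · subst hA
    by_cases hB : B = 0
    · subst hB
      have e : C^2 = D^2 := by
        unfold kF at hF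
        have : (C^2-D^2)^2 = 0 := by linear_combination hF
        have := pow_eq_zero_iff (two_ne_zero) |>.1 this
        linarith
      left
      constructor
      · apply mul_left_cancel₀ hm; linear_combination -h1 - e
      · apply mul_left_cancel₀ hm; linear_combination -h2 + e
    · obtain ⟨E, hE⟩ : ∃ E, E = C-D-B := ⟨_, rfl⟩
      have hC' : C = E+D+B := by linarith
      subst hC'
      have e : E^2+B^2+2*E*D = 0 := by
        unfold kF at hF
        have : (E^2+B^2+2*E*D)^2 = 0 := by linear_combination hF
        exact pow_eq_zero_iff (two_ne_zero) |>.1 this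
      have hE0 : E ≠ 0 := by
        rintro rfl
        apply hB; simpa using e
      obtain ⟨-, ⟨r, hr⟩⟩ := hS
      have := CQ (x := B/E) (y := r/E^2) (by
        unfold kQ at hr
        field_simp
        linear_combination (-E)*hr + B*(B^2-2*B*E-E^2)*e)
      rcases this with h | h | h
      · simp [hB, hE0] at h
      · have hBE : B = E := by field_simp at h; exact h
        subst hBE
        have hDB : D = -B := by
          apply mul_left_cancel₀ hB; linear_combination (1/2)*e
        subst hDB
        right; left
        refine ⟨?_, ?_, ?_⟩ <;> apply mul_left_cancel₀ hm
        · linear_combination h2 - h1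
        · linear_combination - h3
        · linear_combination 2*h1 - h4
      · have hBE : E = -B := by field_simp at h; linarith
        subst hBE
        have hDB : D = B := by
          apply mul_left_cancel₀ hB; linear_combination (-1/2)*e
        subst hDB
        right; right
        refine ⟨?_, ?_, ?_⟩ <;> apply mul_left_cancel₀ hm
        · linear_combination h2 - h1
        · linear_combination - h4
        · linear_combination 2*h1 - h3
  · have hQ : kQ A B C D ≠ 0 := by
      intro hQ
      unfold kQ at hQ
      obtain ⟨h1, h2⟩ := sqrt2 (a := A+B) (b := C-D) (by linarith)
      have hB : B = -A := by linarith
      have hD : D = C := by linarith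
      unfold kF at hF
      subst hB hD
      have h3 : A^2*D^2 = 0 := by linarith
      have h4 : D = 0 := by simpa [hA] using h3
      exact hC h4
    obtain ⟨a, b, ⟨m1, m2⟩, -⟩ := mumOfK hF hS hA hQ
    have hsq : IsSquare ((C-D+A-B)^2-4*A*B) := by
      by_contra hns
      exact hng ⟨hF, hS, hA, hns, fun h => hC h.1⟩
    obtain ⟨r, hr⟩ := hsq
    obtain ⟨s, hs⟩ : ∃ s, s = -(C-D+A-B)/A := ⟨_, rfl⟩
    obtain ⟨t, ht⟩ : ∃ t, t = B/A := ⟨_, rfl⟩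
    rw [← hs, ← ht] at m1 m2
    have root : ∀ x, x^2+s*x+t = 0 → x = 0 ∨ x = 1 ∨ x = -1 := by
      intro x hx
      apply CQ (y := a*x+b)
      linear_combination m2 + x*m1 + (a^2+x^3-s*x^2-2*x^2+(s^2-t)*x+2*s*x + (2*s*t - s^3 -2*s^2+2*t-2))*hx
    obtain ⟨x1, hx1⟩ : ∃ x1, x1 = ((C-D+A-B)+r)/(2*A) := ⟨_, rfl⟩
    obtain ⟨x2, hx2⟩ : ∃ x2, x2 = ((C-D+A-B)-r)/(2*A) := ⟨_, rfl⟩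
    have hsum : A*(x1+x2) = C-D+A-B := by rw [hx1, hx2]; field_simp; ring
    have hprod : A*(x1*x2) = B := by
      rw [hx1, hx2]; field_simp; linear_combination hr
    have r1 := root x1 (by
      apply mul_left_cancel₀ hA
      have e1 : A*s = -(C-D+A-B) := by rw [hs]; field_simp
      have e2 : A*t = B := by rw [ht]; field_simp
      linear_combination x1*e1 + e2 - hprod + x1*hsum)
    have r2 := root x2 (by
      apply mul_left_cancel₀ hA
      have e1 : A*s = -(C-D+A-B) := by rw [hs]; field_simp
      have e2 : A*t = B := by rw [ht]; field_simp
      linear_combination x2*e1 + e2 - hprod + x2*hsum)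
    clear hx1 hx2 root m1 m2 hs ht hr hS hQ
    have c01 : x1*x2 = 0 → x1+x2 = 1 → Spec A0 B0 C0 D0 := by
      intro k1 k2
      rw [k1] at hprod
      rw [k2] at hsum
      have hB : B = 0 := by linarith
      have hCD : C = D := by linarith
      subst hB hCD
      unfold kF at hF
      have hh : (2*A)^2*(C-A)^2 = 0 := by linear_combination hF
      have hCA : C = A := by
        have := (mul_eq_zero.1 hh).resolve_left (by positivity)
        have := pow_eq_zero_iff (two_ne_zero) |>.1 this
        linarith
      subst hCA
      right; left
      refine ⟨?_, ?_, ?_⟩ <;> apply mul_left_cancel₀ hm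
      · linear_combination h2 - h1
      · linear_combination - h3
      · linear_combination 2*h1 - h4
    have c0m : x1*x2 = 0 → x1+x2 = -1 → Spec A0 B0 C0 D0 := by
      intro k1 k2
      rw [k1] at hprod
      rw [k2] at hsum
      have hB : B = 0 := by linarith
      have hCD : D = C+2*A := by linarith
      subst hB hCD
      unfold kF at hF
      have hh : (2*A)^2*(C+A)^2 = 0 := by linear_combination hF
      have hCA : C = -A := by
        have := (mul_eq_zero.1 hh).resolve_left (by positivity)
        have := pow_eq_zero_iff (two_ne_zero) |>.1 this
        linarith
      subst hCA
      right; right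
      refine ⟨?_, ?_, ?_⟩ <;> apply mul_left_cancel₀ hm
      · linear_combination h2 - h1
      · linear_combination - h4
      · linear_combination 2*h1 - h3
    have cpm : x1*x2 = -1 → x1+x2 = 0 → False := by
      intro k1 k2
      rw [k1] at hprod
      rw [k2] at hsum
      have hB : B = -A := by linarith
      have hCD : D = C+2*A := by linarith
      unfold kF at hF
      subst hB
      have : A^2*(C*D) = 0 := by
        rw [hCD] at hF ⊢; linear_combination (1/16)*hF
      simp [hA, hC, hD] at this
    rcases r1 with k1 | k1 | k1 <;> rcases r2 with k2 | k2 | k2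
    · exfalso
      rw [k1, k2] at hprod hsum
      have hB : B = 0 := by linarith
      have hCD : C = D-A := by linarith
      subst hB hCD
      unfold kF at hF
      have : A^4 = 0 := by linear_combination hF
      simp [hA] at this
    · exact c01 (by rw [k1, k2]; ring) (by rw [k1, k2]; ring)
    · exact c0m (by rw [k1, k2]; ring) (by rw [k1, k2]; ring)
    · exact c01 (by rw [k1, k2]; ring) (by rw [k1, k2]; ring)
    · exfalso
      rw [k1, k2] at hprod hsum
      have hB : B = A := by linarith
      have hCD : C = D+2*A := by linarith
      subst hB
      rw [hCD] at hF
      unfold kF at hF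
      have : B^3*D = 0 := by linear_combination (-1/32)*hF
      simp [hA, hD] at this
    · exact (cpm (by rw [k1, k2]; ring) (by rw [k1, k2]; ring)).elim
    · exact c0m (by rw [k1, k2]; ring) (by rw [k1, k2]; ring)
    · exact (cpm (by rw [k1, k2]; ring) (by rw [k1, k2]; ring)).elim
    · exfalso
      rw [k1, k2] at hprod hsum
      have hB : B = A := by linarith
      have hCD : D = C+2*A := by linarith
      subst hB
      rw [hCD] at hF
      unfold kF at hF
      have : B^3*C = 0 := by linear_combination (-1/32)*hF
      simp [hA, hC] at this

/-- integral, normalised preimage -/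
lemma normPre {A' B' C' D' m : ℚ} {A0 B0 C0 D0 : ℤ} (hm : m ≠ 0)
    (hphi : PhiEq A' B' C' D' m (A0:ℚ) B0 C0 D0) (hF : kF A' B' C' D' = 0)
    (h0 : A0*C0 ≠ 0 ∨ B0*D0 ≠ 0) :
    ∃ (A B C D : ℤ) (m : ℚ), m ≠ 0 ∧ PhiEq (A:ℚ) B C D m (A0:ℚ) B0 C0 D0 ∧
      kF (A:ℚ) B C D = 0 ∧ Prim A B C D ∧ C % 2 = 1 ∧ D % 2 = 1 := by
  have hv : ¬ (A' = 0 ∧ B' = 0 ∧ C' = 0 ∧ D' = 0) := by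
    rintro ⟨rfl, rfl, rfl, rfl⟩
    obtain ⟨h1, h2, h3, h4⟩ := hphi
    simp [pS0, pS1, pR0, pR1, hm] at h1 h2
    simp [h1, h2] at h0
  obtain ⟨l, hl, A, B, C, D, rfl, rfl, rfl, rfl, hP⟩ := primInt A' B' C' D' hv
  have hl2 : l^2 ≠ 0 := pow_ne_zero _ hl
  have hl4 : l^4 ≠ 0 := pow_ne_zero _ hl
  have hphi2 : PhiEq (A:ℚ) B C D (m/l^2) (A0:ℚ) B0 C0 D0 := by
    obtain ⟨h1, h2, h3, h4⟩ := hphi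
    unfold PhiEq
    simp only [pS0, pS1, pR0, pR1] at h1 h2 h3 h4 ⊢
    refine ⟨?_, ?_, ?_, ?_⟩
    · field_simp; linear_combination h1
    · field_simp; linear_combination h2
    · field_simp; linear_combination h3
    · field_simp; linear_combination h4
  have hF2 : kF (A:ℚ) B C D = 0 := by
    apply mul_left_cancel₀ hl4
    unfold kF at hF ⊢
    linear_combination hF
  clear hphi hF hv
  have parity : ∀ a b c d : ℤ, kF (a:ℚ) b c d = 0 → c % 2 = d % 2 := by
    intro a b c d h
    unfold kF at h
    have h' : (c^2-d^2-2*b*c+2*a*d-2*a^2+2*b^2)^2 = 2*(8*a*b*c*d) := by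
      have : ((c^2-d^2-2*b*c+2*a*d-2*a^2+2*b^2)^2 : ℚ) = 2*(8*a*b*c*d) := by linarith
      exact_mod_cast this
    have e1 : (2:ℤ) ∣ c^2-d^2-2*b*c+2*a*d-2*a^2+2*b^2 :=
      Int.prime_two.dvd_of_dvd_pow (Dvd.intro _ h'.symm)
    have e2 : (2:ℤ) ∣ (c-d)^2 := by
      have : (c-d)^2 = (c^2-d^2-2*b*c+2*a*d-2*a^2+2*b^2) + 2*(b*c-a*d+a^2-b^2+d^2-c*d) := by ring
      rw [this]
      exact dvd_add e1 (Dvd.intro _ rfl)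
    have e3 : (2:ℤ) ∣ c - d := Int.prime_two.dvd_of_dvd_pow e2
    omega
  have p1 := parity _ _ _ _ hF2
  by_cases hC : C % 2 = 1
  · exact ⟨A, B, C, D, m/l^2, div_ne_zero hm hl2, hphi2, hF2, hP, hC, by omega⟩
  · obtain ⟨C1, hC1⟩ : ∃ z, C = 2*z := ⟨C/2, by omega⟩
    obtain ⟨D1, hD1⟩ : ∃ z, D = 2*z := ⟨D/2, by omega⟩
    subst hC1 hD1
    push_cast at hF2 hphi2
    have hF3 : kF (D1:ℚ) C1 B A = 0 := by
      unfold kF at hF2 ⊢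
      linear_combination (1/4)*hF2
    have hP3 : Prim D1 C1 B A := by
      intro p hp x y z w
      exact hP p hp w z (y.mul_left _) (x.mul_left _)
    have p2 := parity _ _ _ _ hF3
    have hB : B % 2 = 1 := by
      by_contra hB
      exact hP 2 Nat.prime_two (by push_cast; omega) (by push_cast; omega) ⟨C1, by push_cast; rfl⟩
        ⟨D1, by push_cast; rfl⟩
    refine ⟨D1, C1, B, A, m/l^2/2, by positivity, ?_, hF3, hP3, hB, by omega⟩
    obtain ⟨h1, h2, h3, h4⟩ := hphi2
    unfold PhiEq
    simp only [pS0, pS1, pR0, pR1] at h1 h2 h3 h4 ⊢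
    refine ⟨?_, ?_, ?_, ?_⟩
    · linear_combination (1/2)*h1
    · linear_combination (1/2)*h2
    · linear_combination (1/2)*h3
    · linear_combination (1/2)*h4

lemma num_dvd {m : ℚ} {z k : ℤ} (h : (z:ℚ) = m*k) : m.num ∣ z := by
  have h1 := Rat.num_div_den m
  have hd : (m.den:ℚ) ≠ 0 := by exact_mod_cast m.den_ne_zero
  rw [← h1] at h
  have h2 : z*m.den = m.num*k := by
    have : (z*m.den:ℚ) = m.num*k := by rw [h]; field_simp
    exact_mod_cast this
  have hc : IsCoprime m.num (m.den:ℤ) := by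
    rw [Int.isCoprime_iff_gcd_eq_one]
    have := m.reduced
    simpa [Int.gcd, Nat.Coprime] using this
  exact hc.dvd_of_dvd_mul_right ⟨k, h2⟩

lemma stepZ {A B C D : ℤ} (h : Good (A:ℚ) B C D) :
    ∃ A' B' C' D' : ℤ, Good (A':ℚ) B' C' D' ∧ C' % 2 = 1 ∧ D' % 2 = 1 ∧
      (hT A' B' C' D')^2 ≤ 24 * hT A B C D := by
  obtain ⟨a0, b0, c0, d0, hTT, ⟨A', B', C', D', m, hm, hphi, hF⟩, s1, s2, hne⟩ := stepQ h
  have hsp := noSpec h hTT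
  obtain ⟨A0, B0, C0, D0, rfl, rfl, rfl, rfl, hle⟩ : ∃ A0 B0 C0 D0 : ℤ, a0 = A0 ∧ b0 = B0 ∧
      c0 = C0 ∧ d0 = D0 ∧ hT A0 B0 C0 D0 ≤ 2 * hT A B C D := by
    have p1 := sq_nonneg A
    have p2 := sq_nonneg B
    have p3 := sq_nonneg C
    have p4 := sq_nonneg D
    rcases hTT with ⟨rfl, rfl, rfl, rfl⟩ | ⟨rfl, rfl, rfl, rfl⟩ | ⟨rfl, rfl, rfl, rfl⟩ |
      ⟨rfl, rfl, rfl, rfl⟩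
    · exact ⟨A, B, C, D, rfl, rfl, rfl, rfl, by unfold hT; nlinarith⟩
    · exact ⟨D, C, 2*B, 2*A, rfl, rfl, by push_cast; rfl, by push_cast; rfl, by unfold hT; nlinarith⟩
    · exact ⟨-B, A, D, -C, by push_cast; rfl, rfl, rfl, by push_cast; rfl, by unfold hT; nlinarith⟩
    · exact ⟨-C, D, 2*A, -(2*B), by push_cast; rfl, rfl, by push_cast; rfl, by push_cast; rfl,
        by unfold hT; nlinarith⟩
  have hne' : A0*C0 ≠ 0 ∨ B0*D0 ≠ 0 := by exact_mod_cast hne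
  obtain ⟨X, Y, Z, W, n, hn, hphi', hF', hP, hZ, hW⟩ := normPre hm hphi hF hne'
  have hss : sSq (X:ℚ) Y Z W := transfer hn hphi' hF' s1 s2 hne
  have hG := vGood hn hphi' hF' hss (by norm_cast; omega) (by norm_cast; omega) hsp
  refine ⟨X, Y, Z, W, hG, hZ, hW, ?_⟩
  have hi := heightIneq hphi'
  have hn2 : n^2 ≤ 4 := by
    obtain ⟨h1, h2, h3, h4⟩ := hphi'
    simp only [pS0, pS1, pR0, pR1] at h1 h2 h3 h4
    have hc := content (N := n.num) hP hZ hW (by simpa using hn)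
      (num_dvd (k := A0) (by simp only [pS0, pS1, pR0, pR1]; push_cast; exact h1))
      (num_dvd (k := B0) (by simp only [pS0, pS1, pR0, pR1]; push_cast; exact h2))
      (num_dvd (k := C0) (by simp only [pS0, pS1, pR0, pR1]; push_cast; exact h3))
      (num_dvd (k := D0) (by simp only [pS0, pS1, pR0, pR1]; push_cast; exact h4))
    have hd : (1:ℚ) ≤ n.den := by exact_mod_cast n.den_pos
    rw [← Rat.num_div_den n, div_pow, div_le_iff₀ (by positivity)]
    have : ((n.num:ℚ))^2 ≤ 4 := by exact_mod_cast hc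
    nlinarith
  have hpos : (0:ℚ) ≤ hT (A0:ℚ) B0 C0 D0 := by unfold hT; positivity
  have hi2 : (hT (X:ℚ) Y Z W)^2 ≤ 12 * hT (A0:ℚ) B0 C0 D0 := by nlinarith
  have hi3 : (hT X Y Z W)^2 ≤ 12 * hT A0 B0 C0 D0 := by
    unfold hT at hi2 ⊢
    exact_mod_cast hi2
  linarith

lemma noGoodOdd (N : ℕ) : ∀ A B C D : ℤ, Good (A:ℚ) B C D → C % 2 = 1 → D % 2 = 1 →
    (hT A B C D) = N → False := by
  induction N using Nat.strong_induction_on with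
  | _ N ih =>
  intro A B C D h hC hD hN
  by_cases hs : hT A B C D ≤ 24
  · have hA : A ≠ 0 := by have := h.2.2.1; exact_mod_cast this
    have hB : B ≠ 0 := by have := h.Bne; exact_mod_cast this
    have hF : kF A B C D = 0 := by
      have := h.1
      unfold kF at this ⊢
      exact_mod_cast this
    unfold hT at hs
    have p1 := sq_nonneg A
    have p2 := sq_nonneg B
    have p3 := sq_nonneg C
    have p4 := sq_nonneg D
    have bA : -4 < A ∧ A < 4 := abs_lt.1 (abs_lt_of_sq_lt_sq (by linarith) (by norm_num))
    have bB : -4 < B ∧ B < 4 := abs_lt.1 (abs_lt_of_sq_lt_sq (by linarith) (by norm_num))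
    have bC : -5 < C ∧ C < 5 := abs_lt.1 (abs_lt_of_sq_lt_sq (by linarith) (by norm_num))
    have bD : -5 < D ∧ D < 5 := abs_lt.1 (abs_lt_of_sq_lt_sq (by linarith) (by norm_num))
    refine baseCase A (Finset.mem_Icc.2 (by omega)) B (Finset.mem_Icc.2 (by omega)) C ?_ D ?_ hA hB hF
    · simp only [Finset.mem_insert, Finset.mem_singleton]; clear p1 p2 p3 p4 hs hN; omega
    · simp only [Finset.mem_insert, Finset.mem_singleton]; clear p1 p2 p3 p4 hs hN; omega
  · obtain ⟨A', B', C', D', hG, hC', hD', hle⟩ := stepZ h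
    have hnn : 0 ≤ hT A' B' C' D' := by unfold hT; positivity
    refine ih (hT A' B' C' D').toNat ?_ A' B' C' D' hG hC' hD' (Int.toNat_of_nonneg hnn).symm
    have : hT A' B' C' D' < hT A B C D := by
      by_contra hh
      push Not at hh hs
      nlinarith
    omega

theorem noGood {A B C D : ℚ} (h : Good A B C D) : False := by
  obtain ⟨l, hl, X, Y, Z, W, rfl, rfl, rfl, rfl, -⟩ := primInt A B C D (fun h' => h.2.2.1 h'.1)
  have hG : Good (X:ℚ) Y Z W := by
    obtain ⟨hF, ⟨⟨p, hp⟩, ⟨q, hq⟩⟩, hA, hns, h0⟩ := h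
    have hl4 : l^4 ≠ 0 := pow_ne_zero _ hl
    refine ⟨?_, ⟨⟨p/l^2, ?_⟩, ⟨q/l^2, ?_⟩⟩, fun h' => hA (by rw [h']; ring), ?_, ?_⟩
    · apply mul_left_cancel₀ hl4
      unfold kF at hF ⊢
      linear_combination hF
    · unfold kQ at hp ⊢; field_simp; linear_combination hp
    · unfold kQ at hq ⊢; field_simp; linear_combination hq
    · rintro ⟨r, hr⟩
      exact hns ⟨l*r, by linear_combination l^2*hr⟩
    · rintro ⟨z, w⟩
      exact h0 (by rw [z, w]; simp)
  obtain ⟨A', B', C', D', hG', hC', hD', -⟩ := stepZ hG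
  have hnn : 0 ≤ hT A' B' C' D' := by unfold hT; positivity
  exact noGoodOdd _ A' B' C' D' hG' hC' hD' (Int.toNat_of_nonneg hnn).symm

theorem core {s t a b : ℚ} (h : Mum s t a b) (hns : ¬ IsSquare (s^2-4*t)) : a = 0 ∧ b = 0 := by
  by_contra h0
  obtain ⟨A, B, C, D, hG⟩ := goodOf h hns h0
  exact noGood hG

lemma dyn {F : Type*} [Field F] [CharZero F] {c p0 p1 p2 p3 : F} (e1 : p1 = p0^2+c)
    (e2 : p2 = p1^2+c) (e3 : p3 = p2^2+c) (e0 : p0 = p3^2+c) (hne : p0 ≠ p2) :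
    ∃ x y : F, x ≠ 0 ∧ x ≠ 1 ∧ x ≠ -1 ∧ y^2 = -x*(x^2+1)*(x^2-2*x-1) ∧ y ≠ 0 ∧
      c = (x^2-4*x-1)*(x^4+x^3+2*x^2-x+1)/(4*x*(x-1)^2*(x+1)^2) := by
  obtain ⟨g, hg⟩ : ∃ g, g = p0+p2 := ⟨_, rfl⟩
  obtain ⟨h, hh⟩ : ∃ h, h = p0-p2 := ⟨_, rfl⟩
  have h0 : h ≠ 0 := by rw [hh]; exact sub_ne_zero.2 hne
  have d1 : p1-p3 = g*h := by rw [hg, hh]; linear_combination e1 - e3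
  have d2 : g*(p1+p3) = -1 := by
    apply mul_left_cancel₀ h0
    have : p2 - p0 = (p1-p3)*(p1+p3) := by linear_combination e2 - e0
    rw [d1] at this
    linear_combination -this + hh
  have g0 : g ≠ 0 := by
    rintro rfl
    simp at d2
  have d3 : 2*(p1+p3) = g^2+h^2+4*c := by rw [hg, hh]; linear_combination 2*e1+2*e3
  have d4 : 2*g = (p1+p3)^2 + g^2*h^2 + 4*c := by
    rw [← mul_pow, ← d1]
    linear_combination 2*hg + 2*e2 + 2*e0
  have d5 : h^2*(g^2*(g^2-1)) = g^4+2*g^3+2*g-1 := by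
    linear_combination (-g^2)*d4 + g^2*d3 - (2*g)*d2 - (g*(p1+p3) - 1)*d2
  have g1 : g - 1 ≠ 0 := by
    intro hh
    have : g = 1 := by linear_combination hh
    rw [this] at d5
    norm_num at d5
  have gm : g + 1 ≠ 0 := by
    intro hh
    have : g = -1 := by linear_combination hh
    rw [this] at d5
    norm_num at d5
  have g1' : 1 - g ≠ 0 := by intro h; apply g1; linear_combination -h
  have hh2 : h^2 = (g^4+2*g^3+2*g-1)/(g^2*((g-1)*(g+1))) := by
    rw [eq_div_iff (by positivity)]
    linear_combination d5
  have hc : c = (-2/g - g^2 - h^2)/4 := by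
    field_simp
    linear_combination (2)*d2 - g*d3
  obtain ⟨x, hx⟩ : ∃ x, x = (1+g)/(1-g) := ⟨_, rfl⟩
  have x0 : x ≠ 0 := by
    rw [hx]; exact div_ne_zero (by rwa [add_comm]) g1'
  have x1 : x - 1 = 2*g/(1-g) := by rw [hx]; field_simp; ring
  have xm : x + 1 = 2/(1-g) := by rw [hx]; field_simp; ring
  have x1' : x - 1 ≠ 0 := by
    rw [x1]; exact div_ne_zero (mul_ne_zero two_ne_zero g0) g1'
  have xm' : x + 1 ≠ 0 := by
    rw [xm]; exact div_ne_zero two_ne_zero g1'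
  refine ⟨x, x*(x-1)*h, x0, sub_ne_zero.1 x1', fun h => xm' (by rw [h]; ring), ?_,
    mul_ne_zero (mul_ne_zero x0 x1') h0, ?_⟩
  · rw [mul_pow, hh2, x1, hx]
    field_simp
    ring
  · rw [hc, hh2, x1, xm, hx]
    have g3 : 1 + g ≠ 0 := by rwa [add_comm]
    field_simp
    ring

lemma spanPair {K : Type*} [Field K] [CharZero K] [Algebra ℚ K] (hK : Module.finrank ℚ K = 2) {x : K}
    (hx : ∀ q : ℚ, x ≠ q) (z : K) : ∃ a b : ℚ, z = a*x+b := by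
  have hli : LinearIndependent ℚ ![(1:K), x] := by
    rw [LinearIndependent.pair_iff]
    intro s t h
    rw [Algebra.smul_def, Algebra.smul_def, eq_ratCast, eq_ratCast] at h
    have ht : t = 0 := by
      by_contra ht
      have ht' : (t:K) ≠ 0 := by exact_mod_cast ht
      apply hx (-s/t)
      push_cast
      field_simp
      linear_combination h
    subst ht
    refine ⟨?_, rfl⟩
    simpa using h
  have : FiniteDimensional ℚ K := Module.finite_of_finrank_pos (by rw [hK]; norm_num)
  have hsp := hli.span_eq_top_of_card_eq_finrank' (by simp [hK])
  have hz : z ∈ Submodule.span ℚ (Set.range ![(1:K), x]) := by rw [hsp]; trivial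
  rw [Matrix.range_cons, Matrix.range_cons, Matrix.range_empty, Set.union_empty,
    Set.singleton_union, Submodule.mem_span_pair] at hz
  obtain ⟨b, a, h⟩ := hz
  refine ⟨a, b, ?_⟩
  rw [Algebra.smul_def, Algebra.smul_def, eq_ratCast, eq_ratCast] at h
  linear_combination -h

lemma ratX {K : Type*} [Field K] [CharZero K] [Algebra ℚ K] (hK : Module.finrank ℚ K = 2) {x y : K}
    (h : y^2 = -x*(x^2+1)*(x^2-2*x-1)) (hy : y ≠ 0) : ∃ q : ℚ, x = q := by
  by_contra hx
  push Not at hx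
  obtain ⟨s', t', hst⟩ := spanPair hK hx (x^2)
  obtain ⟨a, b, hab⟩ := spanPair hK hx y
  obtain ⟨s, rfl⟩ : ∃ s, s' = -s := ⟨-s', by ring⟩
  obtain ⟨t, rfl⟩ : ∃ t, t' = -t := ⟨-t', by ring⟩
  push_cast at hst
  have hind : ∀ α β : ℚ, (α:K) + β*x = 0 → α = 0 ∧ β = 0 := by
    intro α β he
    have ht : β = 0 := by
      by_contra ht
      have ht' : (β:K) ≠ 0 := by exact_mod_cast ht
      apply hx (-α/β)
      push_cast
      field_simp
      linear_combination he
    subst ht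
    exact ⟨by simpa using he, rfl⟩
  have hns : ¬ IsSquare (s^2-4*t) := by
    rintro ⟨r, hr⟩
    have hr' : ((s:K)^2-4*t) = r*r := by exact_mod_cast hr
    have : (2*x+s-r)*(2*x+s+r) = 0 := by linear_combination 4*hst + hr'
    rcases mul_eq_zero.1 this with h | h
    · apply hx ((r-s)/2); push_cast; field_simp; linear_combination h
    · apply hx ((-r-s)/2); push_cast; field_simp; linear_combination h
  have hx' : x^2+s*x+t = 0 := by linear_combination hst
  obtain ⟨m2, m1⟩ := hind (b^2-a^2*t - t*(-s^3+2*s*t+2*t-2*s^2-2))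
    (2*a*b-a^2*s - (-(s^4-3*s^2*t+t^2)+2*(-s^3+2*s*t)-2*s+1)) (by
      push_cast
      rw [hab] at h
      linear_combination h - ((a:K)^2+x^3-s*x^2-2*x^2+(s^2-t)*x+2*s*x + (2*s*t - s^3 -2*s^2+2*t-2))*hx')
  obtain ⟨rfl, rfl⟩ := core (s := s) (t := t) (a := a) (b := b)
    ⟨by linear_combination m1, by linear_combination m2⟩ hns
  apply hy
  rw [hab]; simp

end G84


/-- If `K` is a quadratic field and `c ∈ K` is such that `f_c(z) = z² + c` has a `K`-rational
point of exact period 4, then there is a rational number `x ∉ {0, 1, -1}` with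
`c = (x² - 4x - 1)(x⁴ + x³ + 2x² - x + 1) / (4x(x-1)²(x+1)²)` and
`K = ℚ(√(-x(x² + 1)(x² - 2x - 1)))`. In particular `c` is rational. -/
theorem graph_8_4_classification (K : IntermediateField ℚ ℂ)
    (hK : Module.finrank ℚ K = 2) (c p : K)
    (hper : (fun z : K => z ^ 2 + c)^[4] p = p)
    (hmin : ∀ k : ℕ, 1 ≤ k → k < 4 → (fun z : K => z ^ 2 + c)^[k] p ≠ p) :
    ∃ x : ℚ, x ≠ 0 ∧ x ≠ 1 ∧ x ≠ -1 ∧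
      c = (((x ^ 2 - 4 * x - 1) * (x ^ 4 + x ^ 3 + 2 * x ^ 2 - x + 1) /
          (4 * x * (x - 1) ^ 2 * (x + 1) ^ 2) : ℚ) : K) ∧
      ∃ z : ℂ, z ^ 2 = ((-x * (x ^ 2 + 1) * (x ^ 2 - 2 * x - 1) : ℚ) : ℂ) ∧ K = ℚ⟮z⟯ := by
  simp only [Function.iterate_succ, Function.iterate_zero, Function.comp_apply, id] at hper
  have hne : p ≠ (p^2+c)^2+c := by
    intro h
    exact hmin 2 (by norm_num) (by norm_num) (by simpa using h.symm)
  obtain ⟨x, y, x0, x1, xm, hxy, hy, hc⟩ := G84.dyn (c := c) (p0 := p) rfl rfl rfl hper.symm hne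
  obtain ⟨q, rfl⟩ := G84.ratX hK hxy hy
  have q0 : q ≠ 0 := by exact_mod_cast x0
  have q1 : q ≠ 1 := by exact_mod_cast x1
  have qm : q ≠ -1 := by
    rintro rfl
    apply xm; push_cast; rfl
  have hyq : ∀ r : ℚ, y ≠ r := by
    rintro r rfl
    have : r^2 = -q*(q^2+1)*(q^2-2*q-1) := by exact_mod_cast hxy
    rcases G84.CQ this with h | h | h
    · exact q0 h
    · exact q1 h
    · exact qm h
  refine ⟨q, q0, q1, qm, by rw [hc]; push_cast; rfl, (y:ℂ), ?_, ?_⟩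
  · have := congrArg (fun z : K => (z:ℂ)) hxy
    push_cast at this ⊢
    exact this
  · apply le_antisymm
    · intro w hw
      obtain ⟨a, b, hab⟩ := G84.spanPair hK hyq ⟨w, hw⟩
      have : w = a*(y:ℂ)+b := by
        have := congrArg (fun z : K => (z:ℂ)) hab
        push_cast at this
        exact this
      rw [this]
      exact add_mem (mul_mem (SubfieldClass.ratCast_mem _ a) (mem_adjoin_simple_self ℚ _)) (SubfieldClass.ratCast_mem _ b)
    · rw [adjoin_simple_le_iff]
      exact y.2
end
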